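/- The third homotopy group π₃(SU(4)/SO(4)) of the coset space SU(4)/SO(4), based at the coset of the identity, is isomorphic to the cyclic group ℤ/2ℤ. -/

import Mathlib

open Matrix
open scoped Topology

noncomputable section

/-- The special unitary group `SU(n)`, i.e. the group of unitary `n×n` complex matrices of
determinant one, as a subgroup of the unitary group (so that its topology is the subspace
topology from the `n×n` complex matrices). -/
def SU (n : ℕ) : Subgroup (Matrix.unitaryGroup (Fin n) ℂ) :=
  (Matrix.detMonoidHom.comp (Matrix.unitaryGroup (Fin n) ℂ).subtype).ker

/-- The special orthogonal group `SO(n)`, regarded as the closed subgroup of `SU(n)` consisting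
of the matrices with real entries (i.e. the image of the real matrices under the entrywise
inclusion `ℝ → ℂ`). -/
def SOinSU (n : ℕ) : Subgroup (SU n) where
  carrier := {A | ∃ B : Matrix (Fin n) (Fin n) ℝ,
    ((A : Matrix.unitaryGroup (Fin n) ℂ) : Matrix (Fin n) (Fin n) ℂ) =
      Complex.ofRealHom.mapMatrix B}
  one_mem' := ⟨1, by simp⟩
  mul_mem' := by
    rintro a b ⟨Ba, hBa⟩ ⟨Bb, hBb⟩
    exact ⟨Ba * Bb, by push_cast [hBa, hBb]; rw [_root_.map_mul]⟩
  inv_mem' := by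
    rintro a ⟨B, hB⟩
    refine ⟨Bᵀ, ?_⟩
    have : ((a⁻¹ : SU n) : Matrix.unitaryGroup (Fin n) ℂ) =
        star (a : Matrix.unitaryGroup (Fin n) ℂ) := rfl
    rw [this]
    ext i j
    have := congrArg (fun M => M j i) hB
    simp only [RingHom.mapMatrix_apply, Matrix.map_apply, Complex.ofRealHom_eq_coe] at this ⊢
    simp [Matrix.conjTranspose_apply, this, Complex.conj_ofReal, Matrix.transpose_apply]


namespace Pi3
open scoped unitInterval Topology.Homotopy
open Set

section Loops

variable {N : Type*} {X Y Z : Type*} [TopologicalSpace X] [TopologicalSpace Y] [TopologicalSpace Z]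
  {x : X} {y : Y} {z : Z}

/-- A generalized loop built from a plain function. -/
def mkLoop (f : (N → I) → X) (hf : Continuous f) (hb : ∀ y ∈ Cube.boundary N, f y = x) :
    Ω^ N X x := ⟨⟨f, hf⟩, hb⟩

@[simp] lemma mkLoop_apply (f : (N → I) → X) (hf : Continuous f)
    (hb : ∀ y ∈ Cube.boundary N, f y = x) (u : N → I) : mkLoop f hf hb u = f u := rfl

lemma loop_continuous (f : Ω^ N X x) : Continuous f := f.1.continuous

lemma loop_bdry (f : Ω^ N X x) {u : N → I} (hu : u ∈ Cube.boundary N) : f u = x := f.2 u hu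

/-- The class of a loop. -/
def cls (f : Ω^ N X x) : HomotopyGroup N X x := Quotient.mk _ f

lemma exists_rep (a : HomotopyGroup N X x) : ∃ f : Ω^ N X x, a = cls f :=
  ⟨a.out, (Quotient.out_eq a).symm⟩

lemma cls_eq_cls {f g : Ω^ N X x} : cls f = cls g ↔ GenLoop.Homotopic f g := Quotient.eq

lemma homotopic_of (f g : Ω^ N X x) (H : I × (N → I) → X) (hH : Continuous H)
    (h0 : ∀ u, H (0, u) = f u) (h1 : ∀ u, H (1, u) = g u)
    (hb : ∀ t, ∀ u ∈ Cube.boundary N, H (t, u) = x) : GenLoop.Homotopic f g :=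
  ⟨⟨⟨⟨H, hH⟩, h0, h1⟩, fun t u hu => (hb t u hu).trans (f.2 u hu).symm⟩⟩

lemma exists_homotopy {f g : Ω^ N X x} (h : GenLoop.Homotopic f g) :
    ∃ H : I × (N → I) → X, Continuous H ∧ (∀ u, H (0, u) = f u) ∧ (∀ u, H (1, u) = g u) ∧
      ∀ t, ∀ u ∈ Cube.boundary N, H (t, u) = x := by
  obtain ⟨H⟩ := h
  exact ⟨H, H.continuous, H.apply_zero, H.apply_one, fun t u hu =>
    (H.prop' t u hu).trans (f.2 u hu)⟩

/-- The pushforward of a generalized loop. -/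
def mapLoop (φ : X → Y) (hφ : Continuous φ) (h : φ x = y) (f : Ω^ N X x) : Ω^ N Y y :=
  mkLoop (fun u => φ (f u)) (hφ.comp (loop_continuous f)) fun u hu => by rw [loop_bdry f hu, h]

@[simp] lemma mapLoop_apply (φ : X → Y) (hφ : Continuous φ) (h : φ x = y) (f : Ω^ N X x) (u) :
    mapLoop φ hφ h f u = φ (f u) := rfl

lemma mapLoop_homotopic (φ : X → Y) (hφ : Continuous φ) (h : φ x = y) {f g : Ω^ N X x}
    (hfg : GenLoop.Homotopic f g) :
    GenLoop.Homotopic (mapLoop φ hφ h f) (mapLoop φ hφ h g) := by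
  obtain ⟨H, hc, h0, h1, hb⟩ := exists_homotopy hfg
  exact homotopic_of _ _ (fun p => φ (H p)) (hφ.comp hc) (fun u => by simp [h0])
    (fun u => by simp [h1]) fun t u hu => by rw [hb t u hu, h]

variable [DecidableEq N]

lemma transAt_apply (i : N) (f g : Ω^ N X x) (t : N → I) :
    GenLoop.transAt i f g t = if (t i : ℝ) ≤ 1 / 2
      then f (Function.update t i <| Set.projIcc 0 1 zero_le_one (2 * t i))
      else g (Function.update t i <| Set.projIcc 0 1 zero_le_one (2 * t i - 1)) := rfl

lemma mapLoop_transAt (φ : X → Y) (hφ : Continuous φ) (h : φ x = y) (i : N) (f g : Ω^ N X x) :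
    mapLoop φ hφ h (GenLoop.transAt i f g) =
      GenLoop.transAt i (mapLoop φ hφ h f) (mapLoop φ hφ h g) := by
  apply GenLoop.ext
  intro t
  rw [mapLoop_apply, transAt_apply, transAt_apply]
  split_ifs <;> rfl

variable [Nonempty N]

lemma mul_cls (i : N) (f g : Ω^ N X x) : cls f * cls g = cls (GenLoop.transAt i g f) :=
  HomotopyGroup.mul_spec

lemma cls_const : cls (GenLoop.const : Ω^ N X x) = 1 := HomotopyGroup.one_def.symm

lemma cls_eq_one {f : Ω^ N X x} : cls f = 1 ↔ GenLoop.Homotopic f GenLoop.const := by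
  rw [← cls_const]; exact cls_eq_cls

/-- The homomorphism induced on homotopy groups by a pointed map. -/
def piHom (φ : X → Y) (hφ : Continuous φ) (h : φ x = y) :
    HomotopyGroup N X x →* HomotopyGroup N Y y where
  toFun := Quotient.map (mapLoop φ hφ h) fun _ _ => mapLoop_homotopic φ hφ h
  map_one' := by
    rw [← cls_const, ← cls_const]
    refine congrArg cls ?_
    apply GenLoop.ext
    intro u
    exact h
  map_mul' a b := by
    obtain ⟨f, rfl⟩ := exists_rep a
    obtain ⟨g, rfl⟩ := exists_rep b
    have i : N := Classical.arbitrary N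
    rw [mul_cls i]
    change cls _ = cls _ * cls _
    rw [mul_cls i, mapLoop_transAt]

lemma piHom_cls (φ : X → Y) (hφ : Continuous φ) (h : φ x = y) (f : Ω^ N X x) :
    piHom φ hφ h (cls f) = cls (mapLoop φ hφ h f) := rfl

lemma piHom_comp (φ : X → Y) (hφ : Continuous φ) (h : φ x = y)
    (ψ : Y → Z) (hψ : Continuous ψ) (h' : ψ y = z) (a : HomotopyGroup N X x) :
    piHom ψ hψ h' (piHom φ hφ h a) = piHom (fun t => ψ (φ t)) (hψ.comp hφ) (by simp [h, h']) a := by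
  obtain ⟨f, rfl⟩ := exists_rep a
  rfl

lemma piHom_id (φ : X → X) (hφ : Continuous φ) (h : φ x = x) (he : ∀ t, φ t = t)
    (a : HomotopyGroup N X x) : piHom φ hφ h a = a := by
  obtain ⟨f, rfl⟩ := exists_rep a
  rw [piHom_cls]
  congr 1
  apply GenLoop.ext
  intro u
  exact he _

/-- Pointed-homotopic maps induce the same homomorphism. -/
lemma piHom_congr_homotopy (φ ψ : X → Y) (hφ : Continuous φ) (h : φ x = y)
    (hψ : Continuous ψ) (h' : ψ x = y) (H : I × X → Y) (hH : Continuous H)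
    (h0 : ∀ u, H (0, u) = φ u) (h1 : ∀ u, H (1, u) = ψ u) (hb : ∀ t, H (t, x) = y)
    (a : HomotopyGroup N X x) : piHom φ hφ h a = piHom ψ hψ h' a := by
  obtain ⟨f, rfl⟩ := exists_rep a
  rw [piHom_cls, piHom_cls, cls_eq_cls]
  refine homotopic_of _ _ (fun p => H (p.1, f p.2)) ?_ (fun u => h0 _) (fun u => h1 _) ?_
  · exact hH.comp (continuous_fst.prodMk ((loop_continuous f).comp continuous_snd))
  · intro t u hu
    rw [loop_bdry f hu, hb]

/-- Mutually inverse (up to pointed homotopy) maps give an isomorphism. -/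
def piEquiv (φ : X → Y) (hφ : Continuous φ) (h : φ x = y) (hbij : Function.Bijective
    (piHom φ hφ h : HomotopyGroup N X x →* HomotopyGroup N Y y)) :
    HomotopyGroup N X x ≃* HomotopyGroup N Y y := MulEquiv.ofBijective _ hbij

end Loops

section Groups

variable {N : Type*} {G : Type*} [TopologicalSpace G] [Group G] [IsTopologicalGroup G]

/-- Pointwise product of loops in a topological group. -/
def mulLoop (f g : Ω^ N G 1) : Ω^ N G 1 :=
  mkLoop (fun u => f u * g u) ((loop_continuous f).mul (loop_continuous g)) fun u hu => by
    rw [loop_bdry f hu, loop_bdry g hu, one_mul]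

@[simp] lemma mulLoop_apply (f g : Ω^ N G 1) (u) : mulLoop f g u = f u * g u := rfl

lemma mulLoop_homotopic {f f' g g' : Ω^ N G 1} (h : GenLoop.Homotopic f f')
    (h' : GenLoop.Homotopic g g') : GenLoop.Homotopic (mulLoop f g) (mulLoop f' g') := by
  obtain ⟨H, hc, h0, h1, hb⟩ := exists_homotopy h
  obtain ⟨H', hc', h0', h1', hb'⟩ := exists_homotopy h'
  exact homotopic_of _ _ (fun p => H p * H' p) (hc.mul hc') (fun u => by simp [h0, h0'])
    (fun u => by simp [h1, h1']) fun t u hu => by simp [hb t u hu, hb' t u hu]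

variable [DecidableEq N] [Nonempty N]

lemma cls_mul_cls (f g : Ω^ N G 1) : cls f * cls g = cls (mulLoop f g) := by
  have i : N := Classical.arbitrary N
  have e1 : GenLoop.transAt i g f =
      mulLoop (GenLoop.transAt i GenLoop.const f) (GenLoop.transAt i g GenLoop.const) := by
    apply GenLoop.ext
    intro t
    rw [mulLoop_apply, transAt_apply, transAt_apply, transAt_apply]
    split_ifs <;> simp
  have e2 : GenLoop.Homotopic (GenLoop.transAt i GenLoop.const f) f := by
    rw [← cls_eq_cls, ← mul_cls i, cls_const, mul_one]
  have e3 : GenLoop.Homotopic (GenLoop.transAt i g GenLoop.const) g := by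
    rw [← cls_eq_cls, ← mul_cls i, cls_const, one_mul]
  rw [mul_cls i, e1, cls_eq_cls]
  exact mulLoop_homotopic e2 e3

/-- Conjugation by an element joined to the identity acts trivially. -/
lemma piHom_conj_eq (γ : I → G) (hγ : Continuous γ) (h1 : γ 0 = 1)
    (a : HomotopyGroup N G 1) :
    piHom (fun t => γ 1 * t * (γ 1)⁻¹) (by fun_prop) (by simp) a = a := by
  rw [piHom_congr_homotopy (fun t => γ 1 * t * (γ 1)⁻¹) id (by fun_prop) (by simp)
    continuous_id rfl (fun p => γ (σ p.1) * p.2 * (γ (σ p.1))⁻¹) ?_ ?_ ?_ ?_]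
  · exact piHom_id _ _ _ (fun _ => rfl) a
  · have : Continuous fun p : I × G => γ (σ p.1) := hγ.comp (by fun_prop)
    exact (this.mul continuous_snd).mul this.inv
  · intro u; simp
  · intro u; simp [h1]
  · intro t; simp

end Groups
end Pi3

namespace Pi3
open scoped unitInterval Topology.Homotopy
open Set

section Lifting

variable {G B : Type*} [TopologicalSpace G] [Group G] [TopologicalSpace B]

/-- A continuous action whose orbit map at `b₀` has a continuous local section on the orbit. -/
structure HasLocalSection (act : G → B → B) (b₀ : B) : Prop where
  cont : Continuous fun p : G × B => act p.1 p.2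
  one : ∀ b, act 1 b = b
  mul : ∀ g h b, act (g * h) b = act g (act h b)
  sec : ∃ U ∈ 𝓝 b₀, ∃ s : B → G, ContinuousOn s (U ∩ range fun g => act g b₀) ∧ s b₀ = 1 ∧
    ∀ b ∈ U, b ∈ (range fun g => act g b₀) → act (s b) b₀ = b

variable {act : G → B → B} {b₀ : B}

lemma HasLocalSection.inv_act (h : HasLocalSection act b₀) (g : G) (b : B) :
    act g⁻¹ (act g b) = b := by rw [← h.mul, inv_mul_cancel, h.one]

lemma HasLocalSection.act_inv (h : HasLocalSection act b₀) (g : G) (b : B) :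
    act g (act g⁻¹ b) = b := by rw [← h.mul, mul_inv_cancel, h.one]

lemma exists_uniform_step {Y : Type*} [TopologicalSpace Y] [CompactSpace Y]
    (V : Set ((I × I) × Y)) (hV : IsOpen V) (hd : ∀ t y, ((t, t), y) ∈ V) :
    ∃ δ : ℝ, 0 < δ ∧ ∀ t t' : I, ∀ y, |(t : ℝ) - t'| ≤ δ → ((t, t'), y) ∈ V := by
  have hK : IsCompact Vᶜ := hV.isClosed_compl.isCompact
  rcases (Vᶜ).eq_empty_or_nonempty with he | hne
  · refine ⟨1, one_pos, fun t t' y _ => ?_⟩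
    rw [compl_empty_iff] at he
    rw [he]; trivial
  · have hc : Continuous fun p : (I × I) × Y => |(p.1.1 : ℝ) - p.1.2| := by fun_prop
    obtain ⟨p, hp, hmin⟩ := hK.exists_isMinOn hne hc.continuousOn
    have hpos : 0 < |(p.1.1 : ℝ) - p.1.2| := by
      rw [abs_pos, sub_ne_zero]
      intro h
      apply hp
      have : p = ((p.1.1, p.1.1), p.2) := by
        ext <;> simp [h]
      rw [this]; exact hd _ _
    refine ⟨|(p.1.1 : ℝ) - p.1.2| / 2, by positivity, fun t t' y h => ?_⟩
    by_contra hn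
    have := hmin hn
    simp only [mem_ofPred_eq] at this
    linarith

theorem HasLocalSection.lift [IsTopologicalGroup G] [CompactSpace G] [T2Space B]
    (h : HasLocalSection act b₀) {Y : Type*} [TopologicalSpace Y] [CompactSpace Y]
    (f : I × Y → B) (hf : Continuous f) (hfo : ∀ p, ∃ g, act g b₀ = f p)
    (F₀ : Y → G) (hF₀ : Continuous F₀) (h0 : ∀ y, act (F₀ y) b₀ = f (0, y)) :
    ∃ F : I × Y → G, Continuous F ∧ (∀ y, F (0, y) = F₀ y) ∧ (∀ p, act (F p) b₀ = f p) ∧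
      ∀ y, (∀ t, f (t, y) = f (0, y)) → ∀ t, F (t, y) = F₀ y := by
  obtain ⟨U, hU, s, hs, hs1, hsec⟩ := h.sec
  set W : Set (B × B) := {p | ∀ g, act g b₀ = p.1 → act g⁻¹ p.2 ∈ interior U} with hW
  have hWo : IsOpen W := by
    have hcl : IsClosed {q : G × (B × B) | act q.1 b₀ = q.2.1 ∧ act q.1⁻¹ q.2.2 ∉ interior U} := by
      refine IsClosed.inter (isClosed_eq ?_ ?_) ?_
      · exact h.cont.comp (continuous_fst.prodMk continuous_const)
      · fun_prop
      · have hc : Continuous fun q : G × (B × B) => act q.1⁻¹ q.2.2 :=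
          h.cont.comp (by fun_prop : Continuous fun q : G × (B × B) => (q.1⁻¹, q.2.2))
        exact (isOpen_interior.preimage hc).isClosed_compl
    have := isClosedMap_snd_of_compactSpace _ hcl
    rw [← isClosed_compl_iff]
    convert this using 1
    ext p
    simp only [hW, mem_compl_iff, mem_ofPred_eq, not_forall, mem_image, Prod.exists,
      exists_eq_right, exists_prop]
  have hWd : ∀ g, (act g b₀, act g b₀) ∈ W := by
    intro g g' hg'
    simp only at hg' ⊢
    rw [← hg', h.inv_act]
    exact mem_interior_iff_mem_nhds.2 hU
  obtain ⟨δ, hδ, hstep⟩ := exists_uniform_step (Y := Y)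
    {q | (f (q.1.1, q.2), f (q.1.2, q.2)) ∈ W} (hWo.preimage (by fun_prop)) (fun t y => by
      obtain ⟨g, hg⟩ := hfo (t, y)
      rw [mem_ofPred_eq, ← hg]; exact hWd g)
  let m : ℕ → I → I := fun i t => ⟨min t (i * δ), le_min t.2.1 (by positivity),
    (min_le_left _ _).trans t.2.2⟩
  have hm : ∀ i, Continuous (m i) := fun i => by
    refine Continuous.subtype_mk ?_ _
    fun_prop
  have hm0 : ∀ i, m i 0 = 0 := fun i => by
    apply Subtype.ext
    simp only [m, Icc.coe_zero]
    exact min_eq_left (by positivity)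
  have hmm : ∀ i t, |(m i t : ℝ) - m (i + 1) t| ≤ δ := by
    intro i t
    simp only [m]
    push_cast
    rw [abs_le]
    constructor <;> rcases min_cases (t : ℝ) (i * δ) with ⟨h1, h2⟩ | ⟨h1, h2⟩ <;>
      rcases min_cases (t : ℝ) ((i + 1) * δ) with ⟨h3, h4⟩ | ⟨h3, h4⟩ <;> rw [h1, h3] <;> nlinarith
  have key : ∀ i : ℕ, ∃ F : I × Y → G, Continuous F ∧ (∀ y, F (0, y) = F₀ y) ∧
      (∀ t y, act (F (t, y)) b₀ = f (m i t, y)) ∧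
      ∀ y, (∀ t, f (t, y) = f (0, y)) → ∀ t, F (t, y) = F₀ y := by
    intro i
    induction i with
    | zero =>
      refine ⟨fun p => F₀ p.2, by fun_prop, fun _ => rfl, fun t y => ?_, fun _ _ _ => rfl⟩
      have : m 0 t = 0 := by
        apply Subtype.ext
        simpa [m] using t.2.1
      rw [this, h0]
    | succ i ih =>
      obtain ⟨F, hF, hF0, hFa, hFc⟩ := ih
      have hcU : ∀ t y, act (F (t, y))⁻¹ (f (m (i + 1) t, y)) ∈ U := fun t y =>
        interior_subset (hstep (m i t) (m (i + 1) t) y (hmm i t) _ (hFa t y))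
      have hcO : ∀ t y, act (F (t, y))⁻¹ (f (m (i + 1) t, y)) ∈ range fun g => act g b₀ := by
        intro t y
        obtain ⟨g, hg⟩ := hfo (m (i + 1) t, y)
        exact ⟨(F (t, y))⁻¹ * g, by simp only [h.mul, hg]⟩
      have hcb : ∀ t y, f (m i t, y) = f (m (i + 1) t, y) →
          act (F (t, y))⁻¹ (f (m (i + 1) t, y)) = b₀ := by
        intro t y e
        rw [← e, ← hFa, h.inv_act]
      refine ⟨fun p => F p * s (act (F p)⁻¹ (f (m (i + 1) p.1, p.2))), ?_, ?_, ?_, ?_⟩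
      · refine hF.mul (hs.comp_continuous ?_ fun p => ⟨hcU p.1 p.2, hcO p.1 p.2⟩)
        have h2 := hm (i + 1)
        exact h.cont.comp (hF.inv.prodMk (hf.comp
          ((h2.comp continuous_fst).prodMk continuous_snd)))
      · intro y
        simp only
        rw [hcb 0 y (by rw [hm0, hm0]), hs1, mul_one, hF0]
      · intro t y
        rw [h.mul, hsec _ (hcU t y) (hcO t y), h.act_inv]
      · intro y hy t
        simp only
        rw [hcb t y (by rw [hy, hy (m (i + 1) t)]), hs1, mul_one, hFc y hy]
  obtain ⟨n, hn⟩ := exists_nat_ge (1 / δ)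
  obtain ⟨F, hF, hF0, hFa, hFc⟩ := key n
  refine ⟨F, hF, hF0, fun p => ?_, hFc⟩
  rw [show p = (p.1, p.2) from rfl, hFa]
  have : m n p.1 = p.1 := by
    apply Subtype.ext
    refine min_eq_left (p.1.2.2.trans ?_)
    rw [div_le_iff₀ hδ] at hn
    exact hn
  rw [this]

end Lifting

section Cubes

/-- Splitting off the first coordinate of a cube. -/
lemma continuous_cons {k : ℕ} : Continuous fun p : I × (Fin k → I) =>
    (Fin.cons p.1 p.2 : Fin (k + 1) → I) := by
  refine continuous_pi fun i => ?_
  refine Fin.cases ?_ (fun j => ?_) i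
  · simpa using continuous_fst
  · simp only [Fin.cons_succ]; fun_prop

lemma continuous_tail {k : ℕ} : Continuous fun u : Fin (k + 1) → I => (Fin.tail u : Fin k → I) :=
  continuous_pi fun i => continuous_apply i.succ

lemma cons_mem_boundary {k : ℕ} {t : I} {u : Fin k → I} :
    (Fin.cons t u : Fin (k + 1) → I) ∈ Cube.boundary (Fin (k + 1)) ↔
      t = 0 ∨ t = 1 ∨ u ∈ Cube.boundary (Fin k) := by
  simp only [Cube.boundary, mem_ofPred_eq, Fin.exists_fin_succ, Fin.cons_zero, Fin.cons_succ,
    or_assoc]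

lemma cons_head_tail {k : ℕ} (u : Fin (k + 1) → I) : (Fin.cons (u 0) (Fin.tail u) : Fin (k+1) → I) = u :=
  Fin.cons_self_tail u

lemma mem_boundary_succ {k : ℕ} {u : Fin (k + 1) → I} :
    u ∈ Cube.boundary (Fin (k + 1)) ↔ u 0 = 0 ∨ u 0 = 1 ∨ Fin.tail u ∈ Cube.boundary (Fin k) := by
  rw [← cons_mem_boundary, cons_head_tail]

end Cubes
end Pi3

namespace Pi3
open scoped unitInterval Topology.Homotopy
open Set

section HtpyIn

variable {Y E : Type*} [TopologicalSpace Y] [TopologicalSpace E]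

/-- `f` and `g` are homotopic through maps into `S`, relative to `A`. -/
def HtpyIn (S : Set E) (A : Set Y) (f g : Y → E) : Prop :=
  ∃ H : I × Y → E, Continuous H ∧ (∀ u, H (0, u) = f u) ∧ (∀ u, H (1, u) = g u) ∧
    (∀ p, H p ∈ S) ∧ ∀ t, ∀ u ∈ A, H (t, u) = f u

variable {S : Set E} {A : Set Y} {f g k : Y → E}

lemma HtpyIn.symm (h : HtpyIn S A f g) : HtpyIn S A g f := by
  obtain ⟨H, hc, h0, h1, hS, hA⟩ := h
  refine ⟨fun p => H (σ p.1, p.2), by fun_prop, fun u => by simp [h1], fun u => by simp [h0],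
    fun p => hS _, fun t u hu => ?_⟩
  simp only
  rw [hA _ u hu, ← h1, hA _ u hu]

lemma HtpyIn.trans (h : HtpyIn S A f g) (h' : HtpyIn S A g k) : HtpyIn S A f k := by
  obtain ⟨H, hc, h0, h1, hS, hA⟩ := h
  obtain ⟨H', hc', h0', h1', hS', hA'⟩ := h'
  refine ⟨fun p => if (p.1 : ℝ) ≤ 1 / 2 then H (projIcc 0 1 zero_le_one (2 * (p.1 : ℝ)), p.2)
    else H' (projIcc 0 1 zero_le_one (2 * (p.1 : ℝ) - 1), p.2), ?_, fun u => ?_, fun u => ?_, fun p => ?_, ?_⟩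
  · refine Continuous.if_le ?_ ?_ (by fun_prop) continuous_const ?_
    · exact hc.comp ((continuous_projIcc.comp (by fun_prop)).prodMk continuous_snd)
    · exact hc'.comp ((continuous_projIcc.comp (by fun_prop)).prodMk continuous_snd)
    · rintro ⟨t, u⟩ ht
      simp only at ht ⊢
      rw [ht]
      norm_num
      rw [h0', h1]
  · simp only [Icc.coe_zero]
    rw [if_pos (by norm_num)]
    simpa using h0 u
  · simp only [Icc.coe_one]
    rw [if_neg (by norm_num)]
    norm_num
    exact h1' u
  · dsimp only
    split_ifs
    exacts [hS _, hS' _]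
  · intro t u hu
    dsimp only
    split_ifs
    · exact hA _ u hu
    · rw [hA' _ u hu, ← h1, hA _ u hu]

lemma HtpyIn.mono {S' : Set E} (h : HtpyIn S A f g) (hS : S ⊆ S') : HtpyIn S' A f g := by
  obtain ⟨H, hc, h0, h1, hS', hA⟩ := h
  exact ⟨H, hc, h0, h1, fun p => hS (hS' p), hA⟩

lemma HtpyIn.map {F : Type*} [TopologicalSpace F] {S' : Set F} (h : HtpyIn S A f g) (φ : E → F)
    (hφ : ContinuousOn φ S) (hS : ∀ x ∈ S, φ x ∈ S') :
    HtpyIn S' A (fun u => φ (f u)) (fun u => φ (g u)) := by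
  obtain ⟨H, hc, h0, h1, hS', hA⟩ := h
  refine ⟨fun p => φ (H p), hφ.comp_continuous hc hS', fun u => by simp only [h0], fun u => by simp only [h1],
    fun p => hS _ (hS' p), fun t u hu => by simp only; rw [hA t u hu]⟩

end HtpyIn

section General

variable {E : Type*} [NormedAddCommGroup E] [NormedSpace ℝ E]

lemma HtpyIn.line {Y : Type*} [TopologicalSpace Y] {S : Set E} {A : Set Y} {f g : Y → E}
    (hf : Continuous f) (hg : Continuous g)
    (hS : ∀ u, ∀ t : I, f u + (t : ℝ) • (g u - f u) ∈ S) (hA : ∀ u ∈ A, f u = g u) :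
    HtpyIn S A f g := by
  refine ⟨fun p => f p.2 + (p.1 : ℝ) • (g p.2 - f p.2), by fun_prop, fun u => by simp,
    fun u => by simp, fun p => hS _ _, fun t u hu => by simp [hA u hu]⟩

lemma exists_smooth_near [FiniteDimensional ℝ E] {k : ℕ} (f : (Fin k → I) → E) (hf : Continuous f)
    {ε : ℝ} (hε : 0 < ε) :
    ∃ P : (Fin k → ℝ) → E, ContDiff ℝ 1 P ∧ ∀ u : Fin k → I, ‖P (fun i => u i) - f u‖ < ε := by
  have huc : UniformContinuous fun x : Fin k → ℝ => f fun i => projIcc 0 1 zero_le_one (x i) := by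
    refine (CompactSpace.uniformContinuous_of_continuous hf).comp ?_
    refine uniformContinuous_pi.2 fun i => ?_
    exact (LipschitzWith.projIcc zero_le_one).uniformContinuous.comp
      (Pi.uniformContinuous_proj _ i)
  obtain ⟨P, hP, hd⟩ := huc.exists_contDiff_dist_le hε
  refine ⟨P, hP.of_le (by exact_mod_cast le_top), fun u => ?_⟩
  have := hd fun i => (u i : ℝ)
  simp only [projIcc_val] at this
  rwa [dist_eq_norm] at this

lemma exists_small_notMem_range {A : Type*} [NormedAddCommGroup A] [NormedSpace ℝ A]
    [FiniteDimensional ℝ A] [FiniteDimensional ℝ E] (φ : A → E) (hφ : ContDiff ℝ 1 φ)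
    (h : Module.finrank ℝ A < Module.finrank ℝ E) {ε : ℝ} (hε : 0 < ε) :
    ∃ w : E, ‖w‖ < ε ∧ w ∉ range φ := by
  obtain ⟨w, hw, hw'⟩ := (hφ.dense_compl_range_of_finrank_lt_finrank h).exists_dist_lt 0 hε
  exact ⟨w, by simpa [dist_eq_norm] using hw', hw⟩

/-- A cube of dimension at least two less than that of `E` is null-homotopic in `E \ 0`. -/
theorem htpyIn_const_of_lt [FiniteDimensional ℝ E] {k : ℕ} (hk : k + 2 ≤ Module.finrank ℝ E) {e : E} (he : e ≠ 0)
    (f : (Fin k → I) → E) (hf : Continuous f) (hne : ∀ u, f u ≠ 0)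
    (hb : ∀ u ∈ Cube.boundary (Fin k), f u = e) :
    HtpyIn {0}ᶜ (Cube.boundary (Fin k)) f (fun _ => e) := by
  have he' : 0 < ‖e‖ := norm_pos_iff.2 he
  obtain ⟨u₀, -, hu₀⟩ := isCompact_univ.exists_isMinOn univ_nonempty hf.norm.continuousOn
  set m := ‖f u₀‖
  have hm : 0 < m := norm_pos_iff.2 (hne u₀)
  have hmin : ∀ u, m ≤ ‖f u‖ := fun u => hu₀ (mem_univ u)
  set ε := min m ‖e‖ / 4 with hεdef
  have hε : 0 < ε := by positivity
  have hεm : 4 * ε ≤ m := by rw [hεdef]; linarith [min_le_left m ‖e‖]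
  have hεe : 4 * ε ≤ ‖e‖ := by rw [hεdef]; linarith [min_le_right m ‖e‖]
  obtain ⟨P, hP, hPf⟩ := exists_smooth_near f hf hε
  obtain ⟨w, hwε, hw⟩ := exists_small_notMem_range
    (fun p : (Fin k → ℝ) × ℝ => p.2 • e - P p.1)
    (by fun_prop) (by simp; omega) hε
  set χ : (Fin k → I) → ℝ := fun u => min 1 (‖f u - e‖ / ε)
  have hχ0 : ∀ u, 0 ≤ χ u := fun u => by positivity
  have hχ1 : ∀ u, χ u ≤ 1 := fun u => min_le_left _ _
  set D : (Fin k → I) → E := fun u => P (fun i => u i) + w - f u with hD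
  have hPc := hP.continuous
  have hDc : Continuous D := by
    have : Continuous fun u : Fin k → I => P (fun i => u i) := hPc.comp (by fun_prop)
    fun_prop
  have hDn : ∀ u, ‖D u‖ ≤ 2 * ε := fun u => by
    have : D u = (P (fun i => u i) - f u) + w := by simp only [hD]; abel
    rw [this]
    linarith [norm_add_le (P (fun i => u i) - f u) w, hPf u]
  have hχD : ∀ u, ‖χ u • D u‖ ≤ 2 * ε := fun u => by
    rw [norm_smul, Real.norm_of_nonneg (hχ0 u)]
    calc _ ≤ 1 * ‖D u‖ := by gcongr; exact hχ1 u
      _ ≤ _ := by linarith [hDn u]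
  set F : (Fin k → I) → E := fun u => f u + χ u • D u with hF
  have hχc : Continuous χ := by fun_prop
  have hFc : Continuous F := by fun_prop
  have hray : ∀ u, ∀ r : ℝ, 0 ≤ r → F u ≠ -(r • e) := by
    intro u r hr h
    by_cases hc : ε ≤ ‖f u - e‖
    · have h1 : χ u = 1 := min_eq_left ((one_le_div hε).2 hc)
      apply hw
      refine ⟨(fun i => u i, -r), ?_⟩
      simp only [hF, h1, hD, one_smul] at h
      have : P (fun i => u i) + w = -(r • e) := by rw [← h]; abel
      simp only [neg_smul, ← this]; abel
    · push Not at hc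
      have h1 : ‖F u - e‖ < 4 * ε := by
        have : F u - e = (f u - e) + χ u • D u := by simp only [hF]; abel
        rw [this]
        linarith [norm_add_le (f u - e) (χ u • D u), hχD u]
      rw [h, show -(r • e) - e = -((r + 1) • e) by rw [add_smul, one_smul]; abel, norm_neg,
        norm_smul, Real.norm_of_nonneg (by positivity)] at h1
      nlinarith
  refine HtpyIn.trans (g := F) (HtpyIn.line hf hFc ?_ ?_) (HtpyIn.line hFc continuous_const ?_ ?_)
  · intro u t h
    rw [mem_singleton_iff, hF, add_sub_cancel_left] at h
    have h2 := norm_neg (f u)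
    rw [← eq_neg_of_add_eq_zero_right h, norm_smul, Real.norm_of_nonneg t.2.1] at h2
    have := hmin u
    nlinarith [hχD u, t.2.2, t.2.1, norm_nonneg (χ u • D u)]
  · intro u hu
    simp [hF, χ, hb u hu]
  · intro u t h
    rw [mem_singleton_iff] at h
    have h2 : (1 - (t : ℝ)) • F u = -((t : ℝ) • e) := by
      rw [eq_neg_iff_add_eq_zero, ← h, smul_sub, sub_smul, one_smul]; abel
    rcases eq_or_lt_of_le t.2.2 with h1 | h1
    · rw [h1] at h2
      simp at h2
      exact he h2
    · have h3 : (0 : ℝ) < 1 - t := by linarith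
      refine hray u (t / (1 - t)) (div_nonneg t.2.1 h3.le) ?_
      rw [div_eq_inv_mul, mul_smul, ← smul_neg, ← h2, smul_smul, inv_mul_cancel₀ h3.ne', one_smul]
  · intro u hu
    simp [hF, χ, hb u hu]

end General
end Pi3

namespace Pi3
open scoped unitInterval Topology.Homotopy
open Set

section Stereo

variable {F : Type*} [NormedAddCommGroup F] [NormedSpace ℝ F]

/-- The complement of the closed upward ray. -/
def offUp (F : Type*) [NormedAddCommGroup F] : Set (F × ℝ) := {x | ¬ (x.1 = 0 ∧ 0 ≤ x.2)}

/-- The complement of the closed downward ray. -/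
def offDown (F : Type*) [NormedAddCommGroup F] : Set (F × ℝ) := {x | ¬ (x.1 = 0 ∧ x.2 ≤ 0)}

/-- Euclidean norm on `F × ℝ`. -/
def enorm2 (x : F × ℝ) : ℝ := √(‖x.1‖ ^ 2 + x.2 ^ 2)

/-- Logarithmic stereographic coordinates on the complement of the upward ray. -/
def stereo (x : F × ℝ) : F × ℝ := ((enorm2 x - x.2)⁻¹ • x.1, Real.log (enorm2 x))

/-- The inverse of `stereo`. -/
def stereoInv (y : F × ℝ) : F × ℝ :=
  ((2 * Real.exp y.2 / (‖y.1‖ ^ 2 + 1)) • y.1, Real.exp y.2 * (‖y.1‖ ^ 2 - 1) / (‖y.1‖ ^ 2 + 1))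

/-- Reflection in the last coordinate. -/
def reflLast (x : F × ℝ) : F × ℝ := (x.1, -x.2)

lemma continuous_reflLast : Continuous (reflLast : F × ℝ → F × ℝ) := by
  unfold reflLast; fun_prop

lemma continuous_enorm2 : Continuous (enorm2 : F × ℝ → ℝ) := by
  unfold enorm2; fun_prop

lemma sub_pos_of_offUp {x : F × ℝ} (hx : x ∈ offUp F) : 0 < enorm2 x - x.2 := by
  rw [sub_pos]
  rcases lt_or_ge x.2 0 with h | h
  · exact h.trans_le (Real.sqrt_nonneg _)
  · have h1 : x.1 ≠ 0 := fun h1 => hx ⟨h1, h⟩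
    have h2 : 0 < ‖x.1‖ := norm_pos_iff.2 h1
    exact Real.lt_sqrt_of_sq_lt (by nlinarith)

lemma enorm2_pos {x : F × ℝ} (hx : x ∈ offUp F) : 0 < enorm2 x := by
  refine Real.sqrt_pos.2 ?_
  by_contra h
  have h2 : ‖x.1‖ ^ 2 + x.2 ^ 2 = 0 := le_antisymm (not_lt.1 h) (by positivity)
  have h3 : x.2 = 0 := by nlinarith [sq_nonneg ‖x.1‖]
  have h4 : ‖x.1‖ = 0 := by nlinarith [sq_nonneg ‖x.1‖]
  exact hx ⟨norm_eq_zero.1 h4, h3.ge⟩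

lemma continuousOn_stereo : ContinuousOn (stereo : F × ℝ → F × ℝ) (offUp F) := by
  have hc := (continuous_enorm2 (F := F))
  refine ContinuousOn.prodMk (ContinuousOn.smul (ContinuousOn.inv₀ (by fun_prop) ?_) (by fun_prop))
    (ContinuousOn.log hc.continuousOn ?_)
  · intro x hx; exact (sub_pos_of_offUp hx).ne'
  · intro x hx; exact (enorm2_pos hx).ne'

lemma continuous_stereoInv : Continuous (stereoInv : F × ℝ → F × ℝ) := by
  have h : ∀ y : F × ℝ, ‖y.1‖ ^ 2 + 1 ≠ 0 := fun y => by positivity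
  unfold stereoInv
  refine Continuous.prodMk ?_ ?_
  · exact (Continuous.div (by fun_prop) (by fun_prop) h).smul continuous_fst
  · exact Continuous.div (by fun_prop) (by fun_prop) h

lemma stereoInv_mem (y : F × ℝ) : stereoInv y ∈ offUp F := by
  rintro ⟨h1, h2⟩
  simp only [stereoInv, smul_eq_zero] at h1 h2
  have h0 : y.1 = 0 := by
    rcases h1 with h1 | h1
    · exact absurd h1 (by positivity)
    · exact h1
  rw [h0] at h2
  norm_num at h2
  exact absurd h2 (not_le.2 (Real.exp_pos _))

lemma stereoInv_stereo {x : F × ℝ} (hx : x ∈ offUp F) : stereoInv (stereo x) = x := by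
  have h1 := sub_pos_of_offUp hx
  have h2 := enorm2_pos hx
  have h3 : enorm2 x ^ 2 = ‖x.1‖ ^ 2 + x.2 ^ 2 := Real.sq_sqrt (by positivity)
  have h4 : ‖(enorm2 x - x.2)⁻¹ • x.1‖ ^ 2 = (enorm2 x + x.2) / (enorm2 x - x.2) := by
    rw [norm_smul, mul_pow, norm_inv, Real.norm_of_nonneg h1.le]
    field_simp
    nlinarith
  have h5 : (enorm2 x + x.2) / (enorm2 x - x.2) + 1 = 2 * enorm2 x / (enorm2 x - x.2) := by
    field_simp; ring
  have h6 : (enorm2 x + x.2) / (enorm2 x - x.2) - 1 = 2 * x.2 / (enorm2 x - x.2) := by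
    field_simp; ring
  simp only [stereoInv, stereo, Real.exp_log h2, h4, h5, h6]
  refine Prod.ext ?_ ?_
  · rw [smul_smul]
    convert one_smul ℝ x.1 using 2
    field_simp
  · dsimp only
    field_simp

lemma reflLast_mem {x : F × ℝ} : reflLast x ∈ offUp F ↔ x ∈ offDown F := by
  simp [reflLast, offUp, offDown]

lemma reflLast_mem' {x : F × ℝ} : reflLast x ∈ offDown F ↔ x ∈ offUp F := by
  simp [reflLast, offUp, offDown]

lemma reflLast_reflLast (x : F × ℝ) : reflLast (reflLast x) = x := by simp [reflLast]

lemma isOpen_offUp : IsOpen (offUp F) := by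
  have : IsClosed {x : F × ℝ | x.1 = 0 ∧ 0 ≤ x.2} :=
    (isClosed_eq continuous_fst continuous_const).inter
      (isClosed_le continuous_const continuous_snd)
  exact this.isOpen_compl

lemma isOpen_offDown : IsOpen (offDown F) := by
  have : IsClosed {x : F × ℝ | x.1 = 0 ∧ x.2 ≤ 0} :=
    (isClosed_eq continuous_fst continuous_const).inter
      (isClosed_le continuous_snd continuous_const)
  exact this.isOpen_compl

lemma mem_offUp {x : F × ℝ} (h : x.1 ≠ 0) : x ∈ offUp F := fun h' => h h'.1

lemma mem_offDown {x : F × ℝ} (h : x.1 ≠ 0) : x ∈ offDown F := fun h' => h h'.1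

lemma ne_zero_of_offUp {x : F × ℝ} (h : x ∈ offUp F) : x ∈ ({0}ᶜ : Set (F × ℝ)) := by
  intro h'
  rw [mem_singleton_iff] at h'
  exact h (by simp [h'])

lemma ne_zero_of_offDown {x : F × ℝ} (h : x ∈ offDown F) : x ∈ ({0}ᶜ : Set (F × ℝ)) := by
  intro h'
  rw [mem_singleton_iff] at h'
  exact h (by simp [h'])

end Stereo

section Glue

/-- Fillings in a coordinate patch modelled on a vector space are unique up to homotopy. -/
lemma exists_half_glue {E V Y : Type*} [TopologicalSpace E] [TopologicalSpace Y]
    [NormedAddCommGroup V] [NormedSpace ℝ V] {S : Set E} {c : E → V} {ci : V → E}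
    (hc : ContinuousOn c S) (hci : Continuous ci) (hcS : ∀ v, ci v ∈ S) (hr : ∀ x ∈ S, ci (c x) = x)
    {g₀ g₁ M : I × Y → E} (h₀ : Continuous g₀) (h₁ : Continuous g₁) (hM : Continuous M)
    (hS₀ : ∀ p, g₀ p ∈ S) (hS₁ : ∀ p, g₁ p ∈ S) (hSM : ∀ p, M p ∈ S)
    (hM₀ : ∀ y, M (0, y) = g₀ (1, y)) (hM₁ : ∀ y, M (1, y) = g₁ (1, y)) :
    ∃ K : I × (I × Y) → E, Continuous K ∧ (∀ p, K (0, p) = g₀ p) ∧ (∀ p, K (1, p) = g₁ p) ∧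
      (∀ p, K p ∈ S) ∧ (∀ s y, K (s, (1, y)) = M (s, y)) ∧
      (∀ y b, g₀ (0, y) = b → g₁ (0, y) = b → ∀ s, K (s, (0, y)) = b) ∧
      (∀ y b, (∀ t, g₀ (t, y) = b) → (∀ t, g₁ (t, y) = b) → (∀ s, M (s, y) = b) →
        ∀ s t, K (s, (t, y)) = b) := by
  have k₀ : Continuous fun p => c (g₀ p) := hc.comp_continuous h₀ hS₀
  have k₁ : Continuous fun p => c (g₁ p) := hc.comp_continuous h₁ hS₁
  have kM : Continuous fun p => c (M p) := hc.comp_continuous hM hSM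
  set L : I → I → Y → V := fun s t y => c (g₀ (t, y)) + (s : ℝ) • (c (g₁ (t, y)) - c (g₀ (t, y)))
    with hL
  have hLc : Continuous fun q : I × (I × Y) => L q.1 q.2.1 q.2.2 := by
    have a : Continuous fun q : I × (I × Y) => c (g₀ (q.2.1, q.2.2)) := k₀.comp (by fun_prop)
    have b : Continuous fun q : I × (I × Y) => c (g₁ (q.2.1, q.2.2)) := k₁.comp (by fun_prop)
    exact a.add ((continuous_subtype_val.comp continuous_fst).smul (b.sub a))
  refine ⟨fun q => ci (L q.1 q.2.1 q.2.2 + (q.2.1 : ℝ) • (c (M (q.1, q.2.2)) - L q.1 1 q.2.2)),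
    ?_, ?_, ?_, fun p => hcS _, ?_, ?_, ?_⟩
  · have a : Continuous fun q : I × (I × Y) => c (M (q.1, q.2.2)) := kM.comp (by fun_prop)
    have b : Continuous fun q : I × (I × Y) => L q.1 1 q.2.2 :=
      hLc.comp (by fun_prop : Continuous fun q : I × (I × Y) => (q.1, ((1 : I), q.2.2)))
    exact hci.comp (hLc.add ((continuous_subtype_val.comp
      (continuous_fst.comp continuous_snd)).smul (a.sub b)))
  · rintro ⟨t, y⟩
    simp [hL, hM₀, hr _ (hS₀ _)]
  · rintro ⟨t, y⟩
    simp [hL, hM₁, hr _ (hS₁ _)]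
  · intro s y
    simp [hr _ (hSM _)]
  · intro y b e₀ e₁ s
    simp only [Icc.coe_zero, zero_smul, add_zero, hL, e₀, e₁, sub_self, smul_zero]
    rw [hr _ (e₀ ▸ hS₀ _)]
  · intro y b e₀ e₁ e₂ s t
    simp only [hL, e₀, e₁, e₂, sub_self, smul_zero, add_zero]
    rw [hr _ (e₀ 0 ▸ hS₀ _)]

variable {F : Type*} [NormedAddCommGroup F] [NormedSpace ℝ F] {Y : Type*} [TopologicalSpace Y]

/-- `t ↦ t / 2`. -/
def lowHalf (t : I) : I := ⟨t / 2, by have := t.2.1; positivity, by linarith [t.2.2]⟩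

/-- `t ↦ 1 - t / 2`. -/
def highHalf (t : I) : I := σ (lowHalf t)

lemma continuous_lowHalf : Continuous lowHalf := Continuous.subtype_mk (by fun_prop) _

lemma continuous_highHalf : Continuous highHalf := by
  have := continuous_lowHalf
  unfold highHalf; fun_prop

/-- `t ↦ min (2 * t) 1`. -/
def dbl (t : I) : I := projIcc 0 1 zero_le_one (2 * t)

/-- `t ↦ min (2 - 2 * t) 1`. -/
def dbl' (t : I) : I := projIcc 0 1 zero_le_one (2 - 2 * t)

@[fun_prop] lemma continuous_dbl : Continuous dbl := continuous_projIcc.comp (by fun_prop)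

@[fun_prop] lemma continuous_dbl' : Continuous dbl' := continuous_projIcc.comp (by fun_prop)

lemma lowHalf_dbl {t : I} (ht : (t : ℝ) ≤ 1 / 2) : lowHalf (dbl t) = t := by
  apply Subtype.ext
  simp only [lowHalf, dbl]
  rw [projIcc_of_mem zero_le_one (x := 2 * (t : ℝ)) ⟨by linarith [t.2.1], by linarith⟩]
  simp

lemma highHalf_dbl {t : I} (ht : 1 / 2 ≤ (t : ℝ)) : highHalf (dbl' t) = t := by
  apply Subtype.ext
  simp only [highHalf, lowHalf, dbl', unitInterval.coe_symm_eq]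
  rw [projIcc_of_mem zero_le_one (x := 2 - 2 * (t : ℝ)) ⟨by linarith [t.2.2], by linarith⟩]
  simp only
  ring

lemma dbl_zero : dbl 0 = 0 := by simp [dbl]
lemma dbl'_one : dbl' 1 = 0 := by simp [dbl']
lemma dbl_half {t : I} (ht : (t : ℝ) = 1 / 2) : dbl t = 1 := by
  simp [dbl, ht]
lemma dbl'_half {t : I} (ht : (t : ℝ) = 1 / 2) : dbl' t = 1 := by
  rw [dbl', ht]; norm_num

/-- The midpoint of the unit interval. -/
def mid : I := ⟨1 / 2, by norm_num, by norm_num⟩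

lemma lowHalf_one : lowHalf 1 = mid := by apply Subtype.ext; simp [lowHalf, mid]
lemma highHalf_one : highHalf 1 = mid := by
  apply Subtype.ext; simp only [highHalf, lowHalf, mid, unitInterval.coe_symm_eq]; norm_num
lemma lowHalf_zero : lowHalf 0 = 0 := by apply Subtype.ext; simp [lowHalf]
lemma highHalf_zero : highHalf 0 = 1 := by
  apply Subtype.ext; simp [highHalf, lowHalf]
lemma lowHalf_le (t : I) : lowHalf t ≤ mid := by
  change (t : ℝ) / 2 ≤ 1 / 2; linarith [t.2.2]
lemma le_highHalf (t : I) : mid ≤ highHalf t := by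
  change (1 / 2 : ℝ) ≤ 1 - (t : ℝ) / 2; linarith [t.2.2]

theorem htpyIn_of_middle {A : Set Y} {b : F × ℝ} {f₀ f₁ M : I × Y → F × ℝ}
    (h₀ : Continuous f₀) (h₁ : Continuous f₁) (hM : Continuous M)
    (hl₀ : ∀ t y, t ≤ mid → f₀ (t, y) ∈ offUp F) (hu₀ : ∀ t y, mid ≤ t → f₀ (t, y) ∈ offDown F)
    (hl₁ : ∀ t y, t ≤ mid → f₁ (t, y) ∈ offUp F) (hu₁ : ∀ t y, mid ≤ t → f₁ (t, y) ∈ offDown F)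
    (hb₀ : ∀ y, f₀ (0, y) = b ∧ f₀ (1, y) = b) (hb₁ : ∀ y, f₁ (0, y) = b ∧ f₁ (1, y) = b)
    (hA₀ : ∀ t, ∀ y ∈ A, f₀ (t, y) = b) (hA₁ : ∀ t, ∀ y ∈ A, f₁ (t, y) = b)
    (hMn : ∀ p, (M p).1 ≠ 0) (hMA : ∀ s, ∀ y ∈ A, M (s, y) = b)
    (hM₀ : ∀ y, M (0, y) = f₀ (mid, y)) (hM₁ : ∀ y, M (1, y) = f₁ (mid, y)) :
    HtpyIn {0}ᶜ {p : I × Y | p.1 = 0 ∨ p.1 = 1 ∨ p.2 ∈ A} f₀ f₁ := by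
  have cl := continuous_lowHalf
  have ch := continuous_highHalf
  obtain ⟨K, hK, hK0, hK1, hKS, hKM, hKb, hKA⟩ := exists_half_glue (S := offUp F)
    (g₀ := fun p : I × Y => f₀ (lowHalf p.1, p.2)) (g₁ := fun p : I × Y => f₁ (lowHalf p.1, p.2))
    (M := M) continuousOn_stereo continuous_stereoInv stereoInv_mem (fun x => stereoInv_stereo)
    (by fun_prop) (by fun_prop) hM (fun p => hl₀ _ _ (lowHalf_le _))
    (fun p => hl₁ _ _ (lowHalf_le _)) (fun p => mem_offUp (hMn p))
    (fun y => by simp [hM₀, lowHalf_one]) (fun y => by simp [hM₁, lowHalf_one])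
  obtain ⟨K', hK', hK0', hK1', hKS', hKM', hKb', hKA'⟩ := exists_half_glue (S := offDown F)
    (g₀ := fun p : I × Y => f₀ (highHalf p.1, p.2))
    (g₁ := fun p : I × Y => f₁ (highHalf p.1, p.2))
    (M := M) (c := fun x => stereo (reflLast x)) (ci := fun x => reflLast (stereoInv x))
    (continuousOn_stereo.comp continuous_reflLast.continuousOn fun x hx => reflLast_mem.2 hx)
    (continuous_reflLast.comp continuous_stereoInv)
    (fun v => reflLast_mem'.2 (stereoInv_mem v))
    (fun x hx => by rw [stereoInv_stereo (reflLast_mem.2 hx), reflLast_reflLast])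
    (by fun_prop) (by fun_prop) hM (fun p => hu₀ _ _ (le_highHalf _))
    (fun p => hu₁ _ _ (le_highHalf _)) (fun p => mem_offDown (hMn p))
    (fun y => by simp [hM₀, highHalf_one]) (fun y => by simp [hM₁, highHalf_one])
  refine ⟨fun q => if (q.2.1 : ℝ) ≤ 1 / 2 then K (q.1, (dbl q.2.1, q.2.2))
    else K' (q.1, (dbl' q.2.1, q.2.2)), ?_, ?_, ?_, ?_, ?_⟩
  · refine Continuous.if_le (by fun_prop) (by fun_prop) (by fun_prop) continuous_const ?_
    intro q hq
    rw [dbl_half hq, dbl'_half hq, hKM, hKM']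
  · rintro ⟨t, y⟩
    dsimp only
    split_ifs with h
    · rw [hK0, lowHalf_dbl h]
    · rw [hK0', highHalf_dbl (not_le.1 h).le]
  · rintro ⟨t, y⟩
    dsimp only
    split_ifs with h
    · rw [hK1, lowHalf_dbl h]
    · rw [hK1', highHalf_dbl (not_le.1 h).le]
  · intro q
    dsimp only
    split_ifs
    · exact ne_zero_of_offUp (hKS _)
    · exact ne_zero_of_offDown (hKS' _)
  · rintro s ⟨t, y⟩ (rfl | rfl | hy)
    · dsimp only
      rw [(hb₀ y).1, if_pos (by simp), dbl_zero]
      exact hKb y b (by simp [lowHalf_zero, hb₀]) (by simp [lowHalf_zero, hb₁]) s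
    · dsimp only
      rw [(hb₀ y).2, if_neg (by norm_num), dbl'_one]
      exact hKb' y b (by simp [highHalf_zero, hb₀]) (by simp [highHalf_zero, hb₁]) s
    · dsimp only at hy ⊢
      rw [hA₀ t y hy]
      split_ifs
      · exact hKA y b (fun t => hA₀ _ y hy) (fun t => hA₁ _ y hy) (fun s => hMA s y hy) _ _
      · exact hKA' y b (fun t => hA₀ _ y hy) (fun t => hA₁ _ y hy) (fun s => hMA s y hy) _ _

/-- The suspension path from `b` through `x` back to `b`. -/
def suspPath (b x : F × ℝ) (t : I) : F × ℝ :=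
  if (t : ℝ) ≤ 1 / 2 then stereoInv (stereo b + (dbl t : ℝ) • (stereo x - stereo b))
  else reflLast (stereoInv (stereo (reflLast b) +
    (dbl' t : ℝ) • (stereo (reflLast x) - stereo (reflLast b))))

variable {b x : F × ℝ}

lemma suspPath_zero (hb : b.1 ≠ 0) : suspPath b x 0 = b := by
  rw [suspPath, if_pos (by simp), dbl_zero]
  simp [stereoInv_stereo (mem_offUp hb)]

lemma suspPath_one (hb : b.1 ≠ 0) : suspPath b x 1 = b := by
  rw [suspPath, if_neg (by norm_num), dbl'_one]
  simp [stereoInv_stereo (reflLast_mem.2 (mem_offDown hb)), reflLast_reflLast]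

lemma suspPath_self (hb : b.1 ≠ 0) (t : I) : suspPath b b t = b := by
  rw [suspPath]
  simp [stereoInv_stereo (mem_offUp hb), stereoInv_stereo (reflLast_mem.2 (mem_offDown hb)),
    reflLast_reflLast]

lemma suspPath_mid (hx : x.1 ≠ 0) : suspPath b x mid = x := by
  rw [suspPath, if_pos (by simp [mid]), dbl_half (by simp [mid])]
  simp [stereoInv_stereo (mem_offUp hx)]

lemma suspPath_low {t : I} (ht : t ≤ mid) : suspPath b x t ∈ offUp F := by
  rw [suspPath, if_pos (show (t : ℝ) ≤ 1 / 2 from ht)]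
  exact stereoInv_mem _

lemma suspPath_high (hx : x.1 ≠ 0) {t : I} (ht : mid ≤ t) : suspPath b x t ∈ offDown F := by
  rcases eq_or_lt_of_le ht with rfl | h
  · rw [suspPath_mid hx]; exact mem_offDown hx
  · rw [suspPath, if_neg (not_le.2 (show (1 / 2 : ℝ) < t from h))]
    exact reflLast_mem'.2 (stereoInv_mem _)

lemma continuous_suspPath {m : Y → F × ℝ} (hm : Continuous m) (hx : ∀ y, (m y).1 ≠ 0) :
    Continuous fun p : I × Y => suspPath b (m p.2) p.1 := by
  have h1 : Continuous fun p : I × Y => stereo (m p.2) :=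
    continuousOn_stereo.comp_continuous (by fun_prop) fun p => mem_offUp (hx p.2)
  have h2 : Continuous fun p : I × Y => stereo (reflLast (m p.2)) :=
    continuousOn_stereo.comp_continuous (continuous_reflLast.comp (by fun_prop))
      fun p => reflLast_mem.2 (mem_offDown (hx p.2))
  have h3 := continuous_stereoInv (F := F)
  have h4 := continuous_reflLast (F := F)
  refine Continuous.if_le (by fun_prop) (by fun_prop) (by fun_prop) continuous_const ?_
  intro p hp
  rw [dbl_half hp, dbl'_half hp]
  simp [stereoInv_stereo (mem_offUp (hx p.2)),
    stereoInv_stereo (reflLast_mem.2 (mem_offDown (hx p.2))), reflLast_reflLast]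

end Glue
end Pi3

namespace Pi3
open scoped unitInterval Topology.Homotopy
open Set

section Separation

variable {F : Type*} [NormedAddCommGroup F] [NormedSpace ℝ F] [FiniteDimensional ℝ F]

lemma isClosed_boundary (k : ℕ) : IsClosed (Cube.boundary (Fin k)) := by
  have : Cube.boundary (Fin k) = ⋃ i, ({y | y i = 0} ∪ {y | y i = 1}) := by
    ext y; simp [Cube.boundary]
  rw [this]
  refine isClosed_iUnion_of_finite fun i => IsClosed.union ?_ ?_
  · exact isClosed_eq (continuous_apply i) continuous_const
  · exact isClosed_eq (continuous_apply i) continuous_const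

lemma exists_generic_affine {j : ℕ} (hj : j + 3 ≤ 2 * Module.finrank ℝ F)
    (P : ℝ × (Fin j → ℝ) → F) (hP : ContDiff ℝ 1 P) {ε : ℝ} (hε : 0 < ε) :
    ∃ w w' : F, ‖w‖ < ε ∧ ‖w'‖ < ε ∧ ∀ y, ∀ s t : ℝ, s < t →
      ¬ (P (s, y) + w + s • w' = 0 ∧ P (t, y) + w + t • w' = 0) := by
  let T := (ℝ × ℝ) × (Fin j → ℝ)
  let Om : Set T := {q | q.1.1 < q.1.2}
  let d : T → F := fun q => (q.1.2 - q.1.1)⁻¹ • (P (q.1.1, q.2) - P (q.1.2, q.2))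
  let φ : T → F × F := fun q => (-P (q.1.1, q.2) - q.1.1 • d q, d q)
  have hd : ContDiffOn ℝ 1 d Om := by
    refine ContDiffOn.smul (ContDiffOn.inv (by fun_prop) fun q hq => ?_) ?_
    · exact (sub_pos.2 hq).ne'
    · exact ContDiff.contDiffOn (by fun_prop)
  have hφ : ContDiffOn ℝ 1 φ Om := by
    refine ContDiffOn.prodMk (ContDiffOn.sub ?_ (ContDiffOn.smul ?_ hd)) hd
    · exact ContDiff.contDiffOn (by fun_prop)
    · exact ContDiff.contDiffOn (by fun_prop)
  have hconv : Convex ℝ Om := by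
    rintro a (ha : a.1.1 < a.1.2) b (hb : b.1.1 < b.1.2) x y hx hy hxy
    change x * a.1.1 + y * b.1.1 < x * a.1.2 + y * b.1.2
    rcases eq_or_lt_of_le hx with rfl | hx
    · have : y = 1 := by linarith
      subst this; linarith
    · nlinarith
  have hdim : dimH Om < Module.finrank ℝ (F × F) := by
    refine (dimH_mono (subset_univ Om)).trans_lt ?_
    rw [Real.dimH_univ_eq_finrank]
    simp only [T, Module.finrank_prod, Module.finrank_self, Module.finrank_fin_fun]
    exact_mod_cast by omega
  obtain ⟨⟨w, w'⟩, hw, hw'⟩ :=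
    (hφ.dense_compl_image_of_dimH_lt_finrank hconv Subset.rfl hdim).exists_dist_lt 0 hε
  rw [dist_comm, dist_zero_right] at hw'
  refine ⟨w, w', (norm_fst_le (w, w')).trans_lt hw', (norm_snd_le (w, w')).trans_lt hw', ?_⟩
  rintro y s t hst ⟨h1, h2⟩
  refine hw ⟨((s, t), y), hst, ?_⟩
  have hts : t - s ≠ 0 := (sub_pos.2 hst).ne'
  have hd' : d ((s, t), y) = w' := by
    have : P (s, y) - P (t, y) = (t - s) • w' := by
      have e1 : P (s, y) = -(s • w') - w := by rw [← sub_eq_zero, ← h1]; abel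
      have e2 : P (t, y) = -(t • w') - w := by rw [← sub_eq_zero, ← h2]; abel
      rw [e1, e2, sub_smul]; abel
    simp only [d, this, smul_smul, inv_mul_cancel₀ hts, one_smul]
  simp only [φ, hd', Prod.mk.injEq, and_true]
  rw [← sub_eq_zero, ← neg_eq_zero, ← h1]; abel

lemma exists_pos_margin {Y E : Type*} [TopologicalSpace Y] [NormedAddCommGroup E]
    {K : Set Y} (hK : IsCompact K) {f : Y → E} (hf : Continuous f) {U : Set E} (hU : IsOpen U)
    (h : ∀ y ∈ K, f y ∈ U) : ∃ δ > 0, ∀ y ∈ K, ∀ x, ‖x - f y‖ < δ → x ∈ U := by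
  obtain ⟨δ, hδ, h'⟩ := (hK.image hf).exists_thickening_subset_open hU (by
    rintro _ ⟨y, hy, rfl⟩; exact h y hy)
  refine ⟨δ, hδ, fun y hy x hx => h' ?_⟩
  rw [Metric.mem_thickening_iff]
  exact ⟨f y, mem_image_of_mem f hy, by rwa [dist_eq_norm]⟩

theorem exists_separation {j : ℕ} (hj : j + 3 ≤ 2 * Module.finrank ℝ F)
    (H : I × (Fin j → I) → F × ℝ) (hH : Continuous H) {b : F × ℝ} (hb : b.1 ≠ 0)
    (hne : ∀ p, H p ≠ 0) (hHb : ∀ y, H (0, y) = b ∧ H (1, y) = b)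
    (hl : ∀ y ∈ Cube.boundary (Fin j), ∀ t ≤ mid, H (t, y) ∈ offUp F)
    (hu : ∀ y ∈ Cube.boundary (Fin j), ∀ t, mid ≤ t → H (t, y) ∈ offDown F)
    {ε : ℝ} (hε : 0 < ε) :
    ∃ (H' : I × (Fin j → I) → F × ℝ) (h : (Fin j → I) → I), Continuous H' ∧ Continuous h ∧
      (∀ p, ‖H' p - H p‖ < ε) ∧ (∀ t y, t ≤ h y → H' (t, y) ∈ offUp F) ∧
      (∀ t y, h y ≤ t → H' (t, y) ∈ offDown F) ∧
      (∀ y ∈ Cube.boundary (Fin j), h y = mid ∧ ∀ t, H' (t, y) = H (t, y)) ∧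
      ∀ y, H' (0, y) = b ∧ H' (1, y) = b := by
  -- margins
  obtain ⟨δ₁, hδ₁, hm₁⟩ := exists_pos_margin
    (K := {p : I × (Fin j → I) | p.1 ≤ mid ∧ p.2 ∈ Cube.boundary (Fin j)})
    (((isClosed_le continuous_fst continuous_const).inter
      ((isClosed_boundary j).preimage continuous_snd)).isCompact) hH isOpen_offUp
    (fun p hp => hl p.2 hp.2 p.1 hp.1)
  obtain ⟨δ₂, hδ₂, hm₂⟩ := exists_pos_margin
    (K := {p : I × (Fin j → I) | mid ≤ p.1 ∧ p.2 ∈ Cube.boundary (Fin j)})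
    (((isClosed_le continuous_const continuous_fst).inter
      ((isClosed_boundary j).preimage continuous_snd)).isCompact) hH isOpen_offDown
    (fun p hp => hu p.2 hp.2 p.1 hp.1)
  obtain ⟨δ₃, hδ₃, hm₃⟩ := exists_pos_margin isCompact_univ hH
    (isOpen_compl_singleton (x := (0 : F × ℝ))) (fun p _ => hne p)
  have hb' : 0 < ‖b.1‖ := norm_pos_iff.2 hb
  obtain ⟨η, hη, hη₁, hη₂, hη₃, hηε, hηb⟩ : ∃ η > 0, η < δ₁ ∧ η < δ₂ ∧ η < δ₃ ∧ η < ε ∧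
      2 * η < ‖b.1‖ := by
    refine ⟨min (min δ₁ δ₂) (min δ₃ (min ε ‖b.1‖)) / 3, by positivity, ?_⟩
    have e1 := min_le_left (min δ₁ δ₂) (min δ₃ (min ε ‖b.1‖))
    have e2 := min_le_right (min δ₁ δ₂) (min δ₃ (min ε ‖b.1‖))
    have e3 := min_le_left δ₁ δ₂
    have e4 := min_le_right δ₁ δ₂
    have e5 := min_le_left δ₃ (min ε ‖b.1‖)
    have e6 := min_le_right δ₃ (min ε ‖b.1‖)
    have e7 := min_le_left ε ‖b.1‖
    have e8 := min_le_right ε ‖b.1‖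
    have e9 : 0 < min (min δ₁ δ₂) (min δ₃ (min ε ‖b.1‖)) := by positivity
    refine ⟨?_, ?_, ?_, ?_, ?_⟩ <;> linarith
  -- the perturbation
  obtain ⟨P₀, hP₀, hP₀H⟩ := exists_smooth_near (k := j + 1)
    (fun u => (H (u 0, Fin.tail u)).1)
    ((hH.comp ((continuous_apply 0).prodMk continuous_tail)).fst) (ε := η / 3) (by positivity)
  let P : ℝ × (Fin j → ℝ) → F := fun q => P₀ (Fin.cons q.1 q.2)
  have hP : ContDiff ℝ 1 P := by
    refine hP₀.comp (contDiff_pi.2 fun i => ?_)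
    refine Fin.cases ?_ (fun i => ?_) i
    · simpa using contDiff_fst
    · simp only [Fin.cons_succ]; fun_prop
  have hPH : ∀ (t : I) (y : Fin j → I), ‖P (t, fun i => y i) - (H (t, y)).1‖ < η / 3 := by
    intro t y
    have := hP₀H (Fin.cons t y)
    simp only [Fin.cons_zero, Fin.tail_cons] at this
    convert this using 4
    ext i
    refine Fin.cases ?_ (fun i => ?_) i <;> simp
  obtain ⟨w, w', hw, hw', hgen⟩ := exists_generic_affine hj P hP (ε := η / 3) (by positivity)
  have hPc : Continuous fun p : I × (Fin j → I) => P (p.1, fun i => p.2 i) :=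
    hP.continuous.comp (by fun_prop)
  let D : I × (Fin j → I) → F × ℝ := fun p =>
    (P (p.1, fun i => p.2 i) + w + (p.1 : ℝ) • w' - (H p).1, 0)
  have hDc : Continuous D := by
    refine Continuous.prodMk ?_ continuous_const
    exact ((hPc.add continuous_const).add (by fun_prop)).sub hH.fst
  have hDn : ∀ p, ‖D p‖ < η := by
    rintro ⟨t, y⟩
    have e : ‖(t : ℝ) • w'‖ < η / 3 := by
      rw [norm_smul, Real.norm_of_nonneg t.2.1]
      nlinarith [t.2.2, t.2.1, norm_nonneg w']
    have : P (t, fun i => y i) + w + (t : ℝ) • w' - (H (t, y)).1 =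
      (P (t, fun i => y i) - (H (t, y)).1) + w + (t : ℝ) • w' := by abel
    simp only [D, Prod.norm_mk, norm_zero, this]
    refine max_lt ?_ hη
    linarith [norm_add₃_le (a := P (t, fun i => y i) - (H (t, y)).1) (b := w)
      (c := (t : ℝ) • w'), hPH t y]
  let ζ : I × (Fin j → I) → ℝ := fun p => min 1 (‖H p - b‖ / η)
  have hζc : Continuous ζ := by fun_prop
  have hζ0 : ∀ p, 0 ≤ ζ p := fun p => by positivity
  have hζ1 : ∀ p, ζ p ≤ 1 := fun p => min_le_left _ _
  have hpn : ∀ p, ∀ r : ℝ, 0 ≤ r → r ≤ 1 → ‖(H p + (r * ζ p) • D p) - H p‖ < η := by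
    intro p r h0 h1
    rw [add_sub_cancel_left, norm_smul, Real.norm_of_nonneg (mul_nonneg h0 (hζ0 p))]
    calc _ ≤ 1 * ‖D p‖ := by
            gcongr
            exact mul_le_one₀ h1 (hζ0 p) (hζ1 p)
      _ < η := by rw [one_mul]; exact hDn p
  let Hp : I × (Fin j → I) → F × ℝ := fun p => H p + (1 * ζ p) • D p
  have hHpc : Continuous Hp := by fun_prop
  have hHpb : ∀ t y, (t = 0 ∨ t = 1) → Hp (t, y) = b := by
    rintro t y (rfl | rfl) <;> simp [Hp, ζ, hHb]
  have hHp0 : ∀ p, Hp p ≠ 0 := fun p =>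
    hm₃ p trivial _ ((hpn p 1 zero_le_one le_rfl).trans hη₃)
  have huniq : ∀ y s t, (Hp (s, y)).1 = 0 → (Hp (t, y)).1 = 0 → s = t := by
    have hgen' : ∀ t y, (Hp (t, y)).1 = 0 → P (t, fun i => y i) + w + (t : ℝ) • w' = 0 := by
      intro t y h
      by_cases hc : η ≤ ‖H (t, y) - b‖
      · have : ζ (t, y) = 1 := min_eq_left ((one_le_div hη).2 hc)
        simpa [Hp, this, D] using h
      · exfalso
        have h1 := norm_fst_le (Hp (t, y) - b)
        rw [Prod.fst_sub, h, zero_sub, norm_neg] at h1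
        have h2 := norm_sub_le_norm_sub_add_norm_sub (Hp (t, y)) (H (t, y)) b
        have h3 := hpn (t, y) 1 zero_le_one le_rfl
        push Not at hc
        simp only [Hp] at h1 h2
        linarith
    intro y s t hs ht
    rcases lt_trichotomy s t with h | h | h
    · exact absurd ⟨hgen' s y hs, hgen' t y ht⟩ (hgen _ _ _ h)
    · exact h
    · exact absurd ⟨hgen' t y ht, hgen' s y hs⟩ (hgen _ _ _ h)
  -- the bad set
  let bad : Set ((I × I) × (Fin j → I)) := {q |
    (q.1.2 ≤ mid ∧ H (q.1.2, q.2) + ((q.1.1 : ℝ) * ζ (q.1.2, q.2)) • D (q.1.2, q.2) ∈ (offUp F)ᶜ) ∨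
    (mid ≤ q.1.2 ∧ H (q.1.2, q.2) + ((q.1.1 : ℝ) * ζ (q.1.2, q.2)) • D (q.1.2, q.2) ∈ (offDown F)ᶜ)}
  have hbad : IsClosed bad := by
    have hc : Continuous fun q : (I × I) × (Fin j → I) =>
        H (q.1.2, q.2) + ((q.1.1 : ℝ) * ζ (q.1.2, q.2)) • D (q.1.2, q.2) := by fun_prop
    refine IsClosed.union (IsClosed.inter ?_ ?_) (IsClosed.inter ?_ ?_)
    · exact isClosed_le (by fun_prop) continuous_const
    · exact isOpen_offUp.isClosed_compl.preimage hc
    · exact isClosed_le continuous_const (by fun_prop)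
    · exact isOpen_offDown.isClosed_compl.preimage hc
  let C : Set (Fin j → I) := Prod.snd '' bad
  have hC : IsClosed C := isClosedMap_snd_of_compactSpace _ hbad
  have hCb : Disjoint (Cube.boundary (Fin j)) C := by
    rw [Set.disjoint_left]
    rintro y hy ⟨⟨⟨r, t⟩, y'⟩, hq, rfl⟩
    rcases hq with ⟨ht, hq⟩ | ⟨ht, hq⟩
    · exact hq (hm₁ (t, y') ⟨ht, hy⟩ _ ((hpn _ r r.2.1 r.2.2).trans hη₁))
    · exact hq (hm₂ (t, y') ⟨ht, hy⟩ _ ((hpn _ r r.2.1 r.2.2).trans hη₂))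
  have hgood : ∀ y, y ∉ C → ∀ r : I, ∀ t,
      (t ≤ mid → H (t, y) + ((r : ℝ) * ζ (t, y)) • D (t, y) ∈ offUp F) ∧
      (mid ≤ t → H (t, y) + ((r : ℝ) * ζ (t, y)) • D (t, y) ∈ offDown F) := by
    intro y hy r t
    constructor
    · intro ht
      by_contra h
      exact hy ⟨((r, t), y), Or.inl ⟨ht, h⟩, rfl⟩
    · intro ht
      by_contra h
      exact hy ⟨((r, t), y), Or.inr ⟨ht, h⟩, rfl⟩
  obtain ⟨θ, hθ0, hθ1, hθ⟩ := exists_continuous_zero_one_of_isClosed (isClosed_boundary j) hC hCb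
  let A : Set (Fin j → I) := Prod.snd '' (Hp ⁻¹' (offUp F)ᶜ)
  let B : Set (Fin j → I) := Prod.snd '' (Hp ⁻¹' (offDown F)ᶜ)
  have hA : IsClosed A :=
    isClosedMap_snd_of_compactSpace _ (isOpen_offUp.isClosed_compl.preimage hHpc)
  have hB : IsClosed B :=
    isClosedMap_snd_of_compactSpace _ (isOpen_offDown.isClosed_compl.preimage hHpc)
  have hAB' : ∀ y s t, Hp (s, y) ∉ offUp F → Hp (t, y) ∉ offDown F → False := by
    intro y s t hs ht
    simp only [offUp, offDown, mem_ofPred_eq, not_not] at hs ht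
    have := huniq y s t hs.1 ht.1
    subst this
    exact hHp0 (s, y) (Prod.ext hs.1 (le_antisymm ht.2 hs.2))
  have hAB : Disjoint A B := by
    rw [Set.disjoint_left]
    rintro y ⟨⟨s, y'⟩, hs, rfl⟩ ⟨⟨t, y''⟩, ht, h⟩
    simp only at h
    subst h
    exact hAB' _ s t hs ht
  obtain ⟨κ, hκA, hκB, hκ⟩ := exists_continuous_zero_one_of_isClosed hA hB hAB
  let θ₂ : (Fin j → I) → ℝ := fun y => max 0 (2 * θ y - 1)
  have hθ₂0 : ∀ y, 0 ≤ θ₂ y := fun y => le_max_left _ _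
  have hθ₂1 : ∀ y, θ₂ y ≤ 1 := fun y => max_le zero_le_one (by linarith [(hθ y).2])
  let h : (Fin j → I) → I := fun y => ⟨(1 - θ₂ y) / 2 + θ₂ y * κ y, by
    have h1 := hθ₂0 y; have h2 := hθ₂1 y; have h3 := (hκ y).1
    have := mul_nonneg h1 h3
    linarith, by
    have h1 := hθ₂0 y; have h2 := hθ₂1 y; have h3 := (hκ y).2
    have := mul_le_of_le_one_right h1 h3
    linarith⟩
  let r : (Fin j → I) → I := fun y => ⟨min 1 (2 * θ y), le_min zero_le_one
    (by linarith [(hθ y).1]), min_le_left _ _⟩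
  have hrc : Continuous r := Continuous.subtype_mk (by fun_prop) _
  have hhc : Continuous h := Continuous.subtype_mk (by fun_prop) _
  let H' : I × (Fin j → I) → F × ℝ := fun p => H p + ((r p.2 : ℝ) * ζ p) • D p
  have hH'c : Continuous H' := by fun_prop
  have hsmall : ∀ y, θ y < 1 / 2 → y ∉ C ∧ h y = mid := by
    intro y hy
    refine ⟨fun hyC => ?_, ?_⟩
    · have := hθ1 hyC
      simp only [Pi.one_apply] at this
      linarith
    · have : θ₂ y = 0 := max_eq_left (by linarith)
      apply Subtype.ext
      simp [h, this, mid]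
  have hlarge : ∀ y, 1 / 2 ≤ θ y → ∀ t, H' (t, y) = Hp (t, y) := by
    intro y hy t
    have : (r y : ℝ) = 1 := min_eq_left (by linarith)
    simp only [H', Hp, this]
  have hhC : ∀ y ∈ C, h y = κ y := by
    intro y hy
    have h1 : θ y = 1 := hθ1 hy
    have : θ₂ y = 1 := by simp only [θ₂, h1]; norm_num
    simp [h, this]
  have hhA : ∀ y ∈ A, h y ≤ mid := by
    intro y hy
    have h1 : κ y = 0 := hκA hy
    change (1 - θ₂ y) / 2 + θ₂ y * κ y ≤ 1 / 2
    rw [h1]; linarith [hθ₂0 y]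
  have hhB : ∀ y ∈ B, mid ≤ h y := by
    intro y hy
    have h1 : κ y = 1 := hκB hy
    change 1 / 2 ≤ (1 - θ₂ y) / 2 + θ₂ y * κ y
    rw [h1]; linarith [hθ₂0 y]
  have hbU : b ∈ offUp F := mem_offUp hb
  have hbD : b ∈ offDown F := mem_offDown hb
  refine ⟨H', h, hH'c, hhc, fun p => (hpn p _ (r p.2).2.1 (r p.2).2.2).trans hηε, ?_, ?_, ?_, ?_⟩
  · intro t y ht
    rcases lt_or_ge (θ y) (1 / 2) with hy | hy
    · obtain ⟨hyC, hyh⟩ := hsmall y hy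
      exact (hgood y hyC (r y) t).1 (hyh ▸ ht)
    · by_contra hn
      rw [hlarge y hy] at hn
      have hyA : y ∈ A := ⟨(t, y), hn, rfl⟩
      by_cases hyC : y ∈ C
      · have h1 : κ y = 0 := hκA hyA
        have h2 : h y = 0 := Subtype.ext ((hhC y hyC).trans h1)
        have h3 : t = 0 := le_antisymm (h2 ▸ ht) t.2.1
        rw [hHpb t y (Or.inl h3)] at hn
        exact hn hbU
      · refine hn ?_
        simpa [Hp] using (hgood y hyC 1 t).1 (ht.trans (hhA y hyA))
  · intro t y ht
    rcases lt_or_ge (θ y) (1 / 2) with hy | hy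
    · obtain ⟨hyC, hyh⟩ := hsmall y hy
      exact (hgood y hyC (r y) t).2 (hyh ▸ ht)
    · by_contra hn
      rw [hlarge y hy] at hn
      have hyB : y ∈ B := ⟨(t, y), hn, rfl⟩
      by_cases hyC : y ∈ C
      · have h1 : κ y = 1 := hκB hyB
        have h2 : h y = 1 := Subtype.ext ((hhC y hyC).trans h1)
        have h3 : t = 1 := le_antisymm t.2.2 (h2 ▸ ht)
        rw [hHpb t y (Or.inr h3)] at hn
        exact hn hbD
      · refine hn ?_
        simpa [Hp] using (hgood y hyC 1 t).2 ((hhB y hyB).trans ht)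
  · intro y hy
    have h1 : θ y = 0 := hθ0 hy
    refine ⟨(hsmall y (by rw [h1]; norm_num)).2, fun t => ?_⟩
    simp [H', r, h1]
  · intro y
    constructor <;> simp [H', ζ, hHb]

end Separation
end Pi3

namespace Pi3
open scoped unitInterval Topology.Homotopy
open Set

section Conversions

variable {E : Type*} [TopologicalSpace E] {N : Type*}

lemma HtpyIn.homotopic {S : Set E} {x : S} {f g : Ω^ N S x}
    (h : HtpyIn S (Cube.boundary N) (fun u => (f u : E)) (fun u => (g u : E))) :
    GenLoop.Homotopic f g := by
  obtain ⟨H, hc, h0, h1, hS, hA⟩ := h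
  refine homotopic_of _ _ (fun p => ⟨H p, hS p⟩) (Continuous.subtype_mk hc _)
    (fun u => Subtype.ext (h0 u)) (fun u => Subtype.ext (h1 u)) fun t u hu => Subtype.ext ?_
  simp only [hA t u hu, loop_bdry f hu]

lemma HtpyIn.comp {Y Y' : Type*} [TopologicalSpace Y] [TopologicalSpace Y'] {S : Set E} {A : Set Y}
    {A' : Set Y'} {f g : Y → E} (h : HtpyIn S A f g) (φ : Y' → Y) (hφ : Continuous φ)
    (hA : ∀ y ∈ A', φ y ∈ A) : HtpyIn S A' (fun y => f (φ y)) (fun y => g (φ y)) := by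
  obtain ⟨H, hc, h0, h1, hS, hA'⟩ := h
  exact ⟨fun p => H (p.1, φ p.2), hc.comp (by fun_prop), fun u => h0 _, fun u => h1 _,
    fun p => hS _, fun t u hu => hA' t _ (hA u hu)⟩

end Conversions

section Freudenthal

variable {F : Type*} [NormedAddCommGroup F] [NormedSpace ℝ F] {k : ℕ}

/-- The inclusion of the punctured equator. -/
def equator (x : ({0}ᶜ : Set F)) : ({0}ᶜ : Set (F × ℝ)) :=
  ⟨((x : F), 0), fun h => x.2 (congrArg Prod.fst (mem_singleton_iff.1 h))⟩

variable {b : ({0}ᶜ : Set F)}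

lemma equator_fst (x : ({0}ᶜ : Set F)) : (equator x : F × ℝ).1 ≠ 0 := x.2

lemma suspPath_ne {x : F × ℝ} (c : F × ℝ) (hx : x.1 ≠ 0) (t : I) :
    suspPath c x t ∈ ({0}ᶜ : Set (F × ℝ)) := by
  rcases le_total t mid with h | h
  · exact ne_zero_of_offUp (suspPath_low h)
  · exact ne_zero_of_offDown (suspPath_high hx h)

/-- The suspension of a loop. -/
def suspLoop (m : Ω^ (Fin k) ({0}ᶜ : Set F) b) :
    Ω^ (Fin (k + 1)) ({0}ᶜ : Set (F × ℝ)) (equator b) :=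
  mkLoop (fun u => ⟨suspPath (equator b) (equator (m (Fin.tail u))) (u 0),
      suspPath_ne _ (equator_fst _) _⟩)
    (Continuous.subtype_mk ((continuous_suspPath (Y := Fin k → I)
      (m := fun y => (equator (m y) : F × ℝ))
      (by unfold equator; have := loop_continuous m; fun_prop) (fun y => equator_fst _)).comp
      ((continuous_apply 0).prodMk continuous_tail)) _)
    (by
      intro u hu
      apply Subtype.ext
      dsimp only
      rcases mem_boundary_succ.1 hu with h | h | h
      · rw [h, suspPath_zero (equator_fst b)]
      · rw [h, suspPath_one (equator_fst b)]
      · rw [loop_bdry m h, suspPath_self (equator_fst b)])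

lemma suspLoop_apply (m : Ω^ (Fin k) ({0}ᶜ : Set F) b) (u) :
    (suspLoop m u : F × ℝ) = suspPath (equator b) (equator (m (Fin.tail u))) (u 0) := rfl

lemma continuous_equator_loop (m : Ω^ (Fin k) ({0}ᶜ : Set F) b) :
    Continuous fun y => (equator (m y) : F × ℝ) := by
  unfold equator; have := loop_continuous m; fun_prop

lemma continuous_susp (m : Ω^ (Fin k) ({0}ᶜ : Set F) b) :
    Continuous fun p : I × (Fin k → I) => suspPath (equator b : F × ℝ) (equator (m p.2) : F × ℝ) p.1 :=
  continuous_suspPath (m := fun y => (equator (m y) : F × ℝ)) (continuous_equator_loop m)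
      (fun y => equator_fst _)

lemma homotopic_suspLoop_of_middle (f : Ω^ (Fin (k + 1)) ({0}ᶜ : Set (F × ℝ)) (equator b))
    (m : Ω^ (Fin k) ({0}ᶜ : Set F) b) (f₀ : I × (Fin k → I) → F × ℝ) (h₀ : Continuous f₀)
    (hf : HtpyIn {0}ᶜ {p : I × (Fin k → I) | p.1 = 0 ∨ p.1 = 1 ∨ p.2 ∈ Cube.boundary (Fin k)}
      (fun p => (f (Fin.cons p.1 p.2) : F × ℝ)) f₀)
    (hl₀ : ∀ t y, t ≤ mid → f₀ (t, y) ∈ offUp F) (hu₀ : ∀ t y, mid ≤ t → f₀ (t, y) ∈ offDown F)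
    (hb₀ : ∀ y, f₀ (0, y) = equator b ∧ f₀ (1, y) = equator b)
    (hA₀ : ∀ t, ∀ y ∈ Cube.boundary (Fin k), f₀ (t, y) = equator b)
    {M : I × (Fin k → I) → F × ℝ} (hM : Continuous M)
    (hMn : ∀ p, (M p).1 ≠ 0) (hMA : ∀ s, ∀ y ∈ Cube.boundary (Fin k), M (s, y) = equator b)
    (hM₀ : ∀ y, M (0, y) = f₀ (mid, y)) (hM₁ : ∀ y, M (1, y) = equator (m y)) :
    GenLoop.Homotopic f (suspLoop m) := by
  have h1 := hf.trans (htpyIn_of_middle (A := Cube.boundary (Fin k)) h₀ (continuous_susp m) hM hl₀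
    hu₀ (fun t y ht => suspPath_low ht) (fun t y ht => suspPath_high (equator_fst _) ht) hb₀
    (fun y => ⟨suspPath_zero (equator_fst b), suspPath_one (equator_fst b)⟩) hA₀
    (fun t y hy => by dsimp only; rw [loop_bdry m hy, suspPath_self (equator_fst b)]) hMn hMA hM₀
    (fun y => by rw [hM₁]; simp only [suspPath_mid (equator_fst (m y))]))
  have h2 := h1.comp (Y' := Fin (k + 1) → I) (A' := Cube.boundary (Fin (k + 1)))
    (fun u => (u 0, Fin.tail u)) ((continuous_apply 0).prodMk continuous_tail)
    (fun u hu => mem_boundary_succ.1 hu)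
  simp only [cons_head_tail] at h2
  exact h2.homotopic

lemma suspLoop_homotopic {m m' : Ω^ (Fin k) ({0}ᶜ : Set F) b} (h : GenLoop.Homotopic m m') :
    GenLoop.Homotopic (suspLoop m) (suspLoop m') := by
  obtain ⟨H, hc, h0, h1, hA⟩ := exists_homotopy h
  refine homotopic_suspLoop_of_middle (suspLoop m) m' _ (continuous_susp m) ?_
    (fun t y ht => suspPath_low ht) (fun t y ht => suspPath_high (equator_fst _) ht)
    (fun y => ⟨suspPath_zero (equator_fst b), suspPath_one (equator_fst b)⟩)
    (fun t y hy => by dsimp only; rw [loop_bdry m hy, suspPath_self (equator_fst b)])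
    (M := fun p => equator (H p)) (by unfold equator; fun_prop) (fun p => equator_fst _) ?_ ?_ ?_
  · refine ⟨fun q => suspPath (equator b) (equator (m q.2.2)) q.2.1,
      (continuous_susp m).comp continuous_snd, fun p => ?_, fun p => rfl,
      fun p => suspPath_ne _ (equator_fst _) _, fun t p _ => ?_⟩ <;>
    simp [suspLoop_apply]
  · intro s y hy
    rw [hA s y hy]
  · intro y; simp only [h0, suspPath_mid (equator_fst (m y))]
  · intro y; rw [h1]

lemma suspLoop_transAt (i : Fin k) (m m' : Ω^ (Fin k) ({0}ᶜ : Set F) b) :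
    suspLoop (GenLoop.transAt i m m') = GenLoop.transAt i.succ (suspLoop m) (suspLoop m') := by
  apply GenLoop.ext
  intro u
  apply Subtype.ext
  rw [suspLoop_apply, transAt_apply, transAt_apply]
  have e : Fin.tail u i = u i.succ := rfl
  rw [e]
  split_ifs <;> rw [suspLoop_apply] <;>
    rw [Fin.tail_update_succ, Function.update_of_ne (Fin.succ_ne_zero i).symm]

lemma suspLoop_const :
    suspLoop (GenLoop.const : Ω^ (Fin k) ({0}ᶜ : Set F) b) = GenLoop.const := by
  apply GenLoop.ext
  intro u
  apply Subtype.ext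
  rw [suspLoop_apply]
  exact suspPath_self (equator_fst b) _

/-- The suspension homomorphism. -/
def suspHom : HomotopyGroup (Fin (k + 1)) ({0}ᶜ : Set F) b →*
    HomotopyGroup (Fin (k + 2)) ({0}ᶜ : Set (F × ℝ)) (equator b) where
  toFun := Quotient.map suspLoop fun _ _ => suspLoop_homotopic
  map_one' := by
    rw [← cls_const, ← cls_const]
    exact congrArg cls suspLoop_const
  map_mul' a c := by
    obtain ⟨f, rfl⟩ := exists_rep a
    obtain ⟨g, rfl⟩ := exists_rep c
    rw [mul_cls 0]
    change cls _ = cls _ * cls _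
    rw [mul_cls (Fin.succ 0), suspLoop_transAt]

variable [FiniteDimensional ℝ F]

lemma suspHom_surjective (hk : k + 1 + 3 ≤ 2 * Module.finrank ℝ F) :
    Function.Surjective (suspHom (k := k) (b := b)) := by
  intro a
  obtain ⟨f, rfl⟩ := exists_rep a
  have hfc := loop_continuous f
  let H : I × (Fin (k + 1) → I) → F × ℝ := fun p => f (Fin.cons p.1 p.2)
  have hH : Continuous H := continuous_subtype_val.comp (hfc.comp continuous_cons)
  have hHne : ∀ p, H p ≠ 0 := fun p => (f _).2
  have hHb : ∀ t y, (t = 0 ∨ t = 1 ∨ y ∈ Cube.boundary (Fin (k + 1))) →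
      H (t, y) = equator b := fun t y h => congrArg Subtype.val (loop_bdry f (cons_mem_boundary.2 h))
  obtain ⟨δ, hδ, hm⟩ := exists_pos_margin isCompact_univ hH
    (isOpen_compl_singleton (x := (0 : F × ℝ))) (fun p _ => hHne p)
  obtain ⟨H', h, hH', hh, hd, hlo, hhi, hbd, he⟩ := exists_separation hk H hH (equator_fst b) hHne
    (fun y => ⟨hHb 0 y (Or.inl rfl), hHb 1 y (Or.inr (Or.inl rfl))⟩)
    (fun y hy t _ => by rw [hHb t y (Or.inr (Or.inr hy))]; exact mem_offUp (equator_fst b))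
    (fun y hy t _ => by rw [hHb t y (Or.inr (Or.inr hy))]; exact mem_offDown (equator_fst b)) hδ
  have hmid : ∀ y, (H' (h y, y)).1 ≠ 0 := by
    intro y h0
    rcases le_total 0 (H' (h y, y)).2 with h1 | h1
    · exact hlo _ y le_rfl ⟨h0, h1⟩
    · exact hhi _ y le_rfl ⟨h0, h1⟩
  have hbd' : ∀ t, ∀ y ∈ Cube.boundary (Fin (k + 1)), H' (t, y) = equator b := fun t y hy => by
    rw [(hbd y hy).2, hHb t y (Or.inr (Or.inr hy))]
  let m : Ω^ (Fin (k + 1)) ({0}ᶜ : Set F) b := mkLoop (fun y => ⟨(H' (h y, y)).1, hmid y⟩)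
    (Continuous.subtype_mk (by fun_prop) _) fun y hy => Subtype.ext (by
      dsimp only; rw [hbd' _ y hy]; rfl)
  refine ⟨cls m, ?_⟩
  change cls _ = cls _
  rw [cls_eq_cls]
  refine GenLoop.Homotopic.symm ?_
  -- the reparametrization
  have hρmem : ∀ p : I × (Fin (k + 1) → I),
      min (2 * (p.1 : ℝ)) 1 * h p.2 + max (2 * (p.1 : ℝ) - 1) 0 * (1 - h p.2) ∈ Icc (0 : ℝ) 1 := by
    intro p
    have h1 := (h p.2).2.1
    have h2 := (h p.2).2.2
    have h3 := p.1.2.1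
    have h4 := p.1.2.2
    rcases le_total (2 * (p.1 : ℝ)) 1 with hc | hc
    · rw [min_eq_left hc, max_eq_right (by linarith)]
      constructor
      · nlinarith
      · nlinarith
    · rw [min_eq_right hc, max_eq_left (by linarith)]
      constructor
      · nlinarith
      · nlinarith
  let ρ : I × (Fin (k + 1) → I) → I := fun p => ⟨_, hρmem p⟩
  have hρc : Continuous ρ := Continuous.subtype_mk (by fun_prop) _
  have hρ0 : ∀ y, ρ (0, y) = 0 := fun y => by apply Subtype.ext; simp [ρ]
  have hρ1 : ∀ y, ρ (1, y) = 1 := fun y => by apply Subtype.ext; norm_num [ρ]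
  have hρm : ∀ y, ρ (mid, y) = h y := fun y => by apply Subtype.ext; norm_num [ρ, mid]
  have hρl : ∀ t y, t ≤ mid → ρ (t, y) ≤ h y := by
    intro t y ht
    have ht' : (t : ℝ) ≤ 1 / 2 := ht
    change min (2 * (t : ℝ)) 1 * h y + max (2 * (t : ℝ) - 1) 0 * (1 - h y) ≤ h y
    rw [min_eq_left (by linarith), max_eq_right (by linarith)]
    nlinarith [(h y).2.1]
  have hρu : ∀ t y, mid ≤ t → h y ≤ ρ (t, y) := by
    intro t y ht
    have ht' : 1 / 2 ≤ (t : ℝ) := ht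
    change (h y : ℝ) ≤ min (2 * (t : ℝ)) 1 * h y + max (2 * (t : ℝ) - 1) 0 * (1 - h y)
    rw [min_eq_right (by linarith), max_eq_left (by linarith)]
    nlinarith [(h y).2.2]
  refine homotopic_suspLoop_of_middle f m (fun p => H' (ρ p, p.2)) (by fun_prop) ?_
    (fun t y ht => hlo _ _ (hρl t y ht)) (fun t y ht => hhi _ _ (hρu t y ht))
    (fun y => by simp only [hρ0, hρ1]; exact he y) (fun t y hy => hbd' _ y hy)
    (M := fun p => ((H' (h p.2, p.2)).1, (1 - (p.1 : ℝ)) * (H' (h p.2, p.2)).2))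
    (by fun_prop) (fun p => hmid _) ?_ ?_ ?_
  · refine HtpyIn.trans (g := H') (HtpyIn.line hH hH' ?_ ?_) ?_
    · intro p t
      refine hm p trivial _ ?_
      rw [add_sub_cancel_left, norm_smul, Real.norm_of_nonneg t.2.1]
      have h1 := hd p
      nlinarith [norm_nonneg (H' p - H p), t.2.2, t.2.1]
    · rintro ⟨t, y⟩ (rfl | rfl | hy)
      · exact (hHb 0 y (Or.inl rfl)).trans (he y).1.symm
      · exact (hHb 1 y (Or.inr (Or.inl rfl))).trans (he y).2.symm
      · exact ((hbd y hy).2 t).symm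
    · let τ : I × (I × (Fin (k + 1) → I)) → I := fun q =>
        ⟨(1 - (q.1 : ℝ)) * q.2.1 + (q.1 : ℝ) * ρ q.2,
          convex_Icc (0 : ℝ) 1 q.2.1.2 (ρ q.2).2 (by linarith [q.1.2.2]) q.1.2.1 (by ring)⟩
      have hτ : Continuous τ := Continuous.subtype_mk (by fun_prop) _
      refine ⟨fun q => H' (τ q, q.2.2), by fun_prop, fun p => ?_, fun p => ?_, fun q => ?_, ?_⟩
      · have : τ (0, p) = p.1 := Subtype.ext (by simp [τ])
        simp only [this]
      · have : τ (1, p) = ρ p := Subtype.ext (by simp [τ])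
        simp only [this]
      · rcases le_total (τ q) (h q.2.2) with h1 | h1
        · exact ne_zero_of_offUp (hlo _ _ h1)
        · exact ne_zero_of_offDown (hhi _ _ h1)
      · rintro s ⟨t, y⟩ (rfl | rfl | hy)
        · dsimp only
          congr 2; apply Subtype.ext; simp [τ, hρ0]
        · dsimp only
          congr 2; apply Subtype.ext; simp [τ, hρ1]
        · dsimp only
          rw [hbd' _ y hy, hbd' _ y hy]
  · intro s y hy
    simp only [hbd' _ y hy]
    ext <;> simp [equator]
  · intro y
    simp [hρm]
  · intro y
    ext <;> simp [equator, m]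

lemma suspHom_injective (hk : k + 1 + 1 + 3 ≤ 2 * Module.finrank ℝ F) :
    Function.Injective (suspHom (k := k) (b := b)) := by
  rw [injective_iff_map_eq_one]
  intro a ha
  obtain ⟨m, rfl⟩ := exists_rep a
  change cls _ = 1 at ha
  rw [cls_eq_one] at ha ⊢
  obtain ⟨K, hK, hK0, hK1, hKA⟩ := exists_homotopy ha
  let H : I × (Fin (k + 2) → I) → F × ℝ := fun p =>
    K (p.2 0, (Fin.cons p.1 (Fin.tail p.2 : Fin (k + 1) → I) : Fin (k + 2) → I))
  have hH : Continuous H := by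
    have h1 : Continuous fun p : I × (Fin (k + 2) → I) =>
        (p.1, (Fin.tail p.2 : Fin (k + 1) → I)) :=
      continuous_fst.prodMk ((continuous_tail (k := k + 1)).comp continuous_snd)
    have h2 := (continuous_cons (k := k + 1)).comp h1
    exact continuous_subtype_val.comp
      (hK.comp (((continuous_apply 0).comp continuous_snd).prodMk h2))
  have hHne : ∀ p, H p ≠ 0 := fun p => (K _).2
  have hHA : ∀ (t : I) (y : Fin (k + 2) → I),
      (t = 0 ∨ t = 1 ∨ (Fin.tail y : Fin (k + 1) → I) ∈ Cube.boundary (Fin (k + 1))) →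
      H (t, y) = equator b := fun t y h =>
    congrArg Subtype.val (hKA (y 0) _ (cons_mem_boundary.2 h))
  have hH0 : ∀ (t : I) (y : Fin (k + 2) → I), y 0 = 0 → H (t, y) = suspPath (equator b) (equator (m (Fin.tail y))) t := by
    intro t y h
    simp only [H, h, hK0, suspLoop_apply, Fin.tail_cons, Fin.cons_zero]
  have hH1 : ∀ (t : I) (y : Fin (k + 2) → I), y 0 = 1 → H (t, y) = equator b := by
    intro t y h
    simp only [H, h, hK1]
    rfl
  have hbU : (equator b : F × ℝ) ∈ offUp F := mem_offUp (equator_fst b)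
  have hbD : (equator b : F × ℝ) ∈ offDown F := mem_offDown (equator_fst b)
  obtain ⟨H', h, hH', hh, hd, hlo, hhi, hbd, he⟩ := exists_separation hk H hH (equator_fst b) hHne
    (fun y => ⟨hHA 0 y (Or.inl rfl), hHA 1 y (Or.inr (Or.inl rfl))⟩)
    (fun y hy t ht => by
      rcases mem_boundary_succ.1 hy with h | h | h
      · rw [hH0 t y h]; exact suspPath_low ht
      · rw [hH1 t y h]; exact hbU
      · rw [hHA t y (Or.inr (Or.inr h))]; exact hbU)
    (fun y hy t ht => by
      rcases mem_boundary_succ.1 hy with h | h | h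
      · rw [hH0 t y h]; exact suspPath_high (equator_fst _) ht
      · rw [hH1 t y h]; exact hbD
      · rw [hHA t y (Or.inr (Or.inr h))]; exact hbD) one_pos
  have hmid : ∀ y, (H' (h y, y)).1 ≠ 0 := by
    intro y h0
    rcases le_total 0 (H' (h y, y)).2 with h1 | h1
    · exact hlo _ y le_rfl ⟨h0, h1⟩
    · exact hhi _ y le_rfl ⟨h0, h1⟩
  have hbd' : ∀ y ∈ Cube.boundary (Fin (k + 2)), H' (h y, y) = H (mid, y) := fun y hy => by
    rw [(hbd y hy).2, (hbd y hy).1]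
  refine homotopic_of _ _ (fun p => ⟨(H' (h (Fin.cons p.1 p.2), Fin.cons p.1 p.2)).1, hmid _⟩)
    (Continuous.subtype_mk ?_ _) ?_ ?_ ?_
  · have := continuous_cons (k := k + 1)
    exact (hH'.comp ((hh.comp this).prodMk this)).fst
  · intro u
    apply Subtype.ext
    dsimp only
    rw [hbd' _ (cons_mem_boundary.2 (Or.inl rfl)), hH0 _ _ rfl, suspPath_mid (equator_fst _)]
    simp [equator]
  · intro u
    apply Subtype.ext
    dsimp only
    rw [hbd' _ (cons_mem_boundary.2 (Or.inr (Or.inl rfl))), hH1 _ _ rfl]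
    rfl
  · intro t u hu
    apply Subtype.ext
    dsimp only
    rw [hbd' _ (cons_mem_boundary.2 (Or.inr (Or.inr hu))),
      hHA _ _ (Or.inr (Or.inr (by rwa [Fin.tail_cons])))]
    rfl

end Freudenthal
end Pi3

namespace Pi3
open scoped unitInterval Topology.Homotopy
open Set

lemma exists_mulEquiv_of_relation {A C : Type*} [Group A] [Group C] (R : A → C → Prop)
    (hmul : ∀ a c a' c', R a c → R a' c' → R (a * a') (c * c'))
    (hl : ∀ a, ∃ c, R a c) (hr : ∀ c, ∃ a, R a c) (h1 : ∀ c, R 1 c → c = 1)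
    (h2 : ∀ a, R a 1 → a = 1) : Nonempty (A ≃* C) := by
  have hu : ∀ a c c', R a c → R a c' → c = c' := by
    intro a c c' h h'
    obtain ⟨d, hd⟩ := hl a⁻¹
    have e1 := h1 _ (by simpa using hmul _ _ _ _ h hd)
    have e2 := h1 _ (by simpa using hmul _ _ _ _ h' hd)
    exact mul_right_cancel (e1.trans e2.symm)
  choose φ hφ using hl
  have hm : ∀ a a', φ (a * a') = φ a * φ a' := fun a a' =>
    hu _ _ _ (hφ _) (hmul _ _ _ _ (hφ a) (hφ a'))
  refine ⟨MulEquiv.ofBijective (MonoidHom.mk' φ hm) ⟨?_, fun c => ?_⟩⟩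
  · rw [injective_iff_map_eq_one]
    intro a ha
    have := hφ a
    rw [show φ a = 1 from ha] at this
    exact h2 a this
  · obtain ⟨a, ha⟩ := hr c
    exact ⟨a, hu _ _ _ (hφ a) ha⟩

section Fibration

variable {G B : Type*} [TopologicalSpace G] [Group G] [IsTopologicalGroup G] [CompactSpace G]
  [TopologicalSpace B] [T2Space B] {act : G → B → B} {b₀ : B} {k : ℕ}

/-- The union of all faces of the cube except the last one in the first direction. -/
def openBox (k : ℕ) : Set (Fin (k + 1) → I) :=
  {u | u 0 = 0 ∨ (Fin.tail u : Fin k → I) ∈ Cube.boundary (Fin k)}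

lemma cons_mem_openBox {t : I} {y : Fin k → I} :
    (Fin.cons t y : Fin (k + 1) → I) ∈ openBox k ↔ t = 0 ∨ y ∈ Cube.boundary (Fin k) := Iff.rfl

lemma mem_boundary_iff_openBox {u : Fin (k + 1) → I} :
    u ∈ Cube.boundary (Fin (k + 1)) ↔ u 0 = 1 ∨ u ∈ openBox k := by
  rw [mem_boundary_succ, openBox, mem_ofPred_eq]; tauto

lemma HasLocalSection.lift_loop (h : HasLocalSection act b₀) (f : Ω^ (Fin (k + 1)) B b₀)
    (hfo : ∀ u, ∃ g, act g b₀ = f u) :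
    ∃ F : (Fin (k + 1) → I) → G, Continuous F ∧ (∀ u, act (F u) b₀ = f u) ∧
      ∀ u ∈ openBox k, F u = 1 := by
  obtain ⟨F, hF, h0, hact, hc⟩ := h.lift (Y := Fin k → I)
    (fun p => f (Fin.cons p.1 p.2)) ((loop_continuous f).comp continuous_cons) (fun p => hfo _)
    (fun _ => 1) continuous_const (fun y => by
      rw [h.one, loop_bdry f (cons_mem_boundary.2 (Or.inl rfl))])
  refine ⟨fun u => F (u 0, Fin.tail u),
    hF.comp ((continuous_apply 0).prodMk continuous_tail), fun u => ?_, ?_⟩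
  · rw [hact, cons_head_tail]
  · rintro u (hu | hu)
    · dsimp only
      rw [hu, h0]
    · refine hc _ (fun t => ?_) _
      rw [loop_bdry f (cons_mem_boundary.2 (Or.inr (Or.inr hu))),
        loop_bdry f (cons_mem_boundary.2 (Or.inr (Or.inr hu)))]

lemma HasLocalSection.lift_null (h : HasLocalSection act b₀) {F : (Fin k → I) → G}
    (hF : Continuous F) (hn : HtpyIn (range fun g => act g b₀) (Cube.boundary (Fin k))
      (fun u => act (F u) b₀) (fun _ => b₀)) :
    ∃ F' : (Fin k → I) → G, HtpyIn univ (Cube.boundary (Fin k)) F F' ∧ ∀ u, act (F' u) b₀ = b₀ := by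
  obtain ⟨H, hH, h0, h1, hS, hA⟩ := hn
  obtain ⟨K, hK, hK0, hact, hc⟩ := h.lift H hH hS F hF (fun y => (h0 y).symm)
  refine ⟨fun u => K (1, u), ⟨K, hK, hK0, fun _ => rfl, fun _ => trivial, fun t u hu => ?_⟩,
    fun u => ?_⟩
  · exact hc u (fun t => by rw [hA t u hu, h0]) t
  · rw [hact, h1]

/-- If a loop in the base is null-homotopic, so is the end face of any lift. -/
lemma HasLocalSection.end_null (h : HasLocalSection act b₀) {F : (Fin (k + 1) → I) → G}
    (hF : Continuous F) (hF1 : ∀ u ∈ openBox k, F u = 1)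
    (hn : HtpyIn (range fun g => act g b₀) (Cube.boundary (Fin (k + 1)))
      (fun u => act (F u) b₀) (fun _ => b₀)) :
    HtpyIn {g | act g b₀ = b₀} (Cube.boundary (Fin k)) (fun y => F (Fin.cons 1 y))
      (fun _ => 1) := by
  obtain ⟨F', ⟨K, hK, hK0, hK1, -, hA⟩, hact⟩ := h.lift_null hF hn
  have hb : ∀ u ∈ Cube.boundary (Fin (k + 1)), F' u = F u := fun u hu => by
    rw [← hK1, hA 1 u hu]
  have hF' : Continuous F' := by
    have : F' = fun u => K (1, u) := funext fun u => (hK1 u).symm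
    rw [this]; fun_prop
  refine HtpyIn.symm ⟨fun p => F' (Fin.cons p.1 p.2), hF'.comp continuous_cons, fun y => ?_,
    fun y => ?_, fun p => hact _, fun t y hy => ?_⟩
  · dsimp only
    rw [hb _ (cons_mem_boundary.2 (Or.inl rfl)), hF1 _ (cons_mem_openBox.2 (Or.inl rfl))]
  · exact hb _ (cons_mem_boundary.2 (Or.inr (Or.inl rfl)))
  · dsimp only
    rw [hb _ (cons_mem_boundary.2 (Or.inr (Or.inr hy))), hF1 _ (cons_mem_openBox.2 (Or.inr hy))]

/-- If the end face of a lift is null-homotopic in the stabilizer, the lift can be corrected to a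
loop. -/
lemma HasLocalSection.correct (h : HasLocalSection act b₀) {F : (Fin (k + 1) → I) → G}
    (hF : Continuous F) (hF1 : ∀ u ∈ openBox k, F u = 1)
    (hn : HtpyIn {g | act g b₀ = b₀} (Cube.boundary (Fin k)) (fun y => F (Fin.cons 1 y))
      (fun _ => 1)) :
    ∃ F' : Ω^ (Fin (k + 1)) G 1, ∀ u, act (F' u) b₀ = act (F u) b₀ := by
  obtain ⟨K, hK, hK0, hK1, hS, hA⟩ := hn.symm
  refine ⟨mkLoop (fun u => F u * (K (u 0, Fin.tail u))⁻¹) (hF.mul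
    (hK.comp ((continuous_apply 0).prodMk continuous_tail)).inv) fun u hu => ?_, fun u => ?_⟩
  · rcases mem_boundary_iff_openBox.1 hu with h0 | h0
    · rw [h0, hK1]
      dsimp only
      rw [← h0, cons_head_tail, mul_inv_cancel]
    · rw [hF1 u h0]
      rcases h0 with h0 | h0
      · rw [h0, hK0]; simp
      · rw [hA _ _ h0]; simp
  · rw [mkLoop_apply, h.mul]
    congr 1
    have h1 := h.inv_act (K (u 0, Fin.tail u)) b₀
    rwa [show act (K (u 0, Fin.tail u)) b₀ = b₀ from hS _] at h1

end Fibration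

section Connecting

variable {G B : Type*} [TopologicalSpace G] [Group G] [IsTopologicalGroup G] [CompactSpace G]
  [TopologicalSpace B] [T2Space B] {act : G → B → B} {b₀ : B} {k : ℕ}

lemma htpyIn_of_homotopic {N E : Type*} [TopologicalSpace E] {x : E} {f g : Ω^ N E x}
    (h : GenLoop.Homotopic f g) : HtpyIn univ (Cube.boundary N) f g := by
  obtain ⟨H, hc, h0, h1, hA⟩ := exists_homotopy h
  exact ⟨H, hc, h0, h1, fun _ => trivial, fun t u hu => by rw [hA t u hu, loop_bdry f hu]⟩

lemma htpyIn_of_homotopic_subtype {N E : Type*} [TopologicalSpace E] {S : Set E} {x : S}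
    {f g : Ω^ N S x} (h : GenLoop.Homotopic f g) :
    HtpyIn S (Cube.boundary N) (fun u => (f u : E)) (fun u => (g u : E)) :=
  (htpyIn_of_homotopic h).map Subtype.val continuous_subtype_val.continuousOn fun x _ => x.2

/-- Concatenation of maps on the cube in the direction `i.succ`. -/
lemma exists_trans (i : Fin k) {F F' : (Fin (k + 1) → I) → G} (hF : Continuous F)
    (hF' : Continuous F') (hF1 : ∀ u ∈ openBox k, F u = 1) (hF1' : ∀ u ∈ openBox k, F' u = 1) :
    ∃ L : (Fin (k + 1) → I) → G, Continuous L ∧ (∀ u ∈ openBox k, L u = 1) ∧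
      ∀ u, L u = if (u i.succ : ℝ) ≤ 1 / 2
        then F (Function.update u i.succ <| Set.projIcc 0 1 zero_le_one (2 * u i.succ))
        else F' (Function.update u i.succ <| Set.projIcc 0 1 zero_le_one (2 * u i.succ - 1)) := by
  have hb : ∀ (u : Fin (k + 1) → I) (s : I), (s = 0 ∨ s = 1) →
      Function.update u i.succ s ∈ openBox k := by
    intro u s hs
    refine Or.inr ⟨i, ?_⟩
    rw [show (Fin.tail (Function.update u i.succ s) : Fin k → I) i = s from
      Function.update_self ..]
    exact hs
  refine ⟨_, ?_, ?_, fun u => rfl⟩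
  · refine Continuous.if_le (hF.comp ?_) (hF'.comp ?_) (by fun_prop) continuous_const ?_
    · exact continuous_id.update _ (continuous_projIcc.comp (by fun_prop))
    · exact continuous_id.update _ (continuous_projIcc.comp (by fun_prop))
    · intro u hu
      rw [hF1 _ (hb _ _ (Or.inr ?_)), hF1' _ (hb _ _ (Or.inl ?_))]
      · rw [hu]; norm_num
      · rw [hu]; norm_num
  · intro u hu
    have hm : ∀ s, (u i.succ = 0 → s = 0) → (u i.succ = 1 → s = 1) →
        Function.update u i.succ s ∈ openBox k := by
      intro s h0 h1
      rcases hu with hu | ⟨j, hj⟩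
      · left; rw [Function.update_of_ne (Fin.succ_ne_zero i).symm, hu]
      · right
        refine ⟨j, ?_⟩
        rw [Fin.tail_update_succ]
        rcases eq_or_ne j i with rfl | hji
        · rw [Function.update_self]
          exact hj.imp h0 h1
        · rwa [Function.update_of_ne hji]
    split_ifs with hc
    · refine hF1 _ (hm _ (fun h => ?_) fun h => ?_)
      · rw [h]; norm_num
      · rw [h] at hc; norm_num at hc
    · refine hF1' _ (hm _ (fun h => ?_) fun h => ?_)
      · rw [h] at hc; norm_num at hc
      · rw [h]; norm_num

/-- The connecting isomorphism of a homogeneous space, when the relevant homotopy groups of the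
group vanish. -/
theorem HasLocalSection.connecting (h : HasLocalSection act b₀) (ht : ∀ b, ∃ g, act g b₀ = b)
    (h1 : ∀ a : HomotopyGroup (Fin (k + 1)) G 1, a = 1)
    (h2 : ∀ a : HomotopyGroup (Fin (k + 2)) G 1, a = 1) (K : Set G)
    (hK : K = {g | act g b₀ = b₀}) (e : K) (he : (e : G) = 1) :
    Nonempty (HomotopyGroup (Fin (k + 1)) K e ≃* HomotopyGroup (Fin (k + 2)) B b₀) := by
  have hrange : (range fun g => act g b₀) = univ := by
    ext b; simpa using ht b
  refine exists_mulEquiv_of_relation (fun a c => ∃ F : (Fin (k + 2) → I) → G, Continuous F ∧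
    (∀ u ∈ openBox (k + 1), F u = 1) ∧ ∃ l m, a = cls l ∧ c = cls m ∧
      (∀ y, (l y : G) = F (Fin.cons 1 y)) ∧ ∀ u, m u = act (F u) b₀) ?_ ?_ ?_ ?_ ?_
  · rintro _ _ _ _ ⟨F, hF, hF1, l, m, rfl, rfl, hl, hm⟩ ⟨F', hF', hF1', l', m', rfl, rfl, hl', hm'⟩
    obtain ⟨L, hL, hL1, hLe⟩ := exists_trans 0 hF' hF hF1' hF1
    refine ⟨L, hL, hL1, _, _, mul_cls 0 _ _, mul_cls (Fin.succ 0) _ _, fun y => ?_, fun u => ?_⟩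
    · rw [transAt_apply, hLe, Fin.cons_succ]
      split_ifs
      · rw [hl', Fin.cons_update]
      · rw [hl, Fin.cons_update]
    · rw [transAt_apply, hLe]
      split_ifs
      · rw [hm']
      · rw [hm]
  · intro a
    obtain ⟨l, rfl⟩ := exists_rep a
    let l' : Ω^ (Fin (k + 1)) G 1 := mapLoop Subtype.val continuous_subtype_val he l
    obtain ⟨H, hH, H0, H1, hA⟩ := exists_homotopy (cls_eq_one.1 (h1 (cls l'))).symm
    refine ⟨_, fun u => H (u 0, Fin.tail u),
      hH.comp ((continuous_apply 0).prodMk continuous_tail), ?_, l,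
      mkLoop (fun u => act (H (u 0, Fin.tail u)) b₀) ?_ ?_, rfl, rfl, ?_, fun u => rfl⟩
    · rintro u (hu | hu)
      · dsimp only; rw [hu, H0]; rfl
      · exact hA _ _ hu
    · exact h.cont.comp ((hH.comp ((continuous_apply 0).prodMk continuous_tail)).prodMk
        continuous_const)
    · intro u hu
      rcases mem_boundary_succ.1 hu with hu | hu | hu
      · rw [hu, H0]; exact h.one _
      · rw [hu, H1]
        have := (l (Fin.tail u)).2
        have h3 := hK.subset this
        exact h3
      · rw [hA _ _ hu]; exact h.one _
    · intro y
      dsimp only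
      rw [Fin.cons_zero, Fin.tail_cons, H1]; rfl
  · intro c
    obtain ⟨m, rfl⟩ := exists_rep c
    obtain ⟨F, hF, hact, hF1⟩ := h.lift_loop m fun u => ht _
    have hmem : ∀ y : Fin (k + 1) → I, F (Fin.cons 1 y) ∈ K := fun y => by
      rw [hK, mem_ofPred_eq, hact, loop_bdry m (cons_mem_boundary.2 (Or.inr (Or.inl rfl)))]
    refine ⟨_, F, hF, hF1, mkLoop (fun y => ⟨F (Fin.cons 1 y), hmem y⟩) (Continuous.subtype_mk
      (hF.comp (continuous_cons.comp (continuous_const.prodMk continuous_id))) hmem) fun y hy => ?_,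
      m, rfl, rfl, fun y => rfl, fun u => (hact u).symm⟩
    apply Subtype.ext
    dsimp only
    rw [he, hF1 _ (cons_mem_openBox.2 (Or.inr hy))]
  · rintro c ⟨F, hF, hF1, l, m, hl, rfl, hle, hm⟩
    have hn := htpyIn_of_homotopic_subtype (cls_eq_one.1 hl.symm)
    obtain ⟨F', hF'⟩ := h.correct hF hF1 (by
      rw [← hK]
      simp only [hle] at hn
      have e1 : (fun y => ((GenLoop.const : Ω^ (Fin (k + 1)) K e) y : G)) = fun _ => 1 :=
        funext fun _ => he
      rwa [e1] at hn)
    have hc : Continuous fun g => act g b₀ := h.cont.comp (continuous_id.prodMk continuous_const)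
    have : m = mapLoop (fun g => act g b₀) hc (h.one b₀) F' := by
      apply GenLoop.ext
      intro u
      rw [hm, mapLoop_apply, hF']
    rw [this, ← piHom_cls, h2 (cls F'), map_one]
  · rintro a ⟨F, hF, hF1, l, m, rfl, hl, hle, hm⟩
    have hn := htpyIn_of_homotopic (cls_eq_one.1 hl.symm)
    have e1 : (m : (Fin (k + 2) → I) → B) = fun u => act (F u) b₀ := funext hm
    rw [e1, ← hrange] at hn
    have h3 := h.end_null hF hF1 hn
    rw [← hK] at h3
    rw [cls_eq_one]
    refine HtpyIn.homotopic ?_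
    simp only [hle]
    have e2 : (fun y => ((GenLoop.const : Ω^ (Fin (k + 1)) K e) y : G)) = fun _ => 1 :=
      funext fun _ => he
    rwa [e2]

end Connecting
end Pi3

namespace Pi3
open scoped unitInterval Topology.Homotopy
open Set

section Normalize

lemma piHom_bijective_of_retract {N X Y : Type*} [Nonempty N] [DecidableEq N]
    [TopologicalSpace X] [TopologicalSpace Y] {x : X}
    {y : Y} (φ : X → Y) (hφ : Continuous φ) (h : φ x = y) (ψ : Y → X) (hψ : Continuous ψ)
    (h' : ψ y = x) (hφψ : ∀ z, φ (ψ z) = z) (H : I × X → X) (hH : Continuous H)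
    (h0 : ∀ u, H (0, u) = ψ (φ u)) (h1 : ∀ u, H (1, u) = u) (hb : ∀ t, H (t, x) = x) :
    Function.Bijective (piHom φ hφ h : HomotopyGroup N X x →* HomotopyGroup N Y y) := by
  refine Function.bijective_iff_has_inverse.2 ⟨piHom ψ hψ h', fun a => ?_, fun a => ?_⟩
  · rw [piHom_comp, piHom_congr_homotopy (fun t => ψ (φ t)) id _ _ continuous_id rfl H hH h0 h1 hb]
    exact piHom_id _ _ _ (fun _ => rfl) _
  · rw [piHom_comp]
    exact piHom_id _ _ _ hφψ _

variable {E F : Type*} [NormedAddCommGroup E] [NormedSpace ℝ E] [NormedAddCommGroup F]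
  [NormedSpace ℝ F]

/-- A punctured vector space has the homotopy groups of its unit sphere. -/
lemma nonempty_mulEquiv_sphere {N : Type*} [Nonempty N] [DecidableEq N]
    (L : F →L[ℝ] E) (M : E →L[ℝ] F) (hML : ∀ x, M (L x) = x)
    (S : Set E) (hS : ∀ y, y ∈ S ↔ ‖y‖ = 1 ∧ L (M y) = y) (b : ({0}ᶜ : Set F)) (e : S)
    (he : (e : E) = L b) :
    Nonempty (HomotopyGroup N ({0}ᶜ : Set F) b ≃* HomotopyGroup N S e) := by
  have hL : ∀ x : ({0}ᶜ : Set F), L x ≠ 0 := fun x h => x.2 (by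
    rw [mem_singleton_iff, ← hML x, h, map_zero])
  have hLp : ∀ x : ({0}ᶜ : Set F), 0 < ‖L x‖ := fun x => norm_pos_iff.2 (hL x)
  have hM : ∀ y : S, M y ≠ 0 := fun y h => by
    have h1 := (hS y).1 y.2
    rw [h, map_zero] at h1
    rw [← h1.2, norm_zero] at h1
    exact zero_ne_one h1.1
  have hb : ‖L b‖ = 1 := by rw [← he]; exact ((hS e).1 e.2).1
  have hLc : Continuous fun x : ({0}ᶜ : Set F) => ‖L x‖⁻¹ :=
    Continuous.inv₀ (by fun_prop) fun x => (hLp x).ne'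
  have hpos : ∀ p : I × ({0}ᶜ : Set F),
      ((1 - (p.1 : ℝ)) * ‖L p.2‖⁻¹ + p.1) • (p.2 : F) ∈ ({0}ᶜ : Set F) := by
    intro p
    rw [mem_compl_iff, mem_singleton_iff, smul_eq_zero, not_or]
    refine ⟨ne_of_gt ?_, p.2.2⟩
    have h1 := inv_pos.2 (hLp p.2)
    rcases eq_or_lt_of_le p.1.2.1 with h | h
    · rw [← h]; simpa using hL p.2
    · have := p.1.2.2
      nlinarith [mul_nonneg (sub_nonneg.2 this) h1.le]
  refine ⟨MulEquiv.ofBijective _ (piHom_bijective_of_retract (N := N) (x := b) (y := e)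
    (fun x => ⟨‖L x‖⁻¹ • L x, (hS _).2 ⟨?_, ?_⟩⟩)
    (Continuous.subtype_mk (hLc.smul (by fun_prop)) _) ?_
    (fun y => ⟨M y, hM y⟩) (Continuous.subtype_mk (by fun_prop) _) ?_ ?_
    (fun p => ⟨((1 - (p.1 : ℝ)) * ‖L p.2‖⁻¹ + p.1) • (p.2 : F), hpos p⟩)
    (Continuous.subtype_mk (Continuous.smul ?_ (by fun_prop)) hpos) ?_ ?_ ?_)⟩
  · rw [norm_smul, norm_inv, norm_norm, inv_mul_cancel₀ (hLp x).ne']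
  · rw [map_smul, map_smul, hML]
  · apply Subtype.ext
    simp [hb, he]
  · apply Subtype.ext
    simp only [he, hML]
  · intro z
    apply Subtype.ext
    have := (hS z).1 z.2
    simp [this.2, this.1]
  · have := hLc.comp (continuous_snd (X := I))
    exact ((continuous_const.sub (by fun_prop)).mul this).add (by fun_prop)
  · intro u
    apply Subtype.ext
    simp [hML]
  · intro u
    apply Subtype.ext
    simp
  · intro t
    apply Subtype.ext
    simp [hb]

lemma htpyIn_sphere [FiniteDimensional ℝ E] {k : ℕ} (hk : k + 2 ≤ Module.finrank ℝ E) {e : E}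
    (he : ‖e‖ = 1) (f : (Fin k → I) → E) (hf : Continuous f) (hne : ∀ u, ‖f u‖ = 1)
    (hb : ∀ u ∈ Cube.boundary (Fin k), f u = e) :
    HtpyIn (Metric.sphere 0 1) (Cube.boundary (Fin k)) f (fun _ => e) := by
  have h1 := htpyIn_const_of_lt hk (norm_pos_iff.1 (he ▸ one_pos)) f hf
    (fun u => norm_pos_iff.1 (hne u ▸ one_pos)) hb
  have h2 := h1.map (S' := Metric.sphere 0 1) (fun x => ‖x‖⁻¹ • x)
    (ContinuousOn.smul (ContinuousOn.inv₀ (by fun_prop) fun x hx => norm_ne_zero_iff.2 hx)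
      continuousOn_id) (fun x hx => by
      rw [mem_sphere_zero_iff_norm, norm_smul, norm_inv, norm_norm,
        inv_mul_cancel₀ (norm_ne_zero_iff.2 hx)])
  simpa [hne, he] using h2

lemma pi_sphere_eq_one [FiniteDimensional ℝ E] {k : ℕ} (hk : k + 1 + 2 ≤ Module.finrank ℝ E)
    (e : Metric.sphere (0 : E) 1)
    (a : HomotopyGroup (Fin (k + 1)) (Metric.sphere (0 : E) 1) e) : a = 1 := by
  obtain ⟨f, rfl⟩ := exists_rep a
  rw [cls_eq_one]
  exact HtpyIn.homotopic (htpyIn_sphere hk (norm_eq_of_mem_sphere e) (fun u => (f u : E))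
    (continuous_subtype_val.comp (loop_continuous f)) (fun u => norm_eq_of_mem_sphere _)
    (fun u hu => by rw [loop_bdry f hu]))

end Normalize

section CircleGroup

lemma pi1_circle : Nonempty (HomotopyGroup (Fin 1) Circle 1 ≃* Multiplicative ℤ) := by
  have h2 : (2 * Real.pi) ≠ 0 := by positivity
  have e2 := (Circle.isAddQuotientCoveringMap_exp.fundamentalGroupEquiv
    (x := (1 : Circle)) ⟨0, by simp⟩)
  have : Infinite (AddSubgroup.zmultiples (2 * Real.pi)) := by
    refine Infinite.of_injective (fun n : ℤ => ⟨n • (2 * Real.pi), n, rfl⟩) fun n m h => ?_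
    have := congrArg Subtype.val h
    simpa [h2] using this
  have e3 : ℤ ≃+ AddSubgroup.zmultiples (2 * Real.pi) := intCyclicAddEquiv
  exact ⟨HomotopyGroup.pi1MulEquivFundamentalGroup.trans
    (e2.trans ((MulEquiv.op.1 (AddEquiv.toMultiplicative e3.symm)).trans
      (MulOpposite.opMulEquiv (M := Multiplicative ℤ)).symm))⟩

end CircleGroup
end Pi3

namespace Pi3
open scoped unitInterval Topology.Homotopy Quaternion
open Set

/-- To give a local section it suffices to describe it in an ambient space of the group. -/
lemma exists_section_of_isEmbedding {G B E : Type*} [TopologicalSpace G] [One G]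
    [TopologicalSpace B] [TopologicalSpace E] {act : G → B → B} {b₀ : B} {c : G → E}
    (hc : Topology.IsEmbedding c) (s : B → E) {U : Set B} (hU : U ∈ 𝓝 b₀)
    (hs : ContinuousOn s (U ∩ range fun g => act g b₀)) (h1 : s b₀ = c 1)
    (hg : ∀ b ∈ U, b ∈ (range fun g => act g b₀) → ∃ g, c g = s b ∧ act g b₀ = b) :
    ∃ U ∈ 𝓝 b₀, ∃ s : B → G, ContinuousOn s (U ∩ range fun g => act g b₀) ∧ s b₀ = 1 ∧
      ∀ b ∈ U, b ∈ (range fun g => act g b₀) → act (s b) b₀ = b := by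
  classical
  let r : B → G := fun b => if h : ∃ g, c g = s b ∧ act g b₀ = b then h.choose else 1
  have hr : ∀ b ∈ U, b ∈ (range fun g => act g b₀) → c (r b) = s b ∧ act (r b) b₀ = b := by
    intro b hb hb'
    have h := hg b hb hb'
    simp only [r, dif_pos h]
    exact h.choose_spec
  refine ⟨U, hU, r, ?_, ?_, fun b hb hb' => (hr b hb hb').2⟩
  · rw [hc.isInducing.continuousOn_iff]
    exact hs.congr fun b hb => (hr b hb.1 hb.2).1
  · by_cases h : ∃ g, c g = s b₀ ∧ act g b₀ = b₀
    · apply hc.injective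
      simp only [r, dif_pos h]
      rw [h.choose_spec.1, h1]
    · simp only [r, dif_neg h]

section Quaternions

/-- The group of unit quaternions. -/
abbrev Sp1 : Type := Metric.sphere (0 : ℍ[ℝ]) 1

lemma sp1_normSq (g : Sp1) : Quaternion.normSq (g : ℍ[ℝ]) = 1 := by
  rw [Quaternion.normSq_eq_norm_mul_self, norm_eq_of_mem_sphere]; norm_num

lemma coe_inv_sp1 (g : Sp1) : ((g⁻¹ : Sp1) : ℍ[ℝ]) = star (g : ℍ[ℝ]) := by
  rw [Metric.unitSphere.coe_inv, Quaternion.inv_def, sp1_normSq]; simp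

lemma norm_eq_one_iff_quat (q : ℍ[ℝ]) :
    ‖q‖ = 1 ↔ q.re ^ 2 + q.imI ^ 2 + q.imJ ^ 2 + q.imK ^ 2 = 1 := by
  rw [← Quaternion.normSq_def', Quaternion.normSq_eq_norm_mul_self]
  constructor
  · intro h; rw [h]; norm_num
  · intro h; nlinarith [norm_nonneg q]

/-- The unit imaginary quaternions. -/
def imSphere : Set ℍ[ℝ] := {q | ‖q‖ = 1 ∧ q.re = 0}

/-- The quaternion with the given coordinates. -/
def quat (a b c d : ℝ) : ℍ[ℝ] := ⟨a, b, c, d⟩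

@[simp] lemma quat_re (a b c d : ℝ) : (quat a b c d).re = a := rfl
@[simp] lemma quat_imI (a b c d : ℝ) : (quat a b c d).imI = b := rfl
@[simp] lemma quat_imJ (a b c d : ℝ) : (quat a b c d).imJ = c := rfl
@[simp] lemma quat_imK (a b c d : ℝ) : (quat a b c d).imK = d := rfl

/-- The quaternion `i`. -/
def qi : ℍ[ℝ] := quat 0 1 0 0

lemma qi_mem : qi ∈ imSphere := by
  refine ⟨(norm_eq_one_iff_quat _).2 ?_, rfl⟩
  simp [qi]

lemma re_conj (g v : ℍ[ℝ]) : (g * v * star g).re = Quaternion.normSq g * v.re := by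
  rw [Quaternion.normSq_def']
  simp only [Quaternion.re_mul, Quaternion.imI_mul, Quaternion.imJ_mul, Quaternion.imK_mul,
    Quaternion.re_star, Quaternion.imI_star, Quaternion.imJ_star, Quaternion.imK_star]
  ring

/-- Conjugation of imaginary quaternions. -/
def imAct (g : Sp1) (v : imSphere) : imSphere :=
  ⟨g * v * star (g : ℍ[ℝ]), by
    rw [norm_mul, norm_mul, norm_star, norm_eq_of_mem_sphere, v.2.1]; norm_num, by
    rw [re_conj, v.2.2, mul_zero]⟩

lemma imAct_coe (g : Sp1) (v : imSphere) : (imAct g v : ℍ[ℝ]) = g * v * star (g : ℍ[ℝ]) := rfl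

/-- The base point of the imaginary sphere. -/
def imBase : imSphere := ⟨qi, qi_mem⟩

lemma im_sq (v : imSphere) : (v : ℍ[ℝ]) * v = -1 := by
  have h1 := (norm_eq_one_iff_quat _).1 v.2.1
  have h2 := v.2.2
  ext <;> simp [h2] at h1 ⊢ <;> linarith

lemma imAct_eq_iff (g : Sp1) (v w : imSphere) :
    imAct g v = w ↔ (g : ℍ[ℝ]) * v = w * g := by
  rw [Subtype.ext_iff, imAct_coe, ← coe_inv_sp1, Metric.unitSphere.coe_inv, mul_inv_eq_iff_eq_mul₀]
  rw [← norm_ne_zero_iff, norm_eq_of_mem_sphere]; exact one_ne_zero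

lemma exists_imAct_eq (v : imSphere) (hv : (1 - v * qi : ℍ[ℝ]) ≠ 0) :
    ∃ g : Sp1, (g : ℍ[ℝ]) = ‖(1 - v * qi : ℍ[ℝ])‖⁻¹ • (1 - v * qi : ℍ[ℝ]) ∧ imAct g imBase = v := by
  refine ⟨⟨‖(1 - v * qi : ℍ[ℝ])‖⁻¹ • (1 - v * qi : ℍ[ℝ]), ?_⟩, rfl, ?_⟩
  · rw [mem_sphere_zero_iff_norm, norm_smul, norm_inv, norm_norm,
      inv_mul_cancel₀ (norm_ne_zero_iff.2 hv)]
  · rw [imAct_eq_iff]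
    dsimp only
    rw [smul_mul_assoc, mul_smul_comm]
    congr 1
    have h1 := im_sq v
    have h2 : qi * qi = -1 := im_sq imBase
    change (1 - (v : ℍ[ℝ]) * qi) * qi = v * (1 - v * qi)
    rw [sub_mul, mul_sub, ← mul_assoc, h1, mul_assoc, h2]
    simp [add_comm]

lemma imAct_section : HasLocalSection imAct imBase where
  cont := by
    unfold imAct
    refine Continuous.subtype_mk ?_ _
    fun_prop
  one b := by apply Subtype.ext; simp [imAct_coe]
  mul g h b := by
    apply Subtype.ext
    simp only [imAct_coe, Metric.unitSphere.coe_mul, star_mul, mul_assoc]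
  sec := by
    have hc : Continuous fun v : imSphere => (1 - v * qi : ℍ[ℝ]) := by fun_prop
    have hb : (1 - imBase * qi : ℍ[ℝ]) = (2 : ℝ) • (1 : ℍ[ℝ]) := by
      rw [show (imBase : ℍ[ℝ]) * qi = -1 from im_sq imBase, two_smul]; norm_num
    refine exists_section_of_isEmbedding Topology.IsEmbedding.subtypeVal
      (fun v : imSphere => ‖(1 - v * qi : ℍ[ℝ])‖⁻¹ • (1 - v * qi : ℍ[ℝ]))
      (U := {v | (1 - v * qi : ℍ[ℝ]) ≠ 0}) ?_ ?_ ?_ ?_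
    · refine (isOpen_ne.preimage hc).mem_nhds ?_
      change (1 - imBase * qi : ℍ[ℝ]) ≠ 0
      rw [hb]; exact smul_ne_zero two_ne_zero one_ne_zero
    · refine ContinuousOn.smul (ContinuousOn.inv₀ hc.norm.continuousOn ?_) hc.continuousOn
      exact fun v hv => norm_ne_zero_iff.2 hv.1
    · rw [hb, norm_smul, norm_one, smul_smul]
      norm_num
    · exact fun v hv _ => exists_imAct_eq v hv

lemma imAct_transitive (v : imSphere) : ∃ g, imAct g imBase = v := by
  by_cases h : (1 - v * qi : ℍ[ℝ]) = 0
  · refine ⟨⟨quat 0 0 1 0, ?_⟩, ?_⟩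
    · rw [mem_sphere_zero_iff_norm, norm_eq_one_iff_quat]; norm_num
    · have h3 : (v : ℍ[ℝ]) = -qi := by
        have h2 : qi * qi = -1 := im_sq imBase
        have h4 : (1 - v * qi : ℍ[ℝ]) * qi = 0 := by rw [h, zero_mul]
        rw [sub_mul, mul_assoc, h2, one_mul, mul_neg, mul_one, sub_neg_eq_add] at h4
        exact eq_neg_of_add_eq_zero_right h4
      rw [imAct_eq_iff, h3]
      change quat 0 0 1 0 * qi = -qi * quat 0 0 1 0
      ext <;> simp [qi]
  · obtain ⟨g, -, hg⟩ := exists_imAct_eq v h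
    exact ⟨g, hg⟩

lemma qi_comm {g : ℍ[ℝ]} (h : g * qi = qi * g) : g.imJ = 0 ∧ g.imK = 0 := by
  have h1 := congrArg QuaternionAlgebra.imJ h
  have h2 := congrArg QuaternionAlgebra.imK h
  simp [qi] at h1 h2
  constructor <;> linarith

/-- The stabilizer of `i` in the unit quaternions. -/
def stabI : Set Sp1 := {g | imAct g imBase = imBase}

/-- The circle subgroup of the unit quaternions. -/
def circleToStab (z : Circle) : stabI :=
  ⟨⟨quat (z : ℂ).re (z : ℂ).im 0 0, by
    have h := Circle.normSq_coe z
    rw [Complex.normSq_apply] at h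
    rw [mem_sphere_zero_iff_norm, norm_eq_one_iff_quat]
    simp only [quat_re, quat_imI, quat_imJ, quat_imK]
    linarith⟩, by
    refine (imAct_eq_iff _ _ _).2 ?_
    change quat (z : ℂ).re (z : ℂ).im 0 0 * qi = qi * quat (z : ℂ).re (z : ℂ).im 0 0
    ext <;> simp [qi]⟩

/-- The coordinates of an element of the stabilizer of `i`. -/
def stabToCircle (g : stabI) : Circle :=
  ⟨⟨(g.1 : ℍ[ℝ]).re, (g.1 : ℍ[ℝ]).imI⟩, by
    have h1 := qi_comm ((imAct_eq_iff _ _ _).1 g.2)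
    have h2 := (norm_eq_one_iff_quat _).1 (norm_eq_of_mem_sphere g.1)
    rw [h1.1, h1.2] at h2
    refine mem_sphere_zero_iff_norm.2 ?_
    rw [Complex.norm_def, Complex.normSq_apply]
    simp only
    rw [Real.sqrt_eq_one]
    linarith⟩

/-- The linear identification of quaternions with quadruples. -/
def quatL : (ℝ × ℝ × ℝ) × ℝ →L[ℝ] ℍ[ℝ] :=
  LinearMap.toContinuousLinearMap
    { toFun := fun p => quat p.1.1 p.1.2.1 p.1.2.2 p.2
      map_add' := fun p q => by ext <;> simp
      map_smul' := fun r p => by ext <;> simp }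

lemma quatL_apply (p : (ℝ × ℝ × ℝ) × ℝ) : quatL p = quat p.1.1 p.1.2.1 p.1.2.2 p.2 := rfl

/-- The coordinates of a quaternion. -/
def quatCoord : ℍ[ℝ] →L[ℝ] (ℝ × ℝ × ℝ) × ℝ :=
  LinearMap.toContinuousLinearMap
    { toFun := fun q => ((q.re, q.imI, q.imJ), q.imK)
      map_add' := fun p q => by simp
      map_smul' := fun r p => by simp }

lemma quatCoord_apply (q : ℍ[ℝ]) : quatCoord q = ((q.re, q.imI, q.imJ), q.imK) := rfl

/-- The linear inclusion of the imaginary quaternions. -/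
def imL : ℝ × ℝ × ℝ →L[ℝ] ℍ[ℝ] :=
  LinearMap.toContinuousLinearMap
    { toFun := fun p => quat 0 p.1 p.2.1 p.2.2
      map_add' := fun p q => by ext <;> simp
      map_smul' := fun r p => by ext <;> simp }

lemma imL_apply (p : ℝ × ℝ × ℝ) : imL p = quat 0 p.1 p.2.1 p.2.2 := rfl

/-- The imaginary coordinates of a quaternion. -/
def imCoord : ℍ[ℝ] →L[ℝ] ℝ × ℝ × ℝ :=
  LinearMap.toContinuousLinearMap
    { toFun := fun q => (q.imI, q.imJ, q.imK)
      map_add' := fun p q => by simp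
      map_smul' := fun r p => by simp }

lemma imCoord_apply (q : ℍ[ℝ]) : imCoord q = (q.imI, q.imJ, q.imK) := rfl

lemma continuous_quat {Y : Type*} [TopologicalSpace Y] {a b c d : Y → ℝ} (ha : Continuous a)
    (hb : Continuous b) (hc : Continuous c) (hd : Continuous d) :
    Continuous fun y => quat (a y) (b y) (c y) (d y) :=
  quatL.continuous.comp ((ha.prodMk (hb.prodMk hc)).prodMk hd)

lemma continuous_circleToStab : Continuous circleToStab := by
  refine Continuous.subtype_mk (Continuous.subtype_mk ?_ _) _
  exact continuous_quat (Complex.continuous_re.comp continuous_subtype_val)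
    (Complex.continuous_im.comp continuous_subtype_val) continuous_const continuous_const

lemma continuous_stabToCircle : Continuous stabToCircle := by
  have h : Continuous fun g : stabI => ((g : Sp1) : ℍ[ℝ]) :=
    continuous_subtype_val.comp continuous_subtype_val
  exact Continuous.subtype_mk (Complex.equivRealProdCLM.symm.continuous.comp
    ((Quaternion.continuous_re.comp h).prodMk (Quaternion.continuous_imI.comp h))) _

lemma circleToStab_stabToCircle (g : stabI) : circleToStab (stabToCircle g) = g := by
  have h1 := qi_comm ((imAct_eq_iff _ _ _).1 g.2)
  apply Subtype.ext
  apply Subtype.ext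
  change quat (g.1 : ℍ[ℝ]).re (g.1 : ℍ[ℝ]).imI 0 0 = g.1
  ext <;> simp [h1]

lemma stabToCircle_circleToStab (z : Circle) : stabToCircle (circleToStab z) = z := by
  apply Subtype.ext
  apply Complex.ext <;> rfl

lemma one_mem_stabI : (1 : Sp1) ∈ stabI := imAct_section.one _

lemma pi1_stabI : Nonempty (HomotopyGroup (Fin 1) stabI ⟨1, one_mem_stabI⟩ ≃*
    Multiplicative ℤ) := by
  obtain ⟨e⟩ := pi1_circle
  have h : circleToStab 1 = ⟨1, one_mem_stabI⟩ := by
    apply Subtype.ext; apply Subtype.ext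
    change quat ((1 : Circle) : ℂ).re ((1 : Circle) : ℂ).im 0 0 = 1
    ext <;> simp
  have h' : stabToCircle ⟨1, one_mem_stabI⟩ = 1 := by
    rw [← h, stabToCircle_circleToStab]
  refine ⟨(piEquiv stabToCircle continuous_stabToCircle h' ⟨?_, ?_⟩).trans e⟩
  · apply Function.LeftInverse.injective (g := piHom circleToStab continuous_circleToStab h)
    intro a
    rw [piHom_comp]
    exact piHom_id _ _ _ circleToStab_stabToCircle a
  · apply Function.RightInverse.surjective (g := piHom circleToStab continuous_circleToStab h)
    intro a
    rw [piHom_comp]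
    exact piHom_id _ _ _ stabToCircle_circleToStab a

lemma finrank_quat : Module.finrank ℝ ℍ[ℝ] = 4 := Quaternion.finrank_eq_four

lemma pi2_imSphere : Nonempty (HomotopyGroup (Fin 2) imSphere imBase ≃* Multiplicative ℤ) := by
  obtain ⟨e⟩ := pi1_stabI
  obtain ⟨e'⟩ := imAct_section.connecting (k := 0) imAct_transitive
    (pi_sphere_eq_one (by rw [finrank_quat]; norm_num) _)
    (pi_sphere_eq_one (by rw [finrank_quat]) _) stabI rfl ⟨1, one_mem_stabI⟩ rfl
  exact ⟨e'.symm.trans e⟩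

/-- The third homotopy group of the group of unit quaternions. -/
theorem pi3_sp1 : Nonempty (HomotopyGroup (Fin 3) Sp1 1 ≃* Multiplicative ℤ) := by
  obtain ⟨e₁⟩ := pi2_imSphere
  let b : ({0}ᶜ : Set (ℝ × ℝ × ℝ)) := ⟨(1, 0, 0), by simp⟩
  obtain ⟨e₂⟩ := nonempty_mulEquiv_sphere (N := Fin 2) imL imCoord (fun x => rfl) imSphere
    (fun q => by
      refine and_congr_right fun _ => ⟨fun h => ?_, fun h => ?_⟩
      · rw [imL_apply, imCoord_apply]
        ext <;> simp [h]
      · rw [← h]; rfl) b imBase rfl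
  have hf : Module.finrank ℝ (ℝ × ℝ × ℝ) = 3 := by simp
  let e₃ := MulEquiv.ofBijective (suspHom (k := 1) (b := b))
    ⟨suspHom_injective (by rw [hf]), suspHom_surjective (by rw [hf]; norm_num)⟩
  obtain ⟨e₄⟩ := nonempty_mulEquiv_sphere (N := Fin 3) quatL quatCoord (fun x => rfl)
    (Metric.sphere (0 : ℍ[ℝ]) 1) (fun q => by
      rw [mem_sphere_zero_iff_norm]
      refine (and_iff_left ?_).symm
      rw [quatL_apply, quatCoord_apply]
      ext <;> rfl) (equator b) (1 : Sp1) (by ext <;> rfl)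
  exact ⟨e₄.symm.trans (e₃.symm.trans (e₂.trans e₁))⟩

end Quaternions
end Pi3

namespace Pi3
open scoped unitInterval Topology.Homotopy
open Set

section SpecialUnitary

variable {n : ℕ}

/-- The matrix underlying an element of `SU n`. -/
def mat (g : SU n) : Matrix (Fin n) (Fin n) ℂ := (g : Matrix.unitaryGroup (Fin n) ℂ)

lemma isEmbedding_mat : Topology.IsEmbedding (mat : SU n → Matrix (Fin n) (Fin n) ℂ) :=
  Topology.IsEmbedding.subtypeVal.comp Topology.IsEmbedding.subtypeVal

lemma continuous_mat : Continuous (mat : SU n → Matrix (Fin n) (Fin n) ℂ) :=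
  isEmbedding_mat.continuous

lemma mat_injective : Function.Injective (mat : SU n → Matrix (Fin n) (Fin n) ℂ) :=
  isEmbedding_mat.injective

@[simp] lemma mat_one : mat (1 : SU n) = 1 := rfl
@[simp] lemma mat_mul (g h : SU n) : mat (g * h) = mat g * mat h := rfl
@[simp] lemma mat_inv (g : SU n) : mat g⁻¹ = (mat g)ᴴ := rfl

lemma mat_mul_conjTranspose (g : SU n) : mat g * (mat g)ᴴ = 1 := by
  rw [← mat_inv, ← mat_mul, mul_inv_cancel, mat_one]

lemma conjTranspose_mul_mat (g : SU n) : (mat g)ᴴ * mat g = 1 := by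
  rw [← mat_inv, ← mat_mul, inv_mul_cancel, mat_one]

lemma det_mat (g : SU n) : (mat g).det = 1 := g.2

lemma exists_mat_eq {A : Matrix (Fin n) (Fin n) ℂ} (h : A * Aᴴ = 1) (hd : A.det = 1) :
    ∃ g : SU n, mat g = A :=
  ⟨⟨⟨A, Matrix.mem_unitaryGroup_iff.2 h⟩, hd⟩, rfl⟩

instance : CompactSpace (SU n) := by
  refine isCompact_univ_iff.1 (isEmbedding_mat.isCompact_iff.2 ?_)
  have hK : IsCompact {M : Matrix (Fin n) (Fin n) ℂ | ∀ i j, M i j ∈ Metric.closedBall (0 : ℂ) 1} := by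
    have h := isCompact_univ_pi (fun i : Fin n => isCompact_univ_pi (fun j : Fin n =>
      isCompact_closedBall (0 : ℂ) 1))
    have h' : {M : Matrix (Fin n) (Fin n) ℂ | ∀ i j, M i j ∈ Metric.closedBall (0 : ℂ) 1} =
        Set.pi univ fun i : Fin n => Set.pi univ fun j : Fin n => Metric.closedBall (0 : ℂ) 1 :=
      Set.ext fun M => ⟨fun h i _ j _ => h i j, fun h i j => h i trivial j trivial⟩
    rw [h']; exact h
  have hC : IsClosed {M : Matrix (Fin n) (Fin n) ℂ | M * Mᴴ = 1 ∧ M.det = 1} := by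
    refine IsClosed.and (isClosed_eq ?_ continuous_const) (isClosed_eq ?_ continuous_const)
    · exact continuous_id.matrix_mul continuous_id.matrix_conjTranspose
    · exact continuous_id.matrix_det
  have hKC := hK.inter_right hC
  convert hKC using 1
  refine Set.ext fun M => ⟨?_, ?_⟩
  · rintro ⟨g, -, rfl⟩
    refine ⟨fun i j => ?_, mat_mul_conjTranspose g, det_mat g⟩
    rw [mem_closedBall_zero_iff]
    exact entry_norm_bound_of_unitary g.1.2 i j
  · rintro ⟨-, h, hd⟩
    obtain ⟨g, hg⟩ := exists_mat_eq h hd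
    exact ⟨g, trivial, hg⟩

end SpecialUnitary

section Reflections

variable {ι : Type*} [Fintype ι] [DecidableEq ι]

/-- The complex reflection with root `a` and parameter `α`. -/
def reflMat (a : ι → ℂ) (α : ℂ) : Matrix ι ι ℂ := 1 - α⁻¹ • vecMulVec a (star a)

lemma reflMat_mulVec (a : ι → ℂ) (α : ℂ) (v : ι → ℂ) :
    reflMat a α *ᵥ v = v - (α⁻¹ * (star a ⬝ᵥ v)) • a := by
  rw [reflMat, sub_mulVec, one_mulVec, smul_mulVec, vecMulVec_mulVec, op_smul_eq_smul, smul_smul]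

lemma reflMat_mul_conjTranspose {a : ι → ℂ} {α : ℂ} (hα : α ≠ 0)
    (ha : star a ⬝ᵥ a = α + star α) : reflMat a α * (reflMat a α)ᴴ = 1 := by
  have hα' : star α ≠ 0 := star_ne_zero.2 hα
  have h1 : vecMulVec a (star a) * vecMulVec a (star a) =
      (α + star α) • vecMulVec a (star a) := by
    rw [vecMulVec_mul_vecMulVec, ha, vecMulVec_smul]
  have h2 : (reflMat a α)ᴴ = 1 - (star α)⁻¹ • vecMulVec a (star a) := by
    rw [reflMat, conjTranspose_sub, conjTranspose_one, conjTranspose_smul, conjTranspose_vecMulVec,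
      star_star, star_inv₀]
  rw [h2, reflMat, sub_mul, mul_sub, mul_sub, one_mul, mul_one, one_mul, smul_mul_smul_comm, h1,
    smul_smul]
  have h3 : α⁻¹ * (star α)⁻¹ * (α + star α) = α⁻¹ + (star α)⁻¹ := by field_simp; ring
  rw [h3, add_smul]
  abel

lemma det_reflMat {a : ι → ℂ} {α : ℂ} (hα : α ≠ 0) (ha : star a ⬝ᵥ a = α + star α) :
    (reflMat a α).det = -(star α / α) := by
  have h : reflMat a α = 1 + replicateCol Unit (-(α⁻¹ • a)) * replicateRow Unit (star a) := by
    rw [← vecMulVec_eq, neg_vecMulVec, smul_vecMulVec, reflMat, sub_eq_add_neg]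
  rw [h, det_one_add_replicateCol_mul_replicateRow, dotProduct_neg, dotProduct_smul, ha,
    smul_eq_mul]
  field_simp
  ring

end Reflections

section Columns

/-- The action of `SU(4)` on vectors. -/
def vecAct (g : SU 4) (v : Fin 4 → ℂ) : Fin 4 → ℂ := mat g *ᵥ v

/-- The standard basis of `ℂ⁴`. -/
def bas (j : Fin 4) : Fin 4 → ℂ := Pi.single j 1

/-- The elements of `SU(4)` fixing the basis vectors after the `m`-th. -/
def fixAbove (m : Fin 4) : Subgroup (SU 4) where
  carrier := {g | ∀ j, m < j → vecAct g (bas j) = bas j}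
  one_mem' := fun j _ => by simp [vecAct]
  mul_mem' := fun {g h} hg hh j hj => by
    have h1 := hg j hj
    have h2 := hh j hj
    simp only [vecAct] at h1 h2 ⊢
    rw [mat_mul, ← mulVec_mulVec, h2, h1]
  inv_mem' := fun {g} hg j hj => by
    have h1 := hg j hj
    simp only [vecAct] at h1 ⊢
    conv_lhs => rw [← h1]
    rw [mat_inv, mulVec_mulVec, conjTranspose_mul_mat, one_mulVec]

/-- Unit vectors supported in the first `m + 1` coordinates. -/
def unitVec (m : Fin 4) : Set (Fin 4 → ℂ) := {v | star v ⬝ᵥ v = 1 ∧ ∀ j, m < j → v j = 0}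

lemma star_vecAct_dotProduct (g : SU 4) (v w : Fin 4 → ℂ) :
    star (vecAct g v) ⬝ᵥ vecAct g w = star v ⬝ᵥ w := by
  rw [vecAct, vecAct, star_mulVec, ← dotProduct_mulVec, mulVec_mulVec, conjTranspose_mul_mat,
    one_mulVec]

lemma star_bas_dotProduct (j : Fin 4) (v : Fin 4 → ℂ) : star (bas j) ⬝ᵥ v = v j := by
  rw [bas, Pi.star_single, star_one, single_one_dotProduct]

lemma bas_apply (i j : Fin 4) : bas i j = if j = i then 1 else 0 := by
  rw [bas, Pi.single_apply]

lemma vecAct_mem_unitVec {m : Fin 4} {g : SU 4} (hg : g ∈ fixAbove m) :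
    vecAct g (bas m) ∈ unitVec m := by
  refine ⟨?_, fun j hj => ?_⟩
  · rw [star_vecAct_dotProduct, star_bas_dotProduct, bas_apply, if_pos rfl]
  · rw [← star_bas_dotProduct j (vecAct g (bas m)), ← hg j hj, star_vecAct_dotProduct, star_bas_dotProduct, bas_apply,
      if_neg hj.ne']

/-- The diagonal correction in the section of the column map. -/
def phases (m : Fin 4) (α : ℂ) : Fin 4 → ℂ :=
  fun j => if j = 0 then α / star α else if j = m then -1 else 1

lemma exists_fixAbove_reflMat {m : Fin 4} (hm : m ≠ 0) {v : Fin 4 → ℂ} (hv : v ∈ unitVec m)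
    (h : 1 + star (v m) ≠ 0) :
    ∃ g ∈ fixAbove m, mat g = reflMat (bas m + v) (1 + star (v m)) *
      diagonal (phases m (1 + star (v m))) ∧ vecAct g (bas m) = v := by
  set α := 1 + star (v m) with hα
  have ha : star (bas m + v) ⬝ᵥ (bas m + v) = α + star α := by
    rw [star_add, add_dotProduct, dotProduct_add, dotProduct_add, hv.1, star_bas_dotProduct,
      star_bas_dotProduct, bas_apply, if_pos rfl, bas, dotProduct_single_one, hα, Pi.star_apply,
      star_add, star_one, star_star]
    ring
  have hα' : star α ≠ 0 := star_ne_zero.2 h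
  have hd : diagonal (phases m α) * (diagonal (phases m α))ᴴ = 1 := by
    rw [diagonal_conjTranspose, diagonal_mul_diagonal, ← diagonal_one]
    congr 1
    funext j
    simp only [phases, Pi.star_apply]
    split_ifs
    · rw [star_div₀, star_star]; field_simp
    · simp
    · simp
  have hdet : (diagonal (phases m α)).det = -(α / star α) := by
    rw [det_diagonal, Fin.prod_univ_four]
    fin_cases m <;> simp [phases] at hm ⊢
  obtain ⟨g, hg⟩ := exists_mat_eq (A := reflMat (bas m + v) α * diagonal (phases m α))
    (by rw [conjTranspose_mul, mul_assoc, ← mul_assoc (Matrix.diagonal (phases m α)), hd, one_mul,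
          reflMat_mul_conjTranspose h ha])
    (by rw [det_mul, det_reflMat h ha, hdet]; field_simp)
  have hcol : ∀ j, vecAct g (bas j) = phases m α j •
      (bas j - (α⁻¹ * star ((bas m + v) j)) • (bas m + v)) := fun j => by
    have h1 : diagonal (phases m α) *ᵥ bas j = phases m α j • bas j := by
      funext i
      rw [mulVec_diagonal, Pi.smul_apply, bas_apply]
      split_ifs with hi
      · rw [hi, smul_eq_mul]
      · simp
    rw [vecAct, hg, ← mulVec_mulVec, h1, mulVec_smul, reflMat_mulVec, bas, dotProduct_single_one]
    rfl
  refine ⟨g, fun j hj => ?_, hg, ?_⟩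
  · rw [hcol]
    have h1 : phases m α j = 1 := by
      have h0 : j ≠ 0 := (Fin.zero_le _).trans_lt hj |>.ne'
      simp [phases, h0, hj.ne']
    rw [h1, Pi.add_apply, hv.2 j hj, bas_apply, if_neg hj.ne']
    simp
  · rw [hcol]
    have h1 : phases m α m = -1 := by simp [phases, hm]
    rw [h1, Pi.add_apply, bas_apply, if_pos rfl, star_add, star_one, ← hα, inv_mul_cancel₀ h]
    simp

end Columns
end Pi3

namespace Pi3
open scoped unitInterval Topology.Homotopy
open Set

section ColumnReduction

/-- The squared norm of a vector in `ℂ⁴`. -/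
def sqNorm (v : Fin 4 → ℂ) : ℝ := ∑ j, Complex.normSq (v j)

lemma star_dotProduct_self (v : Fin 4 → ℂ) : star v ⬝ᵥ v = (sqNorm v : ℂ) := by
  simp only [dotProduct, sqNorm, Complex.ofReal_sum, Pi.star_apply, Complex.star_def,
    Complex.normSq_eq_conj_mul_self]

lemma continuous_sqNorm : Continuous sqNorm :=
  continuous_finsetSum _ fun j _ => Complex.continuous_normSq.comp (continuous_apply j)

lemma sqNorm_pos {v : Fin 4 → ℂ} (hv : v ≠ 0) : 0 < sqNorm v := by
  obtain ⟨j, hj⟩ := Function.ne_iff.1 hv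
  exact Finset.sum_pos' (fun i _ => Complex.normSq_nonneg _)
    ⟨j, Finset.mem_univ _, Complex.normSq_pos.2 hj⟩

lemma mem_unitVec {m : Fin 4} {v : Fin 4 → ℂ} :
    v ∈ unitVec m ↔ sqNorm v = 1 ∧ ∀ j, m < j → v j = 0 := by
  refine and_congr_left fun _ => ?_
  rw [star_dotProduct_self, ← Complex.ofReal_one, Complex.ofReal_inj]

lemma eq_neg_bas {m : Fin 4} {v : Fin 4 → ℂ} (hv : v ∈ unitVec m) (h : v m = -1) :
    v = -bas m := by
  have h1 := (mem_unitVec.1 hv).1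
  rw [sqNorm, ← Finset.add_sum_erase _ _ (Finset.mem_univ m), h, Complex.normSq_neg,
    Complex.normSq_one, add_eq_left,
    Finset.sum_eq_zero_iff_of_nonneg fun i _ => Complex.normSq_nonneg _] at h1
  funext j
  rw [Pi.neg_apply, bas_apply]
  split_ifs with hj
  · rw [hj, h]
  · rw [neg_zero]
    exact Complex.normSq_eq_zero.1 (h1 j (Finset.mem_erase.2 ⟨hj, Finset.mem_univ _⟩))

lemma exists_fixAbove_vecAct {m : Fin 4} (hm : m ≠ 0) {v : Fin 4 → ℂ} (hv : v ∈ unitVec m) :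
    ∃ g ∈ fixAbove m, vecAct g (bas m) = v := by
  by_cases h : 1 + star (v m) = 0
  · have h1 : v = -bas m := by
      refine eq_neg_bas hv ?_
      rw [← star_star (v m), eq_neg_of_add_eq_zero_right h, star_neg, star_one]
    let d : Fin 4 → ℂ := fun j => if j = 0 ∨ j = m then -1 else 1
    obtain ⟨g, hg⟩ := exists_mat_eq (A := Matrix.diagonal d) (by
      rw [diagonal_conjTranspose, diagonal_mul_diagonal, ← diagonal_one]
      congr 1
      funext j
      simp only [d, Pi.star_apply]
      split_ifs <;> simp) (by
      rw [det_diagonal, Fin.prod_univ_four]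
      fin_cases m <;> simp [d] at hm ⊢)
    have hcol : ∀ j, vecAct g (bas j) = d j • bas j := fun j => by
      funext i
      rw [vecAct, hg, mulVec_diagonal, Pi.smul_apply, bas_apply]
      split_ifs with hi
      · rw [hi, smul_eq_mul]
      · simp
    refine ⟨g, fun j hj => ?_, ?_⟩
    · have h0 : j ≠ 0 := (Fin.zero_le _).trans_lt hj |>.ne'
      rw [hcol]
      simp [d, h0, hj.ne']
    · rw [hcol, h1]
      simp [d]
  · obtain ⟨g, hg, -, h'⟩ := exists_fixAbove_reflMat hm hv h
    exact ⟨g, hg, h'⟩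

lemma range_fixAbove {m : Fin 4} (hm : m ≠ 0) :
    (range fun g : fixAbove m => vecAct g (bas m)) = unitVec m := by
  refine Set.ext fun v => ⟨?_, fun hv => ?_⟩
  · rintro ⟨g, rfl⟩
    exact vecAct_mem_unitVec g.2
  · obtain ⟨g, hg, h⟩ := exists_fixAbove_vecAct hm hv
    exact ⟨⟨g, hg⟩, h⟩

lemma continuous_vecAct : Continuous fun p : SU 4 × (Fin 4 → ℂ) => vecAct p.1 p.2 :=
  (continuous_mat.comp continuous_fst).matrix_mulVec continuous_snd

instance (m : Fin 4) : CompactSpace (fixAbove m) := by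
  refine isCompact_iff_compactSpace.1 (IsClosed.isCompact ?_)
  have h : ((fixAbove m : Subgroup (SU 4)) : Set (SU 4)) =
      ⋂ j, ⋂ (_ : m < j), {g | vecAct g (bas j) = bas j} :=
    Set.ext fun g => by simp only [mem_iInter]; exact Iff.rfl
  rw [h]
  exact isClosed_iInter fun j => isClosed_iInter fun _ =>
    isClosed_eq (continuous_vecAct.comp (continuous_id.prodMk continuous_const)) continuous_const

lemma fixAbove_section {m : Fin 4} (hm : m ≠ 0) :
    HasLocalSection (fun (g : fixAbove m) v => vecAct g v) (bas m) where
  cont := continuous_vecAct.comp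
    ((continuous_subtype_val.comp continuous_fst).prodMk continuous_snd)
  one v := one_mulVec v
  mul g h v := (mulVec_mulVec _ _ _).symm
  sec := by
    have hc : Continuous fun v : Fin 4 → ℂ => 1 + star (v m) := by fun_prop
    refine exists_section_of_isEmbedding (isEmbedding_mat.comp Topology.IsEmbedding.subtypeVal)
      (fun v => reflMat (bas m + v) (1 + star (v m)) *
        Matrix.diagonal (phases m (1 + star (v m))))
      (U := {v | 1 + star (v m) ≠ 0}) ?_ ?_ ?_ ?_
    · refine (isOpen_ne.preimage hc).mem_nhds ?_
      change 1 + star (bas m m) ≠ 0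
      rw [bas_apply, if_pos rfl, star_one]
      norm_num
    · refine ContinuousOn.mono ?_ inter_subset_left
      rw [continuousOn_iff_continuous_domRestrict]
      have h1 := hc.comp (continuous_subtype_val (p := fun v => v ∈ {v | 1 + star (v m) ≠ 0}))
      have hv : Continuous fun v : {v : Fin 4 → ℂ | 1 + star (v m) ≠ 0} => bas m + v.1 :=
        continuous_const.add continuous_subtype_val
      refine Continuous.matrix_mul ?_ (Continuous.matrix_diagonal ?_)
      · exact continuous_const.sub ((h1.inv₀ fun v => v.2).smul
          (hv.matrix_vecMulVec hv.star))
      · refine continuous_pi fun j => ?_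
        by_cases h0 : j = 0
        · simp only [phases, if_pos h0]
          exact h1.div h1.star fun v => star_ne_zero.2 v.2
        · simp only [phases, if_neg h0]
          exact continuous_const
    · have h2 : (1 : ℂ) + 1 = 2 := by norm_num
      change _ = (1 : Matrix (Fin 4) (Fin 4) ℂ)
      ext i j
      fin_cases m <;> fin_cases i <;> fin_cases j <;>
        simp [reflMat, phases, vecMulVec_apply, bas_apply, h2] at hm ⊢ <;> norm_num
    · intro v hv hr
      rw [range_fixAbove hm] at hr
      obtain ⟨g, hg, hgv⟩ := exists_fixAbove_reflMat hm hr hv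
      exact ⟨⟨g, hg⟩, hgv⟩

/-- Extension of a vector by zero. -/
def extVec (m : Fin 4) (x : Fin (m.val + 1) → ℂ) : Fin 4 → ℂ :=
  fun j => if h : j.val < m.val + 1 then x ⟨j, h⟩ else 0

/-- The first `m + 1` coordinates of a vector. -/
def headVec (m : Fin 4) (v : Fin 4 → ℂ) : Fin (m.val + 1) → ℂ :=
  fun j => v ⟨j, j.2.trans_le m.2⟩

lemma continuous_extVec (m : Fin 4) : Continuous (extVec m) := by
  refine continuous_pi fun j => ?_
  by_cases h : j.val < m.val + 1
  · simp only [extVec, dif_pos h]; exact continuous_apply _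
  · simp only [extVec, dif_neg h]; exact continuous_const

lemma continuous_headVec (m : Fin 4) : Continuous (headVec m) :=
  continuous_pi fun _ => continuous_apply _

lemma extVec_headVec {m : Fin 4} {v : Fin 4 → ℂ} (hv : ∀ j, m < j → v j = 0) :
    extVec m (headVec m v) = v := by
  funext j
  rw [extVec]
  split_ifs with h
  · rfl
  · exact (hv j (by rw [Fin.lt_def]; omega)).symm

lemma headVec_extVec (m : Fin 4) (x : Fin (m.val + 1) → ℂ) : headVec m (extVec m x) = x := by
  funext j
  exact dif_pos j.2

lemma normalize_mem_unitVec {m : Fin 4} {x : Fin (m.val + 1) → ℂ} (hx : x ≠ 0) :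
    (((Real.sqrt (sqNorm (extVec m x)))⁻¹ : ℝ) : ℂ) • extVec m x ∈ unitVec m := by
  have h0 : extVec m x ≠ 0 := fun h => hx (by rw [← headVec_extVec m x, h]; rfl)
  have hp := sqNorm_pos h0
  refine mem_unitVec.2 ⟨?_, fun j hj => ?_⟩
  · have h1 : ∀ (r : ℝ) v, sqNorm ((r : ℂ) • v) = r ^ 2 * sqNorm v := fun r v => by
      simp only [sqNorm, Pi.smul_apply, smul_eq_mul, Complex.normSq_mul, Complex.normSq_ofReal,
        Finset.mul_sum, sq]
    rw [h1, inv_pow, Real.sq_sqrt hp.le, inv_mul_cancel₀ hp.ne']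
  · rw [Pi.smul_apply, extVec, dif_neg (by rw [Fin.lt_def] at hj; omega), smul_zero]

lemma htpyIn_unitVec {k : ℕ} {m : Fin 4} (hk : k + 2 ≤ 2 * (m.val + 1))
    {f : (Fin k → I) → Fin 4 → ℂ} (hf : Continuous f) (hu : ∀ u, f u ∈ unitVec m)
    (hb : ∀ u ∈ Cube.boundary (Fin k), f u = bas m) :
    HtpyIn (unitVec m) (Cube.boundary (Fin k)) f (fun _ => bas m) := by
  have hbas : bas m ∈ unitVec m := by
    have := vecAct_mem_unitVec (one_mem (fixAbove m))
    rwa [vecAct, mat_one, one_mulVec] at this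
  have hne : ∀ v ∈ unitVec m, headVec m v ≠ 0 := fun v hv h => by
    have h1 : v = 0 := by
      rw [← extVec_headVec hv.2, h]
      funext j
      simp [extVec]
    have h2 := (mem_unitVec.1 hv).1
    rw [h1] at h2
    simp [sqNorm] at h2
  have hφ : ∀ v ∈ unitVec m, (((Real.sqrt (sqNorm (extVec m (headVec m v))))⁻¹ : ℝ) : ℂ) •
      extVec m (headVec m v) = v := fun v hv => by
    rw [extVec_headVec hv.2, (mem_unitVec.1 hv).1]
    simp
  have h1 := htpyIn_const_of_lt (E := Fin (m.val + 1) → ℂ) (by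
      rw [Module.finrank_pi_fintype, Finset.sum_const, Finset.card_univ, Fintype.card_fin,
        Complex.finrank_real_complex, smul_eq_mul]
      omega)
    (hne _ hbas) (fun u => headVec m (f u)) ((continuous_headVec m).comp hf)
    (fun u => hne _ (hu u)) (fun u h => by rw [hb u h])
  have h2 := h1.map (S' := unitVec m)
    (fun x => (((Real.sqrt (sqNorm (extVec m x)))⁻¹ : ℝ) : ℂ) • extVec m x) ?_
    (fun x hx => normalize_mem_unitVec hx)
  · simpa only [hφ _ (hu _), hφ _ hbas] using h2
  · have hc : Continuous fun x : Fin (m.val + 1) → ℂ => Real.sqrt (sqNorm (extVec m x)) :=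
      Real.continuous_sqrt.comp (continuous_sqNorm.comp (continuous_extVec m))
    refine ContinuousOn.smul (Complex.continuous_ofReal.comp_continuousOn
      (ContinuousOn.inv₀ hc.continuousOn fun x hx => ?_)) (continuous_extVec m).continuousOn
    have h0 : extVec m x ≠ 0 := fun h => hx (by
      rw [mem_singleton_iff, ← headVec_extVec m x, h]; rfl)
    exact (Real.sqrt_pos.2 (sqNorm_pos h0)).ne'

/-- Maps of low-dimensional cubes deform into the stabilizer of a further basis vector. -/
lemma htpyIn_fixAbove {k : ℕ} {m : Fin 4} (hm : m ≠ 0) (hk : k + 2 ≤ 2 * (m.val + 1))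
    {F : (Fin k → I) → SU 4} (hF : Continuous F) (hu : ∀ u, F u ∈ fixAbove m)
    (hb : ∀ u ∈ Cube.boundary (Fin k), vecAct (F u) (bas m) = bas m) :
    ∃ F', HtpyIn (fixAbove m : Set (SU 4)) (Cube.boundary (Fin k)) F F' ∧
      ∀ u, vecAct (F' u) (bas m) = bas m := by
  have h := (fixAbove_section hm).lift_null (F := fun u => ⟨F u, hu u⟩)
    (Continuous.subtype_mk hF _) (by
      rw [range_fixAbove hm]
      exact htpyIn_unitVec hk (continuous_vecAct.comp (hF.prodMk continuous_const))
        (fun u => vecAct_mem_unitVec (hu u)) hb)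
  obtain ⟨F', h1, h2⟩ := h
  exact ⟨fun u => F' u, h1.map (fun g => (g : SU 4)) continuous_subtype_val.continuousOn
    (fun g _ => g.2), h2⟩

end ColumnReduction
end Pi3

namespace Pi3
open scoped unitInterval Topology.Homotopy Quaternion
open Set

section Iota

/-- The first complex coordinate of a quaternion. -/
def zc (q : ℍ[ℝ]) : ℂ := ⟨q.re, q.imI⟩

/-- The second complex coordinate of a quaternion. -/
def wc (q : ℍ[ℝ]) : ℂ := ⟨q.imJ, q.imK⟩

lemma zc_mul (p q : ℍ[ℝ]) : zc (p * q) = zc p * zc q - wc p * star (wc q) := by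
  apply Complex.ext <;> simp [zc, wc] <;> ring

lemma wc_mul (p q : ℍ[ℝ]) : wc (p * q) = zc p * wc q + wc p * star (zc q) := by
  apply Complex.ext <;> simp [zc, wc] <;> ring

lemma zc_star (q : ℍ[ℝ]) : zc (star q) = star (zc q) := by
  apply Complex.ext <;> simp [zc]

lemma wc_star (q : ℍ[ℝ]) : wc (star q) = -wc q := by
  apply Complex.ext <;> simp [wc]

lemma zc_wc_norm (q : Sp1) : zc q * star (zc q) + wc q * star (wc q) = 1 := by
  have h := sp1_normSq q
  rw [Quaternion.normSq_def'] at h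
  apply Complex.ext
  · simp [zc, wc]; linarith
  · simp [zc, wc]; ring

lemma quat_ext_zc {p q : ℍ[ℝ]} (hz : zc p = zc q) (hw : wc p = wc q) : p = q := by
  have h1 := congrArg Complex.re hz
  have h2 := congrArg Complex.im hz
  have h3 := congrArg Complex.re hw
  have h4 := congrArg Complex.im hw
  exact QuaternionAlgebra.ext h1 h2 h3 h4

lemma continuous_zc : Continuous zc :=
  Complex.equivRealProdCLM.symm.continuous.comp
    (Quaternion.continuous_re.prodMk Quaternion.continuous_imI)

lemma continuous_wc : Continuous wc :=
  Complex.equivRealProdCLM.symm.continuous.comp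
    (Quaternion.continuous_imJ.prodMk Quaternion.continuous_imK)

/-- The matrix `diag(a, 1)` for a unit quaternion `a`, viewed as an element of `SU(2)`. -/
def iotaMat (q : ℍ[ℝ]) : Matrix (Fin 4) (Fin 4) ℂ :=
  !![zc q, wc q, 0, 0; -star (wc q), star (zc q), 0, 0; 0, 0, 1, 0; 0, 0, 0, 1]

lemma iotaMat_mul (p q : ℍ[ℝ]) : iotaMat (p * q) = iotaMat p * iotaMat q := by
  ext i j
  fin_cases i <;> fin_cases j <;>
    simp [iotaMat, Matrix.mul_apply, Fin.sum_univ_four, zc_mul, wc_mul] <;> ring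

lemma iotaMat_one : iotaMat 1 = 1 := by
  have h1 : zc 1 = 1 := by apply Complex.ext <;> simp [zc]
  have h2 : wc 1 = 0 := by apply Complex.ext <;> simp [wc]
  ext i j
  fin_cases i <;> fin_cases j <;> simp [iotaMat, h1, h2]

lemma iotaMat_star (q : ℍ[ℝ]) : iotaMat (star q) = (iotaMat q)ᴴ := by
  ext i j
  fin_cases i <;> fin_cases j <;> simp [iotaMat, zc_star, wc_star]

lemma det_iotaMat (q : Sp1) : (iotaMat q).det = 1 := by
  rw [← zc_wc_norm q]
  simp [iotaMat, det_succ_row_zero, Fin.sum_univ_succ, Fin.succAbove]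

lemma iotaMat_unitary (q : Sp1) : iotaMat q * (iotaMat q)ᴴ = 1 := by
  rw [← iotaMat_star, ← iotaMat_mul, ← coe_inv_sp1, ← Metric.unitSphere.coe_mul, mul_inv_cancel,
    Metric.unitSphere.coe_one, iotaMat_one]

/-- The inclusion of the unit quaternions in `SU(4)`. -/
def iota : Sp1 →* SU 4 where
  toFun q := ⟨⟨iotaMat q, Matrix.mem_unitaryGroup_iff.2 (iotaMat_unitary q)⟩, det_iotaMat q⟩
  map_one' := mat_injective iotaMat_one
  map_mul' p q := mat_injective (iotaMat_mul p q)

lemma mat_iota (q : Sp1) : mat (iota q) = iotaMat q := rfl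

lemma continuous_iotaMat : Continuous iotaMat := by
  refine continuous_matrix fun i j => ?_
  have h1 := continuous_zc
  have h2 := continuous_wc
  fin_cases i <;> fin_cases j <;> simp only [iotaMat] <;>
    first
      | exact h1
      | exact h2
      | exact h1.star
      | exact h2.star.neg
      | exact continuous_const

lemma continuous_iota : Continuous iota :=
  isEmbedding_mat.continuous_iff.2 (continuous_iotaMat.comp continuous_subtype_val)

lemma iota_injective : Function.Injective iota := by
  intro p q h
  have h1 : iotaMat p = iotaMat q := congrArg mat h
  exact Subtype.ext (quat_ext_zc (congrFun (congrFun h1 0) 0) (congrFun (congrFun h1 0) 1))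

lemma vecAct_bas (g : SU 4) (i j : Fin 4) : vecAct g (bas j) i = mat g i j := by
  rw [vecAct, bas, mulVec_single_one, col_apply]

lemma iota_mem_fixAbove (q : Sp1) : iota q ∈ fixAbove 1 := by
  intro j hj
  funext i
  rw [vecAct_bas, mat_iota, bas_apply]
  fin_cases j <;> fin_cases i <;> simp [iotaMat] at hj ⊢

lemma mem_fixAbove_iff {m m' : Fin 4} (h : m.val = m'.val + 1) (g : SU 4) :
    g ∈ fixAbove m' ↔ g ∈ fixAbove m ∧ vecAct g (bas m) = bas m := by
  refine ⟨fun hg => ⟨fun j hj => hg j ?_, hg m ?_⟩, fun hg j hj => ?_⟩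
  · rw [Fin.lt_def] at *; omega
  · rw [Fin.lt_def]; omega
  · rcases eq_or_ne j m with rfl | hne
    · exact hg.2
    · refine hg.1 j ?_
      have := Fin.val_ne_of_ne hne
      rw [Fin.lt_def] at *; omega

/-- The quaternion with the coordinates of the first row of a matrix. -/
def rowQuat (g : SU 4) : ℍ[ℝ] := quat (mat g 0 0).re (mat g 0 0).im (mat g 0 1).re (mat g 0 1).im

lemma continuous_rowQuat : Continuous rowQuat := by
  have h : ∀ i j, Continuous fun g : SU 4 => mat g i j := fun i j =>
    continuous_mat.matrix_elem i j
  exact continuous_quat (Complex.continuous_re.comp (h 0 0)) (Complex.continuous_im.comp (h 0 0))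
    (Complex.continuous_re.comp (h 0 1)) (Complex.continuous_im.comp (h 0 1))

lemma mat_of_mem_fixAbove {g : SU 4} (hg : g ∈ fixAbove 1) : mat g = iotaMat (rowQuat g) := by
  have hcol : ∀ g ∈ fixAbove 1, ∀ i j, 1 < j → mat g i j = if i = j then 1 else 0 :=
    fun g hg i j hj => by rw [← vecAct_bas, hg j hj, bas_apply, eq_comm]
  have hrow : ∀ i j, 1 < i → mat g i j = if i = j then 1 else 0 := fun i j hi => by
    have h1 := hcol _ (inv_mem hg) j i hi
    rw [mat_inv, conjTranspose_apply] at h1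
    rw [← star_star (mat g i j), h1, apply_ite star, star_one, star_zero]
    exact if_congr eq_comm rfl rfl
  have hd := det_mat g
  have hu : ∀ i j, (mat g * (mat g)ᴴ) i j = (1 : Matrix (Fin 4) (Fin 4) ℂ) i j := fun i j => by
    rw [mat_mul_conjTranspose]
  obtain ⟨a, b, c, d, ha, hb, hform⟩ : ∃ a b c d : ℂ, mat g 0 0 = a ∧ mat g 0 1 = b ∧
      mat g = !![a, b, 0, 0; c, d, 0, 0; 0, 0, 1, 0; 0, 0, 0, 1] := by
    refine ⟨_, _, mat g 1 0, mat g 1 1, rfl, rfl, ?_⟩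
    ext i j
    fin_cases i <;> fin_cases j <;> first
      | rfl
      | exact hrow _ _ (by decide)
      | exact hcol g hg _ _ (by decide)
  have h00 := hu 0 0
  have h01 := hu 1 0
  rw [hform] at hd h00 h01
  simp [det_succ_row_zero, Fin.sum_univ_succ, Fin.succAbove] at hd
  simp [Matrix.mul_apply, Fin.sum_univ_four] at h00 h01
  have e1 : d = star a := by
    simp only [Complex.star_def]
    linear_combination (-d) * h00 + starRingEnd ℂ a * hd + b * h01
  have e2 : c = -star b := by
    simp only [Complex.star_def]
    linear_combination (-c) * h00 - starRingEnd ℂ b * hd + a * h01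
  have hz : zc (rowQuat g) = a := by rw [← ha]; rfl
  have hw : wc (rowQuat g) = b := by rw [← hb]; rfl
  rw [hform, iotaMat, hz, hw, e1, e2]

lemma rowQuat_mem {g : SU 4} (hg : g ∈ fixAbove 1) : rowQuat g ∈ Metric.sphere (0 : ℍ[ℝ]) 1 := by
  have h := congrFun (congrFun (mat_mul_conjTranspose g) 0) 0
  rw [mat_of_mem_fixAbove hg, ← iotaMat_star, ← iotaMat_mul, Quaternion.self_mul_star] at h
  have h1 := congrArg Complex.re h
  simp [iotaMat, zc] at h1
  rw [mem_sphere_zero_iff_norm, norm_eq_one_iff_quat, ← Quaternion.normSq_def', h1]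

/-- Maps of cubes of dimension at most four deform into the unit quaternions. -/
lemma htpyIn_iota {k : ℕ} (hk : k ≤ 4) {F : (Fin k → I) → SU 4} (hF : Continuous F)
    (hb : ∀ u ∈ Cube.boundary (Fin k), F u ∈ fixAbove 1) :
    ∃ l : (Fin k → I) → Sp1, Continuous l ∧
      HtpyIn univ (Cube.boundary (Fin k)) F (fun u => iota (l u)) := by
  have h21 := mem_fixAbove_iff (m := 2) (m' := 1) rfl
  have h32 := mem_fixAbove_iff (m := 3) (m' := 2) rfl
  have hlast : ∀ {F F' : (Fin k → I) → SU 4} {S : Set (SU 4)},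
      HtpyIn S (Cube.boundary (Fin k)) F F' → Continuous F' ∧ (∀ u, F' u ∈ S) ∧
        ∀ u ∈ Cube.boundary (Fin k), F' u = F u := by
    rintro F F' S ⟨H, hH, h0, h1, hS, hA⟩
    refine ⟨?_, fun u => h1 u ▸ hS _, fun u hu => h1 u ▸ hA 1 u hu⟩
    rw [show F' = fun u => H (1, u) from funext fun u => (h1 u).symm]
    fun_prop
  obtain ⟨F₁, hF₁, h₁⟩ := htpyIn_fixAbove (m := 3) (by decide) (by simp; omega) hF
    (fun u j hj => absurd (Fin.lt_def.1 hj) (by have := j.2; simp; omega))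
    (fun u hu => ((h32 _).1 ((h21 _).1 (hb u hu)).1).2)
  obtain ⟨c₁, m₁, b₁⟩ := hlast hF₁
  have m₁' : ∀ u, F₁ u ∈ fixAbove 2 := fun u => (h32 _).2 ⟨m₁ u, h₁ u⟩
  obtain ⟨F₂, hF₂, h₂⟩ := htpyIn_fixAbove (m := 2) (by decide) (by simp; omega) c₁ m₁'
    (fun u hu => by rw [b₁ u hu]; exact ((h21 _).1 (hb u hu)).2)
  obtain ⟨c₂, m₂, b₂⟩ := hlast hF₂
  have m₂' : ∀ u, F₂ u ∈ fixAbove 1 := fun u => (h21 _).2 ⟨m₂ u, h₂ u⟩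
  refine ⟨fun u => ⟨rowQuat (F₂ u), rowQuat_mem (m₂' u)⟩,
    Continuous.subtype_mk (continuous_rowQuat.comp c₂) _, ?_⟩
  have h : (fun u => iota ⟨rowQuat (F₂ u), rowQuat_mem (m₂' u)⟩) = F₂ := by
    funext u
    exact mat_injective (mat_of_mem_fixAbove (m₂' u)).symm
  rw [h]
  exact (hF₁.mono (subset_univ _)).trans (hF₂.mono (subset_univ _))

lemma piHom_iota_bijective : Function.Bijective
    (piHom iota continuous_iota (map_one iota) : HomotopyGroup (Fin 3) Sp1 1 →* _) := by
  constructor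
  · rw [injective_iff_map_eq_one]
    intro a ha
    obtain ⟨f, rfl⟩ := exists_rep a
    rw [piHom_cls, cls_eq_one] at ha
    obtain ⟨H, hH, h0, h1, hb⟩ := exists_homotopy ha
    simp only [mapLoop_apply] at h0
    have hF : Continuous fun u : Fin 4 → I => H (u 0, Fin.tail u) :=
      hH.comp ((continuous_apply 0).prodMk continuous_tail)
    have hc : ∀ t y, (fun u : Fin 4 → I => H (u 0, Fin.tail u)) (Fin.cons t y) = H (t, y) :=
      fun t y => by simp only [Fin.cons_zero, Fin.tail_cons]
    obtain ⟨l, hl, K, hK, hK0, hK1, -, hA⟩ := htpyIn_iota le_rfl hF (fun u hu => by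
      rw [mem_boundary_succ] at hu
      rcases hu with hu | hu | hu
      · simp only [hu, h0]; exact iota_mem_fixAbove _
      · simp only [hu, h1]; exact one_mem _
      · simp only [hb _ _ hu]; exact one_mem _)
    simp only at hK1 hA
    have hlb : ∀ t y, Fin.cons t y ∈ Cube.boundary (Fin 4) → iota (l (Fin.cons t y)) = H (t, y) :=
      fun t y h => by rw [← hK1, hA 1 _ h]; exact hc t y
    rw [cls_eq_one]
    refine homotopic_of _ _ (fun p => l (Fin.cons p.1 p.2)) (hl.comp continuous_cons)
      (fun y => ?_) (fun y => ?_) (fun t y hy => ?_)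
    · apply iota_injective
      rw [hlb _ _ (cons_mem_boundary.2 (Or.inl rfl)), h0]
    · apply iota_injective
      rw [hlb _ _ (cons_mem_boundary.2 (Or.inr (Or.inl rfl))), h1]
      exact (map_one iota).symm
    · apply iota_injective
      rw [hlb _ _ (cons_mem_boundary.2 (Or.inr (Or.inr hy))), hb _ _ hy, map_one]
  · intro a
    obtain ⟨f, rfl⟩ := exists_rep a
    obtain ⟨l, hl, K, hK, hK0, hK1, -, hA⟩ := htpyIn_iota (by norm_num) (loop_continuous f)
      (fun u hu => by rw [loop_bdry f hu]; exact one_mem _)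
    simp only at hK1
    refine ⟨cls (mkLoop l hl fun u hu => ?_), ?_⟩
    · apply iota_injective
      rw [← hK1, hA 1 u hu, loop_bdry f hu, map_one]
    · rw [piHom_cls, cls_eq_cls]
      refine GenLoop.Homotopic.symm (homotopic_of _ _ K hK hK0 (fun u => ?_) fun t u hu => ?_)
      · rw [hK1, mapLoop_apply, mkLoop_apply]
      · rw [hA t u hu, loop_bdry f hu]

lemma pi3_SU4 : Nonempty (HomotopyGroup (Fin 3) (SU 4) 1 ≃* Multiplicative ℤ) := by
  obtain ⟨e⟩ := pi3_sp1
  exact ⟨(piEquiv iota continuous_iota (map_one iota) piHom_iota_bijective).symm.trans e⟩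

end Iota
end Pi3

namespace Pi3
open scoped unitInterval Topology.Homotopy Quaternion
open Set

section Rotations

/-- The matrix of left multiplication by a quaternion. -/
def lmat (a : ℍ[ℝ]) : Matrix (Fin 4) (Fin 4) ℝ :=
  !![a.re, -a.imI, -a.imJ, -a.imK; a.imI, a.re, -a.imK, a.imJ;
    a.imJ, a.imK, a.re, -a.imI; a.imK, -a.imJ, a.imI, a.re]

/-- The matrix of right multiplication by the conjugate of a quaternion. -/
def rmat (b : ℍ[ℝ]) : Matrix (Fin 4) (Fin 4) ℝ :=
  !![b.re, b.imI, b.imJ, b.imK; -b.imI, b.re, -b.imK, b.imJ;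
    -b.imJ, b.imK, b.re, -b.imI; -b.imK, -b.imJ, b.imI, b.re]

/-- The coordinate vector of a quaternion. -/
def qvec (q : ℍ[ℝ]) : Fin 4 → ℝ := ![q.re, q.imI, q.imJ, q.imK]

/-- The quaternion with a given coordinate vector. -/
def vquat (v : Fin 4 → ℝ) : ℍ[ℝ] := quat (v 0) (v 1) (v 2) (v 3)

lemma vquat_qvec (q : ℍ[ℝ]) : vquat (qvec q) = q := by
  ext <;> rfl

lemma qvec_vquat (v : Fin 4 → ℝ) : qvec (vquat v) = v := by
  funext i
  fin_cases i <;> rfl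

lemma lmat_mulVec (a q : ℍ[ℝ]) : lmat a *ᵥ qvec q = qvec (a * q) := by
  funext i
  fin_cases i <;> simp [lmat, qvec, mulVec, dotProduct, Fin.sum_univ_four] <;> ring

lemma rmat_mulVec (b q : ℍ[ℝ]) : rmat b *ᵥ qvec q = qvec (q * star b) := by
  funext i
  fin_cases i <;> simp [rmat, qvec, mulVec, dotProduct, Fin.sum_univ_four] <;> ring

lemma matrix_ext_qvec {M N : Matrix (Fin 4) (Fin 4) ℝ} (h : ∀ q, M *ᵥ qvec q = N *ᵥ qvec q) :
    M = N := by
  refine Matrix.ext_of_mulVec_single fun i => ?_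
  have := h (vquat (Pi.single i 1))
  rwa [qvec_vquat] at this

lemma lmat_mul (a b : ℍ[ℝ]) : lmat (a * b) = lmat a * lmat b :=
  matrix_ext_qvec fun q => by
    rw [← mulVec_mulVec, lmat_mulVec, lmat_mulVec, lmat_mulVec, mul_assoc]

lemma rmat_mul (a b : ℍ[ℝ]) : rmat (a * b) = rmat a * rmat b :=
  matrix_ext_qvec fun q => by
    rw [← mulVec_mulVec, rmat_mulVec, rmat_mulVec, rmat_mulVec, star_mul, mul_assoc]

lemma lmat_mul_rmat_comm (a b : ℍ[ℝ]) : lmat a * rmat b = rmat b * lmat a :=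
  matrix_ext_qvec fun q => by
    rw [← mulVec_mulVec, ← mulVec_mulVec, rmat_mulVec, lmat_mulVec, lmat_mulVec, rmat_mulVec,
      mul_assoc]

lemma lmat_one : lmat 1 = 1 :=
  matrix_ext_qvec fun q => by rw [lmat_mulVec, one_mul, one_mulVec]

lemma rmat_one : rmat 1 = 1 :=
  matrix_ext_qvec fun q => by rw [rmat_mulVec, star_one, mul_one, one_mulVec]

lemma lmat_star (a : ℍ[ℝ]) : lmat (star a) = (lmat a)ᵀ := by
  ext i j
  fin_cases i <;> fin_cases j <;> simp [lmat]

lemma rmat_star (a : ℍ[ℝ]) : rmat (star a) = (rmat a)ᵀ := by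
  ext i j
  fin_cases i <;> fin_cases j <;> simp [rmat]

lemma det_lmat_eq (a : ℍ[ℝ]) : (lmat a).det = Quaternion.normSq a ^ 2 := by
  rw [Quaternion.normSq_def']
  simp [lmat, det_succ_row_zero, Fin.sum_univ_succ, Fin.succAbove]
  ring

lemma det_lmat (a : Sp1) : (lmat a).det = 1 := by
  rw [det_lmat_eq, sp1_normSq, one_pow]

lemma det_rmat_eq (a : ℍ[ℝ]) : (rmat a).det = Quaternion.normSq a ^ 2 := by
  rw [Quaternion.normSq_def']
  simp [rmat, det_succ_row_zero, Fin.sum_univ_succ, Fin.succAbove]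
  ring

lemma det_rmat (a : Sp1) : (rmat a).det = 1 := by
  rw [det_rmat_eq, sp1_normSq, one_pow]

lemma sp1_mul_star (a : Sp1) : (a : ℍ[ℝ]) * star (a : ℍ[ℝ]) = 1 := by
  rw [Quaternion.self_mul_star, sp1_normSq, Quaternion.coe_one]

lemma sp1_star_mul (a : Sp1) : star (a : ℍ[ℝ]) * a = 1 := by
  rw [Quaternion.star_mul_self, sp1_normSq, Quaternion.coe_one]

lemma lmat_orthogonal (a : Sp1) : lmat a * (lmat a)ᵀ = 1 := by
  rw [← lmat_star, ← lmat_mul, sp1_mul_star, lmat_one]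

lemma rmat_orthogonal (a : Sp1) : rmat a * (rmat a)ᵀ = 1 := by
  rw [← rmat_star, ← rmat_mul, sp1_mul_star, rmat_one]

/-- The rotation matrices, as real matrices. -/
def rotMat : Set (Matrix (Fin 4) (Fin 4) ℝ) := {M | M * Mᵀ = 1 ∧ M.det = 1}

lemma mul_mem_rotMat {M N : Matrix (Fin 4) (Fin 4) ℝ} (hM : M ∈ rotMat) (hN : N ∈ rotMat) :
    M * N ∈ rotMat := by
  refine ⟨?_, by rw [det_mul, hM.2, hN.2, one_mul]⟩
  rw [transpose_mul, mul_assoc, ← mul_assoc N, hN.1, one_mul, hM.1]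

lemma lmat_mem (a : Sp1) : lmat a ∈ rotMat := ⟨lmat_orthogonal a, det_lmat a⟩

lemma rmat_mem (a : Sp1) : rmat a ∈ rotMat := ⟨rmat_orthogonal a, det_rmat a⟩

lemma transpose_mem_rotMat {M : Matrix (Fin 4) (Fin 4) ℝ} (hM : M ∈ rotMat) : Mᵀ ∈ rotMat := by
  refine ⟨?_, by rw [det_transpose, hM.2]⟩
  rw [transpose_transpose]
  exact mul_eq_one_comm.1 hM.1

/-- The quaternion given by a column of a matrix. -/
def colQuat (M : Matrix (Fin 4) (Fin 4) ℝ) (j : Fin 4) : ℍ[ℝ] :=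
  quat (M 0 j) (M 1 j) (M 2 j) (M 3 j)

/-- The averaged intertwiner of a rotation with the identity. -/
def intertwiner (M : Matrix (Fin 4) (Fin 4) ℝ) (x : ℍ[ℝ]) : ℍ[ℝ] :=
  colQuat M 0 * x - colQuat M 1 * x * quat 0 1 0 0 - colQuat M 2 * x * quat 0 0 1 0 -
    colQuat M 3 * x * quat 0 0 0 1

lemma mulVec_qvec (M : Matrix (Fin 4) (Fin 4) ℝ) (q : ℍ[ℝ]) : M *ᵥ qvec q =
    qvec (q.re • colQuat M 0 + q.imI • colQuat M 1 + q.imJ • colQuat M 2 + q.imK • colQuat M 3) := by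
  funext i
  fin_cases i <;> simp [qvec, colQuat, mulVec, dotProduct, Fin.sum_univ_four] <;> ring

lemma col_orthonormal {M : Matrix (Fin 4) (Fin 4) ℝ} (hM : M ∈ rotMat) (i j : Fin 4) :
    M 0 i * M 0 j + M 1 i * M 1 j + M 2 i * M 2 j + M 3 i * M 3 j = if i = j then 1 else 0 := by
  have h := congrFun (congrFun (transpose_mem_rotMat hM).1 i) j
  rw [transpose_transpose, mul_apply, Fin.sum_univ_four, one_apply] at h
  exact h

lemma sum_three_sq_eq_zero {x y z : ℝ} (h : x ^ 2 + y ^ 2 + z ^ 2 = 0) :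
    x = 0 ∧ y = 0 ∧ z = 0 := by
  refine ⟨?_, ?_, ?_⟩ <;> nlinarith [sq_nonneg x, sq_nonneg y, sq_nonneg z]

/-- A rotation fixing `1` is multiplicative on the imaginary units. -/
lemma colQuat_mul {M : Matrix (Fin 4) (Fin 4) ℝ} (hM : M ∈ rotMat) (h0 : colQuat M 0 = 1) :
    colQuat M 1 * colQuat M 1 = -1 ∧ colQuat M 2 * colQuat M 2 = -1 ∧
      colQuat M 2 * colQuat M 1 = -(colQuat M 1 * colQuat M 2) ∧
      colQuat M 3 = colQuat M 1 * colQuat M 2 := by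
  have a0 : M 0 0 = 1 := congrArg QuaternionAlgebra.re h0
  have a1 : M 1 0 = 0 := congrArg QuaternionAlgebra.imI h0
  have a2 : M 2 0 = 0 := congrArg QuaternionAlgebra.imJ h0
  have a3 : M 3 0 = 0 := congrArg QuaternionAlgebra.imK h0
  have b : ∀ j, j ≠ 0 → M 0 j = 0 := fun j hj => by
    have := col_orthonormal hM 0 j
    rw [a0, a1, a2, a3, if_neg hj.symm] at this
    linarith
  have b1 := b 1 (by decide)
  have b2 := b 2 (by decide)
  have b3 := b 3 (by decide)
  have o11 := col_orthonormal hM 1 1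
  have o22 := col_orthonormal hM 2 2
  have o33 := col_orthonormal hM 3 3
  have o12 := col_orthonormal hM 1 2
  have hd := hM.2
  simp [det_succ_row_zero, Fin.sum_univ_succ, Fin.succAbove, a0, b1, b2, b3] at hd
  simp only [b1, b2, b3, if_true, mul_zero, zero_add] at o11 o22 o33
  rw [if_neg (by decide)] at o12
  simp only [b1, b2, mul_zero, zero_add] at o12
  refine ⟨?_, ?_, ?_, ?_⟩
  · ext <;> simp [colQuat, b1] <;> linarith
  · ext <;> simp [colQuat, b2] <;> linarith
  · ext <;> simp [colQuat, b1, b2] <;> linarith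
  · have hsq : (M 1 3 - (M 2 1 * M 3 2 - M 3 1 * M 2 2)) ^ 2 +
        (M 2 3 - (M 3 1 * M 1 2 - M 1 1 * M 3 2)) ^ 2 +
        (M 3 3 - (M 1 1 * M 2 2 - M 2 1 * M 1 2)) ^ 2 = 0 := by
      linear_combination o33 - 2 * hd + o11 * (M 1 2 * M 1 2 + M 2 2 * M 2 2 + M 3 2 * M 3 2) + o22
        - o12 * (M 1 1 * M 1 2 + M 2 1 * M 2 2 + M 3 1 * M 3 2)
    obtain ⟨h1, h2, h3⟩ := sum_three_sq_eq_zero hsq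
    ext <;> simp [colQuat, b1, b2, b3] <;> linarith

lemma quat_units (y : ℍ[ℝ]) :
    y * quat 0 1 0 0 * quat 0 1 0 0 = -y ∧ y * quat 0 0 1 0 * quat 0 1 0 0 = -(y * quat 0 0 0 1) ∧
    y * quat 0 0 0 1 * quat 0 1 0 0 = y * quat 0 0 1 0 ∧
    y * quat 0 1 0 0 * quat 0 0 1 0 = y * quat 0 0 0 1 ∧ y * quat 0 0 1 0 * quat 0 0 1 0 = -y ∧
    y * quat 0 0 0 1 * quat 0 0 1 0 = -(y * quat 0 1 0 0) := by
  refine ⟨?_, ?_, ?_, ?_, ?_, ?_⟩ <;> ext <;> simp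

lemma colQuat_mul_intertwiner {M : Matrix (Fin 4) (Fin 4) ℝ} (hM : M ∈ rotMat)
    (h0 : colQuat M 0 = 1) (x : ℍ[ℝ]) :
    colQuat M 1 * intertwiner M x = intertwiner M x * quat 0 1 0 0 ∧
      colQuat M 2 * intertwiner M x = intertwiner M x * quat 0 0 1 0 := by
  obtain ⟨h11, h22, h21, h3⟩ := colQuat_mul hM h0
  rw [intertwiner, h0, h3]
  generalize colQuat M 1 = u at *
  generalize colQuat M 2 = v at *
  have e1 : u * v * u = v := by rw [mul_assoc, h21, mul_neg, ← mul_assoc, h11, neg_mul, one_mul, neg_neg]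
  have e2 : u * v * v = -u := by rw [mul_assoc, h22, mul_neg, mul_one]
  constructor
  · simp only [mul_sub, sub_mul, ← mul_assoc, h11, neg_mul, one_mul,
      fun y => (quat_units y).1, fun y => (quat_units y).2.1, fun y => (quat_units y).2.2.1]
    abel
  · simp only [mul_sub, sub_mul, ← mul_assoc, h22, h21, e2, neg_mul, one_mul,
      fun y => (quat_units y).2.2.2.1, fun y => (quat_units y).2.2.2.2.1,
      fun y => (quat_units y).2.2.2.2.2, neg_neg]
    abel

lemma quat_decomp (p : ℍ[ℝ]) : p = p.re • 1 + p.imI • quat 0 1 0 0 + p.imJ • quat 0 0 1 0 +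
    p.imK • (quat 0 1 0 0 * quat 0 0 1 0) := by
  ext <;> simp

lemma exists_intertwiner_ne_zero {M : Matrix (Fin 4) (Fin 4) ℝ} (h0 : colQuat M 0 = 1) :
    ∃ x, intertwiner M x ≠ 0 := by
  by_contra! h
  have h1 : intertwiner M 1 - intertwiner M (quat 0 1 0 0) * quat 0 1 0 0 -
      intertwiner M (quat 0 0 1 0) * quat 0 0 1 0 -
      intertwiner M (quat 0 0 0 1) * quat 0 0 0 1 = quat 4 0 0 0 := by
    simp only [intertwiner, h0]
    ext <;> simp <;> ring
  rw [h, h, h, h] at h1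
  have h2 := congrArg QuaternionAlgebra.re h1
  simp at h2

/-- A rotation fixing `1` is a conjugation. -/
lemma exists_conj_of_intertwiner {M : Matrix (Fin 4) (Fin 4) ℝ} (hM : M ∈ rotMat)
    (h0 : colQuat M 0 = 1) {x : ℍ[ℝ]} (hx : intertwiner M x ≠ 0) :
    ∃ c : Sp1, (c : ℍ[ℝ]) = ‖intertwiner M x‖⁻¹ • intertwiner M x ∧ M = lmat c * rmat c := by
  obtain ⟨h11, h22, h21, h3⟩ := colQuat_mul hM h0
  obtain ⟨t1, t2⟩ := colQuat_mul_intertwiner hM h0 x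
  have hc : ‖intertwiner M x‖⁻¹ • intertwiner M x ∈ Metric.sphere (0 : ℍ[ℝ]) 1 := by
    rw [mem_sphere_zero_iff_norm, norm_smul, norm_inv, norm_norm,
      inv_mul_cancel₀ (norm_ne_zero_iff.2 hx)]
  refine ⟨⟨_, hc⟩, rfl, matrix_ext_qvec fun p => ?_⟩
  set c : Sp1 := ⟨_, hc⟩ with hcdef
  have c1 : colQuat M 1 * c = c * quat 0 1 0 0 := by
    rw [hcdef]; dsimp only; rw [mul_smul_comm, t1, smul_mul_assoc]
  have c2 : colQuat M 2 * c = c * quat 0 0 1 0 := by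
    rw [hcdef]; dsimp only; rw [mul_smul_comm, t2, smul_mul_assoc]
  have key : (p.re • colQuat M 0 + p.imI • colQuat M 1 + p.imJ • colQuat M 2 +
      p.imK • colQuat M 3) * c = c * p := by
    conv_rhs => rw [quat_decomp p]
    rw [h3, h0]
    simp only [add_mul, mul_add, smul_mul_assoc, mul_smul_comm, one_mul, mul_one, c1]
    rw [c2, mul_assoc (colQuat M 1), c2, ← mul_assoc, c1, mul_assoc]
  rw [mulVec_qvec, ← mulVec_mulVec, rmat_mulVec, lmat_mulVec, ← mul_assoc, ← key, mul_assoc,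
    sp1_mul_star, mul_one]

/-- The action of pairs of unit quaternions on matrices. -/
def rotAct (g : Sp1 × Sp1) (M : Matrix (Fin 4) (Fin 4) ℝ) : Matrix (Fin 4) (Fin 4) ℝ :=
  lmat g.1 * rmat g.2 * M

/-- The part of a rotation fixing `1`. -/
def imPart (R : Matrix (Fin 4) (Fin 4) ℝ) : Matrix (Fin 4) (Fin 4) ℝ :=
  lmat (star (colQuat R 0)) * R

lemma colQuat_eq (M : Matrix (Fin 4) (Fin 4) ℝ) : qvec (colQuat M 0) = M *ᵥ qvec 1 := by
  rw [mulVec_qvec]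
  simp

lemma colQuat_mem {R : Matrix (Fin 4) (Fin 4) ℝ} (hR : R ∈ rotMat) :
    colQuat R 0 ∈ Metric.sphere (0 : ℍ[ℝ]) 1 := by
  have h := col_orthonormal hR 0 0
  rw [if_pos rfl] at h
  rw [mem_sphere_zero_iff_norm, norm_eq_one_iff_quat]
  simp only [colQuat, quat]
  linarith

lemma imPart_colQuat {R : Matrix (Fin 4) (Fin 4) ℝ} (hR : R ∈ rotMat) :
    colQuat (imPart R) 0 = 1 := by
  rw [← vquat_qvec (colQuat (imPart R) 0), colQuat_eq, imPart, ← mulVec_mulVec, ← colQuat_eq,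
    lmat_mulVec, vquat_qvec]
  exact sp1_star_mul ⟨_, colQuat_mem hR⟩

lemma exists_rotAct_of_intertwiner {R : Matrix (Fin 4) (Fin 4) ℝ} (hR : R ∈ rotMat) {x : ℍ[ℝ]}
    (hx : intertwiner (imPart R) x ≠ 0) :
    ∃ g : Sp1 × Sp1, ((g.1 : ℍ[ℝ]), (g.2 : ℍ[ℝ])) =
      (colQuat R 0 * (‖intertwiner (imPart R) x‖⁻¹ • intertwiner (imPart R) x),
        ‖intertwiner (imPart R) x‖⁻¹ • intertwiner (imPart R) x) ∧ rotAct g 1 = R := by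
  let a : Sp1 := ⟨colQuat R 0, colQuat_mem hR⟩
  have hM : imPart R ∈ rotMat := by
    have := mul_mem_rotMat (lmat_mem a⁻¹) hR
    rwa [coe_inv_sp1] at this
  obtain ⟨c, hc, h⟩ := exists_conj_of_intertwiner hM (imPart_colQuat hR) hx
  refine ⟨(a * c, c), ?_, ?_⟩
  · rw [← hc]; rfl
  · rw [rotAct, mul_one, Metric.unitSphere.coe_mul, lmat_mul, mul_assoc, ← h, imPart, ← mul_assoc,
      ← lmat_mul]
    change lmat (a * star (a : ℍ[ℝ])) * R = R
    rw [sp1_mul_star, lmat_one, one_mul]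

end Rotations
end Pi3

namespace Pi3
open scoped unitInterval Topology.Homotopy Quaternion
open Set

section Spin

lemma continuous_lmat : Continuous lmat := by
  refine continuous_matrix fun i j => ?_
  fin_cases i <;> fin_cases j <;> simp only [lmat] <;>
    first
    | exact Quaternion.continuous_re
    | exact Quaternion.continuous_imI
    | exact Quaternion.continuous_imJ
    | exact Quaternion.continuous_imK
    | exact Quaternion.continuous_imI.neg
    | exact Quaternion.continuous_imJ.neg
    | exact Quaternion.continuous_imK.neg

lemma continuous_rmat : Continuous rmat := by
  refine continuous_matrix fun i j => ?_
  fin_cases i <;> fin_cases j <;> simp only [rmat] <;>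
    first
    | exact Quaternion.continuous_re
    | exact Quaternion.continuous_imI
    | exact Quaternion.continuous_imJ
    | exact Quaternion.continuous_imK
    | exact Quaternion.continuous_imI.neg
    | exact Quaternion.continuous_imJ.neg
    | exact Quaternion.continuous_imK.neg

lemma continuous_colQuat (j : Fin 4) :
    Continuous fun M : Matrix (Fin 4) (Fin 4) ℝ => colQuat M j :=
  continuous_quat (continuous_id.matrix_elem _ _) (continuous_id.matrix_elem _ _)
    (continuous_id.matrix_elem _ _) (continuous_id.matrix_elem _ _)

lemma continuous_intertwiner (x : ℍ[ℝ]) :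
    Continuous fun M : Matrix (Fin 4) (Fin 4) ℝ => intertwiner M x := by
  unfold intertwiner
  exact ((((continuous_colQuat 0).mul continuous_const).sub
    (((continuous_colQuat 1).mul continuous_const).mul continuous_const)).sub
    (((continuous_colQuat 2).mul continuous_const).mul continuous_const)).sub
    (((continuous_colQuat 3).mul continuous_const).mul continuous_const)

lemma continuous_imPart : Continuous imPart :=
  (continuous_lmat.comp (continuous_colQuat 0).star).matrix_mul continuous_id

lemma rotAct_mem (g : Sp1 × Sp1) : rotAct g 1 ∈ rotMat := by
  rw [rotAct, mul_one]
  exact mul_mem_rotMat (lmat_mem _) (rmat_mem _)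

lemma range_rotAct : (range fun g => rotAct g 1) = rotMat := by
  ext R
  refine ⟨?_, fun hR => ?_⟩
  · rintro ⟨g, rfl⟩
    exact rotAct_mem g
  · obtain ⟨x, hx⟩ := exists_intertwiner_ne_zero (imPart_colQuat hR)
    obtain ⟨g, -, hg⟩ := exists_rotAct_of_intertwiner hR hx
    exact ⟨g, hg⟩

lemma colQuat_one : colQuat 1 0 = 1 := by
  ext <;> simp [colQuat]

lemma intertwiner_one : intertwiner (imPart 1) 1 = quat 4 0 0 0 := by
  rw [imPart, colQuat_one, star_one, lmat_one, one_mul]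
  ext <;> simp [intertwiner, colQuat]; norm_num

lemma norm_quat_four : ‖quat 4 0 0 0‖ = 4 := by
  have h : quat 4 0 0 0 = (4 : ℝ) • (1 : ℍ[ℝ]) := by ext <;> simp
  rw [h, norm_smul, norm_one]
  norm_num

lemma hasLocalSection_rotAct : HasLocalSection rotAct 1 where
  cont := by
    unfold rotAct
    exact ((continuous_lmat.comp (continuous_subtype_val.comp
      (continuous_fst.comp continuous_fst))).matrix_mul (continuous_rmat.comp
      (continuous_subtype_val.comp (continuous_snd.comp continuous_fst)))).matrix_mul
      continuous_snd
  one M := by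
    change lmat 1 * rmat 1 * M = M
    rw [lmat_one, rmat_one, one_mul, one_mul]
  mul g h M := by
    change lmat (g.1 * h.1 : ℍ[ℝ]) * rmat (g.2 * h.2 : ℍ[ℝ]) * M = _
    rw [lmat_mul, rmat_mul]
    simp only [rotAct]
    rw [mul_assoc (lmat _), ← mul_assoc (lmat h.1), lmat_mul_rmat_comm h.1 g.2]
    simp only [mul_assoc]
  sec := by
    have hT := (continuous_intertwiner 1).comp continuous_imPart
    refine exists_section_of_isEmbedding
      (Topology.IsEmbedding.subtypeVal.prodMap Topology.IsEmbedding.subtypeVal)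
      (fun R => (colQuat R 0 * (‖intertwiner (imPart R) 1‖⁻¹ • intertwiner (imPart R) 1),
        ‖intertwiner (imPart R) 1‖⁻¹ • intertwiner (imPart R) 1))
      (U := {R | intertwiner (imPart R) 1 ≠ 0}) ?_ ?_ ?_ ?_
    · refine (isOpen_ne.preimage hT).mem_nhds ?_
      change intertwiner (imPart 1) 1 ≠ 0
      rw [intertwiner_one, ← norm_ne_zero_iff, norm_quat_four]
      norm_num
    · have h1 : ContinuousOn (fun R => ‖intertwiner (imPart R) 1‖⁻¹ • intertwiner (imPart R) 1)
          ({R | intertwiner (imPart R) 1 ≠ 0} ∩ range fun g => rotAct g 1) :=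
        ContinuousOn.smul (ContinuousOn.inv₀ hT.norm.continuousOn
          fun v hv => norm_ne_zero_iff.2 hv.1) hT.continuousOn
      exact ((continuous_colQuat 0).continuousOn.mul h1).prodMk h1
    · have h1 : (4 : ℝ)⁻¹ • quat 4 0 0 0 = 1 := by ext <;> simp
      simp only [intertwiner_one, norm_quat_four, h1, colQuat_one]
      rw [one_mul]
      rfl
    · intro R hR hR'
      rw [range_rotAct] at hR'
      exact exists_rotAct_of_intertwiner hR' hR

lemma eq_of_rotAct {g : Sp1 × Sp1} (h : rotAct g 1 = 1) :
    g.2 = g.1 ∧ (g.1 : ℍ[ℝ]) = quat (g.1 : ℍ[ℝ]).re 0 0 0 ∧ (g.1 : ℍ[ℝ]).re ^ 2 = 1 := by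
  obtain ⟨a, b⟩ := g
  rw [rotAct, mul_one] at h
  have hq : ∀ q : ℍ[ℝ], (a : ℍ[ℝ]) * (q * star (b : ℍ[ℝ])) = q := fun q => by
    have := congrArg (· *ᵥ qvec q) h
    simp only [← mulVec_mulVec, rmat_mulVec, lmat_mulVec, one_mulVec] at this
    rw [← vquat_qvec ((a : ℍ[ℝ]) * (q * star (b : ℍ[ℝ]))), this, vquat_qvec]
  have hab : b = a := by
    have h1 := hq b
    rw [sp1_mul_star, mul_one] at h1
    exact (Subtype.ext h1).symm
  subst hab
  have hc : ∀ q : ℍ[ℝ], (b : ℍ[ℝ]) * q = q * b := fun q => by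
    have h1 := congrArg (· * (b : ℍ[ℝ])) (hq q)
    rw [mul_assoc, mul_assoc, sp1_star_mul, mul_one] at h1
    exact h1
  have h1 := hc (quat 0 1 0 0)
  have h2 := hc (quat 0 0 1 0)
  have h1J := congrArg QuaternionAlgebra.imJ h1
  have h1K := congrArg QuaternionAlgebra.imK h1
  have h2K := congrArg QuaternionAlgebra.imK h2
  have hn := sp1_normSq b
  rw [Quaternion.normSq_def'] at hn
  simp at h1J h1K h2K
  have eI : (b : ℍ[ℝ]).imI = 0 := by linarith
  have eJ : (b : ℍ[ℝ]).imJ = 0 := by linarith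
  have eK : (b : ℍ[ℝ]).imK = 0 := by linarith
  refine ⟨rfl, ?_, ?_⟩
  · ext <;> simp [eI, eJ, eK]
  · rw [eI, eJ, eK] at hn
    linarith

/-- Loops of rotations lift to pairs of unit quaternions. -/
lemma exists_spin_loop {k : ℕ} (f : Ω^ (Fin (k + 2)) (Matrix (Fin 4) (Fin 4) ℝ) 1)
    (hf : ∀ u, f u ∈ rotMat) :
    ∃ F : Ω^ (Fin (k + 2)) (Sp1 × Sp1) 1, ∀ u, rotAct (F u) 1 = f u := by
  obtain ⟨F, hF, hact, hF1⟩ := hasLocalSection_rotAct.lift_loop f fun u => by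
    have := hf u
    rwa [← range_rotAct] at this
  have hst : ∀ y : Fin (k + 1) → I, rotAct (F (Fin.cons 1 y)) 1 = 1 := fun y => by
    rw [hact, loop_bdry f (cons_mem_boundary.2 (Or.inr (Or.inl rfl)))]
  have h0 : F (Fin.cons 1 fun _ => 0) = 1 :=
    hF1 _ (cons_mem_openBox.2 (Or.inr ⟨0, Or.inl rfl⟩))
  have hre : Continuous fun y : Fin (k + 1) → I => ((F (Fin.cons 1 y)).1 : ℍ[ℝ]).re :=
    Quaternion.continuous_re.comp (continuous_subtype_val.comp (continuous_fst.comp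
      (hF.comp (continuous_cons.comp (continuous_const.prodMk continuous_id)))))
  have hone : ∀ y : Fin (k + 1) → I, ((F (Fin.cons 1 y)).1 : ℍ[ℝ]).re = 1 := by
    rcases isPreconnected_univ.eq_or_eq_neg_of_sq_eq hre.continuousOn
      (continuousOn_const (c := (1 : ℝ))) (fun y _ => by
        have := (eq_of_rotAct (hst y)).2.2
        simpa using this) (fun _ => one_ne_zero) with h | h
    · exact fun y => h trivial
    · have := h (mem_univ fun _ => 0)
      dsimp only at this
      rw [h0] at this
      change (1 : ℝ) = -1 at this
      norm_num at this
  refine ⟨mkLoop F hF fun u hu => ?_, hact⟩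
  rcases mem_boundary_iff_openBox.1 hu with h | h
  · have hu' : Fin.cons 1 (Fin.tail u) = u := by rw [← h, Fin.cons_self_tail]
    obtain ⟨e2, e1, -⟩ := eq_of_rotAct (hst (Fin.tail u))
    rw [hone] at e1
    rw [hu'] at e1 e2
    have e3 : (F u).1 = 1 := Subtype.ext (by rw [e1]; ext <;> rfl)
    exact Prod.ext e3 (e2.trans e3)
  · exact hF1 u h

end Spin
end Pi3

namespace Pi3
open scoped unitInterval Topology.Homotopy Quaternion
open Set

section SquareRoot

lemma exists_continuousOn_sqrt (A : Type*) [NormedRing A] [NormedAlgebra ℝ A] [CompleteSpace A] :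
    ∃ s : A → A, ∃ U ∈ 𝓝 (1 : A), ∃ V ∈ 𝓝 (1 : A), ContinuousOn s U ∧ s 1 = 1 ∧
      (∀ z ∈ U, s z * s z = z) ∧ ∀ x ∈ V, ∀ y ∈ V, x * x = y * y → x = y := by
  let e : A ≃L[ℝ] A := ContinuousLinearEquiv.smulLeft (Units.mk0 (2 : ℝ) two_ne_zero)
  have hd : HasStrictFDerivAt (fun x : A => x * x) (e : A →L[ℝ] A) 1 := by
    have h := (hasStrictFDerivAt_id (𝕜 := ℝ) (1 : A)).mul' (hasStrictFDerivAt_id (1 : A))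
    refine h.congr_fderiv ?_
    ext x
    simp [e, two_smul]
  let p := hd.toOpenPartialHomeomorph _
  have h1 : (1 : A) ∈ p.source := hd.mem_toOpenPartialHomeomorph_source
  have h1' : (1 : A) ∈ p.target := by
    have := hd.image_mem_toOpenPartialHomeomorph_target
    rwa [mul_one] at this
  refine ⟨p.symm, p.target, p.open_target.mem_nhds h1', p.source, p.open_source.mem_nhds h1,
    p.continuousOn_symm, ?_, fun z hz => p.right_inv hz, fun x hx y hy h => p.injOn hx hy h⟩
  have := p.left_inv h1
  change p.symm (1 * 1) = 1 at this
  rwa [mul_one] at this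

lemma exists_continuousOn_matrix_sqrt (n : ℕ) :
    ∃ s : Matrix (Fin n) (Fin n) ℂ → Matrix (Fin n) (Fin n) ℂ,
      ∃ U ∈ 𝓝 (1 : Matrix (Fin n) (Fin n) ℂ), ∃ V ∈ 𝓝 (1 : Matrix (Fin n) (Fin n) ℂ),
      ContinuousOn s U ∧ s 1 = 1 ∧
      (∀ z ∈ U, s z * s z = z) ∧ ∀ x ∈ V, ∀ y ∈ V, x * x = y * y → x = y :=
  letI := Matrix.linftyOpNormedRing (n := Fin n) (α := ℂ)
  letI := Matrix.linftyOpNormedAlgebra (n := Fin n) (R := ℝ) (α := ℂ)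
  haveI : CompleteSpace (Matrix (Fin n) (Fin n) ℂ) := FiniteDimensional.complete ℝ _
  exists_continuousOn_sqrt (Matrix (Fin n) (Fin n) ℂ)

end SquareRoot

section SymmetricSpace

variable {n : ℕ}

/-- The embedding of the symmetric space into matrices, on the level of the group. -/
def symMat (g : SU n) : Matrix (Fin n) (Fin n) ℂ := mat g * (mat g)ᵀ

lemma continuous_symMat : Continuous (symMat : SU n → _) :=
  continuous_mat.matrix_mul continuous_mat.matrix_transpose

lemma symMat_mul_conjTranspose (g : SU n) : symMat g * (symMat g)ᴴ = 1 := by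
  have h := congrArg Matrix.transpose (conjTranspose_mul_mat g)
  rw [transpose_mul, transpose_one] at h
  rw [symMat, conjTranspose_mul, mul_assoc, ← mul_assoc (mat g)ᵀ]
  change mat g * ((mat g)ᵀ * ((mat g)ᴴ)ᵀ * (mat g)ᴴ) = 1
  rw [h, one_mul, mat_mul_conjTranspose]

lemma symMat_transpose (g : SU n) : (symMat g)ᵀ = symMat g := by
  rw [symMat, transpose_mul, transpose_transpose]

lemma det_symMat (g : SU n) : (symMat g).det = 1 := by
  rw [symMat, det_mul, det_transpose, det_mat, one_mul]

lemma mem_SOinSU_iff (g : SU n) : g ∈ SOinSU n ↔ symMat g = 1 := by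
  have key : g ∈ SOinSU n ↔ (mat g)ᵀ = (mat g)ᴴ := by
    constructor
    · rintro ⟨B, hB⟩
      change mat g = _ at hB
      rw [hB]
      ext i j
      simp
    · intro h
      refine ⟨(mat g).map Complex.re, ?_⟩
      change mat g = _
      ext i j
      have := congrFun (congrFun h j) i
      simp only [transpose_apply, conjTranspose_apply] at this
      exact (Complex.conj_eq_iff_re.1 this.symm).symm
  rw [key]
  constructor
  · intro h
    rw [symMat, h, mat_mul_conjTranspose]
  · intro h
    have h2 := congrArg ((mat g)ᴴ * ·) h
    dsimp only [symMat] at h2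
    rwa [← mul_assoc, conjTranspose_mul_mat, one_mul, mul_one] at h2

lemma symMat_eq_iff (g h : SU n) : symMat g = symMat h ↔ g⁻¹ * h ∈ SOinSU n := by
  have e : symMat (g⁻¹ * h) = (mat g)ᴴ * symMat h * ((mat g)ᴴ)ᵀ := by
    simp only [symMat, mat_mul, mat_inv, transpose_mul, mul_assoc]
  have h1 := congrArg Matrix.transpose (conjTranspose_mul_mat g)
  have h2 := congrArg Matrix.transpose (mat_mul_conjTranspose g)
  rw [transpose_mul, transpose_one] at h1 h2
  rw [mem_SOinSU_iff, e]
  constructor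
  · intro hg
    rw [← hg, symMat, ← mul_assoc, conjTranspose_mul_mat, one_mul, h1]
  · intro hg
    have h3 := congrArg (fun M => mat g * M * (mat g)ᵀ) hg
    simp only [mul_assoc, h2, mul_one] at h3
    rw [← mul_assoc, mat_mul_conjTranspose, one_mul] at h3
    exact h3.symm

/-- The map from the symmetric space to matrices. -/
def cosetMat : SU n ⧸ SOinSU n → Matrix (Fin n) (Fin n) ℂ :=
  Quotient.lift symMat fun g h hgh => (symMat_eq_iff g h).2 (QuotientGroup.leftRel_apply.1 hgh)

lemma continuous_cosetMat : Continuous (cosetMat : SU n ⧸ SOinSU n → _) :=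
  continuous_symMat.quotient_lift _

lemma cosetMat_mk (g : SU n) : cosetMat (QuotientGroup.mk g : SU n ⧸ SOinSU n) = symMat g := rfl

lemma cosetMat_injective : Function.Injective (cosetMat : SU n ⧸ SOinSU n → _) := by
  intro a b h
  induction a using QuotientGroup.induction_on
  induction b using QuotientGroup.induction_on
  exact QuotientGroup.eq.2 ((symMat_eq_iff _ _).1 h)

lemma exists_sym_section (n : ℕ) : ∃ s : Matrix (Fin n) (Fin n) ℂ → Matrix (Fin n) (Fin n) ℂ,
    ∃ U ∈ 𝓝 (1 : Matrix (Fin n) (Fin n) ℂ), ContinuousOn s U ∧ s 1 = 1 ∧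
      ∀ Z ∈ U, Z * Zᴴ = 1 → Zᵀ = Z → Z.det = 1 → ∃ g : SU n, mat g = s Z ∧ symMat g = Z := by
  obtain ⟨s, U, hU, V, hV, hs, h1, hsq, hinj⟩ := exists_continuousOn_matrix_sqrt n
  have hc : ContinuousAt s 1 := hs.continuousAt hU
  have hn : ∀ t : Matrix (Fin n) (Fin n) ℂ → Matrix (Fin n) (Fin n) ℂ, ContinuousAt t 1 →
      t 1 = 1 → t ⁻¹' V ∈ 𝓝 1 := fun t ht h => ht (by rwa [h])
  have e1 := hn s hc h1
  have e2 := hn (fun Z => (s Z)ᵀ) (continuous_id.matrix_transpose.continuousAt.comp hc)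
    (by rw [h1, transpose_one])
  have e3 := hn (fun Z => (s Z)ᴴ * Z)
    ((continuous_id.matrix_conjTranspose.continuousAt.comp hc).mul continuousAt_id)
    (by rw [h1, conjTranspose_one, one_mul])
  have e4 : {Z | (s Z).det ≠ -1} ∈ 𝓝 1 := by
    refine (continuous_id.matrix_det.continuousAt.comp hc) (isOpen_ne.mem_nhds ?_)
    change (s 1).det ≠ -1
    rw [h1, det_one]
    norm_num
  refine ⟨s, _, Filter.inter_mem (Filter.inter_mem hU e1) (Filter.inter_mem e2
    (Filter.inter_mem e3 e4)), hs.mono fun Z hZ => hZ.1.1, h1, ?_⟩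
  rintro Z ⟨⟨hZ, hZ1⟩, hZ2, hZ3, hZ4⟩ hu ht hd
  have hSS := hsq Z hZ
  have hT : (s Z)ᵀ = s Z := hinj _ hZ2 _ hZ1 (by rw [← transpose_mul, hSS, ht])
  have a1 : (s Z)ᴴ * ((s Z)ᴴ * Z) = 1 := by
    rw [← mul_assoc, ← conjTranspose_mul, hSS]
    exact mul_eq_one_comm.1 hu
  have a2 : ((s Z)ᴴ * Z) * (s Z)ᴴ = 1 := mul_eq_one_comm.1 a1
  have hH : (s Z)ᴴ * Z = s Z := by
    refine hinj _ hZ3 _ hZ1 ?_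
    rw [hSS]
    calc (s Z)ᴴ * Z * ((s Z)ᴴ * Z) = ((s Z)ᴴ * Z * (s Z)ᴴ) * Z := by simp only [mul_assoc]
      _ = Z := by rw [a2, one_mul]
  have hdet : (s Z).det = 1 := by
    have h2 : (s Z).det * (s Z).det = 1 := by rw [← det_mul, hSS, hd]
    exact (mul_self_eq_one_iff.1 h2).resolve_right hZ4
  rw [hH] at a2
  obtain ⟨g, hg⟩ := exists_mat_eq a2 hdet
  exact ⟨g, hg, by rw [symMat, hg, hT, hSS]⟩

/-- The action of a group on its cosets. -/
def cosetAct {G : Type*} [Group G] {H : Subgroup G} (g : G) (x : G ⧸ H) : G ⧸ H := g • x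

lemma cosetAct_mk {G : Type*} [Group G] {H : Subgroup G} (g h : G) :
    cosetAct g (QuotientGroup.mk h : G ⧸ H) = QuotientGroup.mk (g * h) := rfl

lemma cosetAct_base {G : Type*} [Group G] {H : Subgroup G} (g : G) :
    cosetAct g (QuotientGroup.mk 1 : G ⧸ H) = QuotientGroup.mk g := by
  rw [cosetAct_mk, mul_one]

lemma cosetAct_base_eq_iff {G : Type*} [Group G] {H : Subgroup G} (g : G) :
    cosetAct g (QuotientGroup.mk 1 : G ⧸ H) = QuotientGroup.mk 1 ↔ g ∈ H := by
  rw [cosetAct_base, eq_comm, QuotientGroup.eq, inv_one, one_mul]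

lemma continuous_cosetAct {G : Type*} [Group G] [TopologicalSpace G] [IsTopologicalGroup G]
    {H : Subgroup G} : Continuous fun p : G × (G ⧸ H) => cosetAct p.1 p.2 :=
  continuous_smul

lemma one_cosetAct {G : Type*} [Group G] {H : Subgroup G} (x : G ⧸ H) : cosetAct 1 x = x :=
  one_smul _ _

lemma mul_cosetAct {G : Type*} [Group G] {H : Subgroup G} (g h : G) (x : G ⧸ H) :
    cosetAct (g * h) x = cosetAct g (cosetAct h x) :=
  mul_smul _ _ _

lemma hasLocalSection_coset (n : ℕ) : HasLocalSection
    (cosetAct : SU n → SU n ⧸ SOinSU n → SU n ⧸ SOinSU n) (QuotientGroup.mk 1) where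
  cont := continuous_cosetAct
  one := one_cosetAct
  mul := mul_cosetAct
  sec := by
    obtain ⟨s, U, hU, hs, h1, hg⟩ := exists_sym_section n
    have hb : cosetMat (QuotientGroup.mk 1 : SU n ⧸ SOinSU n) = 1 := by
      rw [cosetMat_mk, symMat, mat_one, transpose_one, one_mul]
    refine exists_section_of_isEmbedding isEmbedding_mat (fun x => s (cosetMat x))
      (U := cosetMat ⁻¹' U) (continuous_cosetMat.continuousAt (by rwa [hb])) ?_ ?_ ?_
    · exact hs.comp continuous_cosetMat.continuousOn fun x hx => hx.1
    · rw [hb, h1, mat_one]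
    · intro x hx _
      obtain ⟨h, rfl⟩ := QuotientGroup.mk_surjective x
      obtain ⟨g, hg1, hg2⟩ := hg _ hx (symMat_mul_conjTranspose h) (symMat_transpose h)
        (det_symMat h)
      refine ⟨g, hg1, cosetMat_injective ?_⟩
      rw [cosetAct_base, cosetMat_mk, hg2, cosetMat_mk]

end SymmetricSpace
end Pi3

namespace Pi3
open scoped unitInterval Topology.Homotopy Quaternion
open Set

section Conjugation

variable {n : ℕ}

/-- Conjugation by a unitary matrix as an endomorphism of `SU n`. -/
def conjU (W : Matrix (Fin n) (Fin n) ℂ) (hW : Wᴴ * W = 1) : SU n →* SU n where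
  toFun g := ⟨⟨W * mat g * Wᴴ, Matrix.mem_unitaryGroup_iff.2 (by
      rw [star_eq_conjTranspose]
      simp only [conjTranspose_mul, conjTranspose_conjTranspose, mul_assoc]
      rw [← mul_assoc Wᴴ W, hW, one_mul, ← mul_assoc (mat g), mat_mul_conjTranspose, one_mul,
        mul_eq_one_comm.1 hW])⟩, by
      change (W * mat g * Wᴴ).det = 1
      rw [det_mul, det_mul, det_mat, mul_one, ← det_mul, mul_eq_one_comm.1 hW, det_one]⟩
  map_one' := mat_injective (by
    change W * mat 1 * Wᴴ = 1
    rw [mat_one, mul_one, mul_eq_one_comm.1 hW])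
  map_mul' g h := mat_injective (by
    change W * mat (g * h) * Wᴴ = W * mat g * Wᴴ * (W * mat h * Wᴴ)
    rw [mat_mul]
    simp only [mul_assoc]
    rw [← mul_assoc Wᴴ W, hW, one_mul])

lemma mat_conjU (W : Matrix (Fin n) (Fin n) ℂ) (hW : Wᴴ * W = 1) (g : SU n) :
    mat (conjU W hW g) = W * mat g * Wᴴ := rfl

lemma continuous_conjU (W : Matrix (Fin n) (Fin n) ℂ) (hW : Wᴴ * W = 1) :
    Continuous (conjU W hW) :=
  isEmbedding_mat.continuous_iff.2
    ((continuous_const.matrix_mul continuous_mat).matrix_mul continuous_const)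

/-- The endomorphism of homotopy groups induced by conjugation. -/
def piConj (W : Matrix (Fin n) (Fin n) ℂ) (hW : Wᴴ * W = 1) :
    HomotopyGroup (Fin 3) (SU n) 1 →* HomotopyGroup (Fin 3) (SU n) 1 :=
  piHom (conjU W hW) (continuous_conjU W hW) (map_one _)

lemma piConj_surjective (W : Matrix (Fin n) (Fin n) ℂ) (hW : Wᴴ * W = 1) :
    Function.Surjective (piConj W hW) := by
  have hW' : (Wᴴ)ᴴ * Wᴴ = 1 := by rw [conjTranspose_conjTranspose, mul_eq_one_comm.1 hW]
  refine fun a => ⟨piConj Wᴴ hW' a, ?_⟩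
  rw [piConj, piConj, piHom_comp]
  refine piHom_id _ _ _ (fun g => mat_injective ?_) a
  rw [mat_conjU, mat_conjU, conjTranspose_conjTranspose]
  simp only [mul_assoc]
  rw [mul_eq_one_comm.1 hW, mul_one, ← mul_assoc, mul_eq_one_comm.1 hW, one_mul]

end Conjugation

section Multiplications

lemma ofReal_mul_transpose {M : Matrix (Fin 4) (Fin 4) ℝ} (hM : M ∈ rotMat) :
    M.map (algebraMap ℝ ℂ) * (M.map (algebraMap ℝ ℂ))ᴴ = 1 := by
  have h : (M.map (algebraMap ℝ ℂ))ᴴ = Mᵀ.map (algebraMap ℝ ℂ) := by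
    ext i j
    simp
  rw [h, ← Matrix.map_mul, hM.1, Matrix.map_one _ (map_zero _) (map_one _)]

lemma det_ofReal {M : Matrix (Fin 4) (Fin 4) ℝ} (hM : M ∈ rotMat) :
    (M.map (algebraMap ℝ ℂ)).det = 1 := by
  have := (algebraMap ℝ ℂ).map_det M
  rw [hM.2, map_one] at this
  exact this.symm

/-- Left multiplication by unit quaternions as a homomorphism to `SU(4)`. -/
def lhom : Sp1 →* SU 4 where
  toFun q := ⟨⟨(lmat q).map (algebraMap ℝ ℂ),
    Matrix.mem_unitaryGroup_iff.2 (ofReal_mul_transpose (lmat_mem q))⟩, det_ofReal (lmat_mem q)⟩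
  map_one' := mat_injective (by
    change (lmat 1).map (algebraMap ℝ ℂ) = 1
    rw [lmat_one, Matrix.map_one _ (map_zero _) (map_one _)])
  map_mul' p q := mat_injective (by
    change (lmat (p * q)).map (algebraMap ℝ ℂ) = _
    rw [lmat_mul, Matrix.map_mul]
    rfl)

/-- Right multiplication by inverse unit quaternions as a homomorphism to `SU(4)`. -/
def rhom : Sp1 →* SU 4 where
  toFun q := ⟨⟨(rmat q).map (algebraMap ℝ ℂ),
    Matrix.mem_unitaryGroup_iff.2 (ofReal_mul_transpose (rmat_mem q))⟩, det_ofReal (rmat_mem q)⟩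
  map_one' := mat_injective (by
    change (rmat 1).map (algebraMap ℝ ℂ) = 1
    rw [rmat_one, Matrix.map_one _ (map_zero _) (map_one _)])
  map_mul' p q := mat_injective (by
    change (rmat (p * q)).map (algebraMap ℝ ℂ) = _
    rw [rmat_mul, Matrix.map_mul]
    rfl)

lemma mat_lhom (q : Sp1) : mat (lhom q) = (lmat q).map (algebraMap ℝ ℂ) := rfl

lemma mat_rhom (q : Sp1) : mat (rhom q) = (rmat q).map (algebraMap ℝ ℂ) := rfl

lemma continuous_lhom : Continuous lhom :=
  isEmbedding_mat.continuous_iff.2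
    ((continuous_lmat.comp continuous_subtype_val).matrix_map Complex.continuous_ofReal)

lemma continuous_rhom : Continuous rhom :=
  isEmbedding_mat.continuous_iff.2
    ((continuous_rmat.comp continuous_subtype_val).matrix_map Complex.continuous_ofReal)

/-- An orthogonal basis splitting the complexified left multiplications. -/
def splitMat : Matrix (Fin 4) (Fin 4) ℂ :=
  !![1, 0, 0, 1; -Complex.I, 0, 0, Complex.I; 0, -1, 1, 0; 0, -Complex.I, -Complex.I, 0]

lemma splitMat_conjTranspose_mul : splitMatᴴ * splitMat = (2 : ℂ) • 1 := by
  ext i j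
  fin_cases i <;> fin_cases j <;>
    simp [splitMat, Matrix.mul_apply, Fin.sum_univ_four] <;> norm_num

/-- The unitary matrix splitting the complexified left multiplications. -/
def splitU : Matrix (Fin 4) (Fin 4) ℂ := ((√2 : ℝ) : ℂ)⁻¹ • splitMat

lemma sqrt_two_sq : (((√2 : ℝ) : ℂ)⁻¹ * ((√2 : ℝ) : ℂ)⁻¹) * 2 = 1 := by
  rw [← mul_inv, ← Complex.ofReal_mul, Real.mul_self_sqrt (by norm_num)]
  norm_num

lemma splitU_unitary : splitUᴴ * splitU = 1 := by
  have h : star (((√2 : ℝ) : ℂ)⁻¹) = ((√2 : ℝ) : ℂ)⁻¹ := by simp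
  rw [splitU, conjTranspose_smul, h, smul_mul_smul_comm, splitMat_conjTranspose_mul, smul_smul,
    sqrt_two_sq, one_smul]

/-- The rotation exchanging the two blocks. -/
def swapMat (c s : ℝ) : Matrix (Fin 4) (Fin 4) ℂ :=
  !![(c : ℂ), 0, -(s : ℂ), 0; 0, (c : ℂ), 0, -(s : ℂ); (s : ℂ), 0, (c : ℂ), 0; 0, (s : ℂ), 0, (c : ℂ)]

lemma exists_swap_path : ∃ γ : I → SU 4, Continuous γ ∧ γ 0 = 1 ∧ mat (γ 1) = swapMat 0 1 := by
  have hcs : ∀ t : ℝ, ((Real.cos t : ℝ) : ℂ) ^ 2 + ((Real.sin t : ℝ) : ℂ) ^ 2 = 1 := fun t => by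
    exact_mod_cast Real.cos_sq_add_sin_sq t
  have hu : ∀ t : ℝ, swapMat (Real.cos t) (Real.sin t) *
      (swapMat (Real.cos t) (Real.sin t))ᴴ = 1 := fun t => by
    have := hcs t
    ext i j
    fin_cases i <;> fin_cases j <;>
      simp [swapMat, Matrix.mul_apply, Fin.sum_univ_four, -Complex.ofReal_cos,
        -Complex.ofReal_sin] <;> first | linear_combination this | ring
  have hd : ∀ t : ℝ, (swapMat (Real.cos t) (Real.sin t)).det = 1 := fun t => by
    have := hcs t
    generalize Real.cos t = c at *
    generalize Real.sin t = s at *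
    simp [swapMat, det_succ_row_zero, Fin.sum_univ_succ, Fin.succAbove]
    linear_combination ((c : ℂ) ^ 2 + (s : ℂ) ^ 2 + 1) * this
  choose g hg using fun t : ℝ => exists_mat_eq (hu t) (hd t)
  refine ⟨fun t => g (Real.pi / 2 * t), isEmbedding_mat.continuous_iff.2 ?_, mat_injective ?_, ?_⟩
  · have : mat ∘ (fun t : I => g (Real.pi / 2 * t)) =
        fun t : I => swapMat (Real.cos (Real.pi / 2 * t)) (Real.sin (Real.pi / 2 * t)) :=
      funext fun t => hg _
    rw [this]
    have h1 : Continuous fun t : I => ((Real.cos (Real.pi / 2 * t) : ℝ) : ℂ) := by fun_prop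
    have h2 : Continuous fun t : I => ((Real.sin (Real.pi / 2 * t) : ℝ) : ℂ) := by fun_prop
    refine continuous_matrix fun i j => ?_
    fin_cases i <;> fin_cases j <;> simp only [swapMat] <;>
      first
      | exact h1
      | exact h2
      | exact h2.neg
      | exact continuous_const
  · rw [hg]
    ext i j
    fin_cases i <;> fin_cases j <;> simp [swapMat]
  · rw [hg]
    simp

lemma swapMat_conj (q : ℍ[ℝ]) : swapMat 0 1 * iotaMat q * (swapMat 0 1)ᴴ =
    !![1, 0, 0, 0; 0, 1, 0, 0; 0, 0, zc q, wc q; 0, 0, -star (wc q), star (zc q)] := by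
  have h : (swapMat 0 1)ᴴ = !![0, 0, 1, 0; 0, 0, 0, 1; -1, 0, 0, 0; 0, -1, 0, 0] := by
    ext i j
    fin_cases i <;> fin_cases j <;> simp [swapMat]
  rw [h]
  ext i j
  fin_cases i <;> fin_cases j <;>
    simp [swapMat, iotaMat, Matrix.mul_apply, Fin.sum_univ_four]

lemma lmat_mul_splitMat (q : ℍ[ℝ]) : (lmat q).map (algebraMap ℝ ℂ) * splitMat =
    splitMat * (iotaMat q * (swapMat 0 1 * iotaMat q * (swapMat 0 1)ᴴ)) := by
  rw [swapMat_conj]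
  ext i j
  fin_cases i <;> fin_cases j <;>
    simp [lmat, splitMat, iotaMat, Matrix.mul_apply, Fin.sum_univ_four, zc, wc,
      Complex.ext_iff]

lemma lhom_eq (γ : SU 4) (hγ : mat γ = swapMat 0 1) (q : Sp1) :
    lhom q = conjU splitU splitU_unitary (iota q * (γ * iota q * γ⁻¹)) := by
  refine mat_injective ?_
  rw [mat_conjU, mat_lhom]
  simp only [mat_mul, mat_inv, hγ, mat_iota]
  have h : (lmat q).map (algebraMap ℝ ℂ) * splitU =
      splitU * (iotaMat q * (swapMat 0 1 * iotaMat q * (swapMat 0 1)ᴴ)) := by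
    rw [splitU, mul_smul_comm, lmat_mul_splitMat, smul_mul_assoc]
  rw [← h, mul_assoc, mul_eq_one_comm.1 splitU_unitary, mul_one]

/-- The matrix of quaternionic conjugation. -/
def starMat : Matrix (Fin 4) (Fin 4) ℂ := Matrix.diagonal ![1, -1, -1, -1]

lemma starMat_unitary : starMatᴴ * starMat = 1 := by
  ext i j
  fin_cases i <;> fin_cases j <;> simp [starMat]

lemma rhom_eq (q : Sp1) : rhom q = conjU starMat starMat_unitary (lhom q) := by
  refine mat_injective ?_
  rw [mat_conjU, mat_lhom, mat_rhom]
  ext i j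
  fin_cases i <;> fin_cases j <;> simp [starMat, lmat, rmat, Matrix.diagonal_mul, Matrix.mul_diagonal]

lemma piHom_lhom (x : HomotopyGroup (Fin 3) Sp1 1) :
    piHom lhom continuous_lhom (map_one lhom) x =
      piConj splitU splitU_unitary (piHom iota continuous_iota (map_one iota) x) ^ 2 := by
  obtain ⟨γ, hγ, h0, h1⟩ := exists_swap_path
  rw [← map_pow, sq]
  conv_rhs => enter [2, 2]; rw [← piHom_conj_eq γ hγ h0 (piHom iota continuous_iota (map_one iota) x)]
  obtain ⟨f, rfl⟩ := exists_rep x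
  rw [piHom_cls, piHom_cls, piHom_cls, cls_mul_cls, piConj, piHom_cls]
  refine congrArg cls (GenLoop.ext _ _ fun u => ?_)
  exact lhom_eq (γ 1) h1 (f u)

lemma piHom_rhom (x : HomotopyGroup (Fin 3) Sp1 1) :
    piHom rhom continuous_rhom (map_one rhom) x =
      piConj starMat starMat_unitary (piHom lhom continuous_lhom (map_one lhom) x) := by
  obtain ⟨f, rfl⟩ := exists_rep x
  rw [piConj, piHom_cls, piHom_cls, piHom_cls]
  refine congrArg cls (GenLoop.ext _ _ fun u => ?_)
  exact rhom_eq (f u)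

end Multiplications
end Pi3

namespace Pi3
open scoped unitInterval Topology.Homotopy Quaternion
open Set

section Algebra

lemma nonempty_mulEquiv_zmod_two {P Q : Type*} [Group P] [Group Q] (e : P ≃* Multiplicative ℤ)
    (q : P →* Q) (hq : Function.Surjective q) (hk : ∀ x, q x = 1 ↔ ∃ y, x = y ^ 2) :
    Nonempty (Q ≃* Multiplicative (ZMod 2)) := by
  let r : P →* Multiplicative (ZMod 2) :=
    (Int.castAddHom (ZMod 2)).toMultiplicative.comp e.toMonoidHom
  have hr : Function.Surjective r := by
    have h1 : Function.Surjective (Int.castAddHom (ZMod 2)).toMultiplicative := fun z => by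
      obtain ⟨n, hn⟩ := ZMod.intCast_surjective z.toAdd
      exact ⟨Multiplicative.ofAdd n, congrArg Multiplicative.ofAdd hn⟩
    exact h1.comp e.surjective
  have hker : q.ker = r.ker := by
    ext x
    rw [MonoidHom.mem_ker, MonoidHom.mem_ker, hk]
    have hx : r x = 1 ↔ (2 : ℤ) ∣ (e x).toAdd := by
      exact ZMod.intCast_zmod_eq_zero_iff_dvd _ 2
    rw [hx]
    constructor
    · rintro ⟨y, rfl⟩
      rw [map_pow, toAdd_pow]
      exact ⟨(e y).toAdd, by simp⟩
    · rintro ⟨m, hm⟩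
      refine ⟨e.symm (Multiplicative.ofAdd m), e.injective ?_⟩
      rw [map_pow, MulEquiv.apply_symm_apply]
      apply Multiplicative.toAdd.injective
      rw [hm, toAdd_pow, toAdd_ofAdd]
      simp
  exact ⟨(QuotientGroup.quotientKerEquivOfSurjective q hq).symm.trans
    ((QuotientGroup.quotientMulEquivOfEq hker).trans
      (QuotientGroup.quotientKerEquivOfSurjective r hr))⟩

end Algebra

section Assembly

instance (n : ℕ) : T2Space (SU n ⧸ SOinSU n) :=
  T2Space.of_injective_continuous cosetMat_injective continuous_cosetMat

lemma lhom_mem (q : Sp1) : lhom q ∈ SOinSU 4 := ⟨lmat q, rfl⟩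

lemma rhom_mem (q : Sp1) : rhom q ∈ SOinSU 4 := ⟨rmat q, rfl⟩

lemma exists_rotMat {g : SU 4} (hg : g ∈ SOinSU 4) :
    (mat g).map Complex.re ∈ rotMat ∧
      ((mat g).map Complex.re).map (algebraMap ℝ ℂ) = mat g := by
  obtain ⟨B, hB⟩ := hg
  change mat g = B.map (algebraMap ℝ ℂ) at hB
  have hre : (mat g).map Complex.re = B := by
    rw [hB]
    ext i j
    simp
  have hinj : Function.Injective fun M : Matrix (Fin 4) (Fin 4) ℝ => M.map (algebraMap ℝ ℂ) :=
    Matrix.map_injective (algebraMap ℝ ℂ).injective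
  rw [hre, hB]
  refine ⟨⟨hinj ?_, ?_⟩, rfl⟩
  · have h := mat_mul_conjTranspose g
    have h' : (B.map (algebraMap ℝ ℂ))ᴴ = Bᵀ.map (algebraMap ℝ ℂ) := by
      ext i j
      simp
    rw [hB, h', ← Matrix.map_mul] at h
    dsimp only
    rw [h, Matrix.map_one _ (map_zero _) (map_one _)]
  · have h := det_mat g
    rw [hB] at h
    have h2 := (algebraMap ℝ ℂ).map_det B
    rw [RingHom.mapMatrix_apply, h] at h2
    exact (algebraMap ℝ ℂ).injective (h2.trans (map_one _).symm)

/-- Loops of rotations in `SU(4)` are products of left and right multiplications. -/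
lemma exists_lhom_rhom {k : ℕ} {F : (Fin (k + 2) → I) → SU 4} (hF : Continuous F)
    (hm : ∀ u, F u ∈ SOinSU 4) (hb : ∀ u ∈ Cube.boundary (Fin (k + 2)), F u = 1) :
    ∃ f g : Ω^ (Fin (k + 2)) Sp1 1, ∀ u, F u = lhom (f u) * rhom (g u) := by
  have hR : Continuous fun u => (mat (F u)).map Complex.re :=
    (continuous_mat.comp hF).matrix_map Complex.continuous_re
  obtain ⟨L, hL⟩ := exists_spin_loop (mkLoop _ hR fun u hu => by
    rw [hb u hu, mat_one, Matrix.map_one _ Complex.zero_re Complex.one_re])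
    (fun u => (exists_rotMat (hm u)).1)
  refine ⟨mapLoop Prod.fst continuous_fst rfl L, mapLoop Prod.snd continuous_snd rfl L,
    fun u => mat_injective ?_⟩
  have h := hL u
  rw [mkLoop_apply, rotAct, mul_one] at h
  rw [mat_mul, mat_lhom, mat_rhom, mapLoop_apply, mapLoop_apply, ← Matrix.map_mul, h,
    (exists_rotMat (hm u)).2]

lemma htpyIn_SOinSU {F : (Fin 2 → I) → SU 4} (hF : Continuous F)
    (hm : ∀ u, F u ∈ SOinSU 4) (hb : ∀ u ∈ Cube.boundary (Fin 2), F u = 1) :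
    HtpyIn {g | g ∈ SOinSU 4} (Cube.boundary (Fin 2)) F (fun _ => 1) := by
  obtain ⟨f, g, hfg⟩ := exists_lhom_rhom (k := 0) hF hm hb
  have hd : 1 + 1 + 2 ≤ Module.finrank ℝ ℍ[ℝ] := by rw [finrank_quat]
  obtain ⟨H, hH, h0, h1, hA⟩ := exists_homotopy (cls_eq_one.1 (pi_sphere_eq_one hd 1 (cls f)))
  obtain ⟨H', hH', h0', h1', hA'⟩ :=
    exists_homotopy (cls_eq_one.1 (pi_sphere_eq_one hd 1 (cls g)))
  refine ⟨fun p => lhom (H p) * rhom (H' p),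
    (continuous_lhom.comp hH).mul (continuous_rhom.comp hH'), fun u => ?_, fun u => ?_,
    fun p => mul_mem (lhom_mem _) (rhom_mem _), fun t u hu => ?_⟩
  · dsimp only
    rw [h0, h0', hfg]
  · dsimp only
    rw [h1, h1']
    change lhom 1 * rhom 1 = 1
    rw [map_one, map_one, one_mul]
  · dsimp only
    rw [hA t u hu, hA' t u hu, hb u hu, map_one, map_one, one_mul]

/-- The homomorphism induced by the projection to the symmetric space. -/
def piCoset : HomotopyGroup (Fin 3) (SU 4) 1 →*
    HomotopyGroup (Fin 3) (SU 4 ⧸ SOinSU 4) (QuotientGroup.mk 1) :=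
  piHom QuotientGroup.mk QuotientGroup.continuous_mk rfl

lemma range_cosetAct : (range fun g : SU 4 => cosetAct g (QuotientGroup.mk 1 : SU 4 ⧸ SOinSU 4)) =
    univ := by
  refine eq_univ_of_forall fun x => ?_
  obtain ⟨g, rfl⟩ := QuotientGroup.mk_surjective x
  exact ⟨g, cosetAct_base g⟩

lemma stabilizer_cosetAct : {g : SU 4 | cosetAct g (QuotientGroup.mk 1 : SU 4 ⧸ SOinSU 4) =
    QuotientGroup.mk 1} = {g | g ∈ SOinSU 4} :=
  Set.ext fun g => cosetAct_base_eq_iff g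

lemma piCoset_surjective : Function.Surjective piCoset := by
  intro a
  obtain ⟨f, rfl⟩ := exists_rep a
  have h := hasLocalSection_coset 4
  obtain ⟨F, hF, hact, hF1⟩ := h.lift_loop (k := 2) f fun u => by
    have : f u ∈ (univ : Set (SU 4 ⧸ SOinSU 4)) := trivial
    rwa [← range_cosetAct] at this
  obtain ⟨F', hF'⟩ := h.correct hF hF1 (by
    rw [stabilizer_cosetAct]
    refine htpyIn_SOinSU (hF.comp (continuous_cons.comp (continuous_const.prodMk continuous_id)))
      (fun y => ?_) (fun y hy => hF1 _ (cons_mem_openBox.2 (Or.inr hy)))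
    rw [← cosetAct_base_eq_iff, hact, loop_bdry f (cons_mem_boundary.2 (Or.inr (Or.inl rfl)))])
  refine ⟨cls F', ?_⟩
  rw [piCoset, piHom_cls]
  refine congrArg cls (GenLoop.ext _ _ fun u => ?_)
  rw [mapLoop_apply, ← cosetAct_base, hF', hact]

lemma piCoset_lhom (x : HomotopyGroup (Fin 3) Sp1 1) :
    piCoset (piHom lhom continuous_lhom (map_one lhom) x) = 1 := by
  obtain ⟨f, rfl⟩ := exists_rep x
  rw [piCoset, piHom_cls, piHom_cls, ← cls_const]
  refine congrArg cls (GenLoop.ext _ _ fun u => ?_)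
  rw [mapLoop_apply, mapLoop_apply, ← cosetAct_base]
  exact (cosetAct_base_eq_iff _).2 (lhom_mem _)

lemma exists_lhom_eq_sq (y : HomotopyGroup (Fin 3) (SU 4) 1) :
    ∃ x, piHom lhom continuous_lhom (map_one lhom) x = y ^ 2 := by
  obtain ⟨z, rfl⟩ := piConj_surjective splitU splitU_unitary y
  obtain ⟨x, rfl⟩ := piHom_iota_bijective.2 z
  exact ⟨x, piHom_lhom x⟩

lemma piCoset_eq_one_iff (a : HomotopyGroup (Fin 3) (SU 4) 1) :
    piCoset a = 1 ↔ ∃ y, a = y ^ 2 := by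
  constructor
  · obtain ⟨f, rfl⟩ := exists_rep a
    intro ha
    rw [piCoset, piHom_cls, cls_eq_one] at ha
    have hn := htpyIn_of_homotopic ha
    obtain ⟨F', hf, hK⟩ := (hasLocalSection_coset 4).lift_null (F := f) (loop_continuous f) (by
      rw [range_cosetAct]
      simp only [cosetAct_base]
      exact hn)
    have hc : Continuous F' := by
      obtain ⟨K, hK, -, h1, -⟩ := hf
      have : F' = fun u => K (1, u) := funext fun u => (h1 u).symm
      rw [this]
      fun_prop
    have hb : ∀ u ∈ Cube.boundary (Fin 3), F' u = 1 := fun u hu => by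
      obtain ⟨K, -, -, h1, -, hA⟩ := hf
      rw [← h1, hA 1 u hu, loop_bdry f hu]
    obtain ⟨l, r, hlr⟩ := exists_lhom_rhom (k := 1) hc
      (fun u => (cosetAct_base_eq_iff _).1 (hK u)) hb
    have e1 : cls f = piHom lhom continuous_lhom (map_one lhom) (cls l) *
        piHom rhom continuous_rhom (map_one rhom) (cls r) := by
      rw [piHom_cls, piHom_cls, cls_mul_cls, cls_eq_cls]
      obtain ⟨K, hKc, h0, h1, -, hA⟩ := hf
      refine homotopic_of _ _ K hKc h0 (fun u => ?_) fun t u hu => ?_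
      · rw [h1, hlr]
        rfl
      · rw [hA t u hu, loop_bdry f hu]
    rw [piHom_rhom, piHom_lhom, piHom_lhom, map_pow] at e1
    obtain ⟨e⟩ := pi3_SU4
    have hcomm : ∀ x y : HomotopyGroup (Fin 3) (SU 4) 1, x * y = y * x := fun x y =>
      e.injective (by rw [map_mul, map_mul, mul_comm])
    exact ⟨_, e1.trans (Commute.mul_pow (hcomm _ _) 2).symm⟩
  · rintro ⟨y, rfl⟩
    obtain ⟨x, hx⟩ := exists_lhom_eq_sq y
    rw [← hx]
    exact piCoset_lhom x

lemma pi3_coset : Nonempty (HomotopyGroup (Fin 3) (SU 4 ⧸ SOinSU 4) (QuotientGroup.mk 1) ≃*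
    Multiplicative (ZMod 2)) := by
  obtain ⟨e⟩ := pi3_SU4
  exact nonempty_mulEquiv_zmod_two e piCoset piCoset_surjective piCoset_eq_one_iff

end Assembly
end Pi3

/-- **Instantons in Partially Broken Gauge Groups**: `π₃(SU(4)/SO(4)) ≅ ℤ/2ℤ`. -/
theorem pi3_SU4_quotient_SO4 :
    Nonempty ((π_ 3 ((↥(SU 4)) ⧸ SOinSU 4) (QuotientGroup.mk 1)) ≃* Multiplicative (ZMod 2)) := by
  exact Pi3.pi3_coset

end
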